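/- arXiv:0911.5661 — 5 statements merged into one kernel-verified Lean document; each statement's English description precedes it below -/
import Mathlib

section
/- Fix 0 ≤ i ≤ g, an integer l with max(0, i+k−g) ≤ l ≤ min(i,k), and a subset J ⊆ {1,…,i} with #J = l. Let Z_{g,i,k,J} be the set of flags (ℱ_j)_{j=0}^{i} ∈ Flag_i(𝒱) such that for every j ∈ {1,…,i}: ℱ_j = (ℱ_j ∩ 𝒱₁) ⊕ (ℱ_j ∩ 𝒱₂), and ℱ_j ∩ 𝒱₁ ≠ ℱ_{j−1} ∩ 𝒱₁ if and only if j ∈ J. Define φ, φ' : {0,…,i} → ℕ by φ(j) = #(J ∩ {1,…,j}) and φ'(j) = j − φ(j). Then the map α_J : Flag_l(𝒱₁) × Flag_{i−l}(𝒱₂) → Z_{g,i,k,J} sending ((ℱ_j)_{j=0}^{l}, (𝒢_j)_{j=0}^{i−l}) to the flag (ℱ_{φ(j)} ⊕ 𝒢_{φ'(j)})_{j=0}^{i} is a well-defined bijection. -/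
open Module

/-- `F` is a flag `(ℱ_j)_{j=0}^{i}` of subspaces of `U`: increasing, with `dim ℱ_j = j`. -/
def IsFlagIn (K : Type*) {V : Type*} [Field K] [AddCommGroup V] [Module K V]
    (i : ℕ) (U : Submodule K V) (F : Fin (i + 1) → Submodule K V) : Prop :=
  Monotone F ∧ (∀ j, F j ≤ U) ∧ ∀ j : Fin (i + 1), finrank K (F j) = (j : ℕ)

/-- `φ (j) = #(J ∩ {1, …, j})` (for `J ⊆ {1, …, i}`). -/
def phiJ (J : Finset ℕ) (j : ℕ) : ℕ := (J.filter (· ≤ j)).card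

/-- The set `Z_{g,i,k,J}` of flags `(ℱ_j)_{j=0}^{i}` in `𝒱` such that for all `1 ≤ j ≤ i`,
`ℱ_j = (ℱ_j ∩ 𝒱₁) ⊕ (ℱ_j ∩ 𝒱₂)` and `ℱ_j ∩ 𝒱₁ ≠ ℱ_{j-1} ∩ 𝒱₁ ↔ j ∈ J`. -/
def ZJ (K : Type*) {V : Type*} [Field K] [AddCommGroup V] [Module K V]
    (i : ℕ) (V1 V2 : Submodule K V) (J : Finset ℕ) :
    Set (Fin (i + 1) → Submodule K V) :=
  {F | IsFlagIn K i ⊤ F ∧ ∀ j : ℕ, ∀ _ : 1 ≤ j, ∀ _ : j ≤ i,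
    F ⟨j, by omega⟩ = (F ⟨j, by omega⟩ ⊓ V1) ⊔ (F ⟨j, by omega⟩ ⊓ V2) ∧
    ((F ⟨j, by omega⟩ ⊓ V1 ≠ F ⟨j - 1, by omega⟩ ⊓ V1) ↔ j ∈ J)}

theorem phiJ_zero {J : Finset ℕ} {i : ℕ} (hJ : J ⊆ Finset.Icc 1 i) : phiJ J 0 = 0 := by
  unfold phiJ
  rw [Finset.card_eq_zero, Finset.filter_eq_empty_iff]
  intro x hx
  have := Finset.mem_Icc.1 (hJ hx)
  omega

theorem phiJ_last {J : Finset ℕ} {i : ℕ} (hJ : J ⊆ Finset.Icc 1 i) : phiJ J i = J.card := by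
  unfold phiJ
  rw [Finset.filter_true_of_mem]
  intro x hx
  have := Finset.mem_Icc.1 (hJ hx)
  omega

theorem phiJ_succ (J : Finset ℕ) (j : ℕ) :
    phiJ J (j + 1) = phiJ J j + if j + 1 ∈ J then 1 else 0 := by
  unfold phiJ
  split_ifs with h
  · have : J.filter (· ≤ j + 1) = insert (j + 1) (J.filter (· ≤ j)) := by
      ext x
      simp only [Finset.mem_filter, Finset.mem_insert]
      constructor
      · rintro ⟨h1, h2⟩
        by_cases hx : x = j + 1
        · exact Or.inl hx
        · exact Or.inr ⟨h1, by omega⟩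
      · rintro (rfl | ⟨h1, h2⟩)
        · exact ⟨h, le_rfl⟩
        · exact ⟨h1, by omega⟩
    rw [this, Finset.card_insert_of_notMem]
    simp
  · congr 1
    ext x
    simp only [Finset.mem_filter]
    constructor
    · rintro ⟨h1, h2⟩
      have : x ≠ j + 1 := by rintro rfl; exact h h1
      exact ⟨h1, by omega⟩
    · rintro ⟨h1, h2⟩
      exact ⟨h1, by omega⟩

theorem nat_ivt (f : ℕ → ℕ) (h0 : f 0 = 0) (hs : ∀ j, f (j + 1) ≤ f j + 1) (n a : ℕ)
    (ha : a ≤ f n) : ∃ j ≤ n, f j = a := by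
  induction n with
  | zero => exact ⟨0, le_rfl, by omega⟩
  | succ n ih =>
    by_cases h : a ≤ f n
    · obtain ⟨j, hj, h⟩ := ih h
      exact ⟨j, by omega, h⟩
    · have := hs n
      exact ⟨n + 1, le_rfl, by omega⟩

theorem phiJ_mono (J : Finset ℕ) : Monotone (phiJ J) :=
  monotone_nat_of_le_succ fun n => by rw [phiJ_succ]; omega

theorem phiJ_le {J : Finset ℕ} {i : ℕ} (hJ : J ⊆ Finset.Icc 1 i) (j : ℕ) : phiJ J j ≤ j := by
  induction j with
  | zero => rw [phiJ_zero hJ]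
  | succ n ih => rw [phiJ_succ]; split_ifs <;> omega

theorem psiJ_mono (J : Finset ℕ) : Monotone (fun j => j - phiJ J j) :=
  monotone_nat_of_le_succ fun n => by
    rw [phiJ_succ]; split_ifs <;> omega

section
variable {K V : Type*} [Field K] [AddCommGroup V] [Module K V]

theorem sup_inf_left_part {V1 V2 A B : Submodule K V} (h : Disjoint V1 V2) (hA : A ≤ V1)
    (hB : B ≤ V2) : (A ⊔ B) ⊓ V1 = A := by
  rw [sup_inf_assoc_of_le B hA, ((h.mono_right hB).symm).eq_bot, sup_bot_eq]

theorem sup_inf_right_part {V1 V2 A B : Submodule K V} (h : Disjoint V1 V2) (hA : A ≤ V1)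
    (hB : B ≤ V2) : (A ⊔ B) ⊓ V2 = B := by
  rw [sup_comm]; exact sup_inf_left_part h.symm hB hA

theorem finrank_sup_parts [FiniteDimensional K V] {V1 V2 A B : Submodule K V}
    (h : Disjoint V1 V2) (hA : A ≤ V1)
    (hB : B ≤ V2) : finrank K (A ⊔ B : Submodule K V) = finrank K A + finrank K B := by
  have := Submodule.finrank_sup_add_finrank_inf_eq A B
  rw [(h.mono hA hB).eq_bot, finrank_bot] at this
  omega

/-- Extracting a flag from an increasing family in which every dimension up to `l` occurs. -/
theorem exists_flag [FiniteDimensional K V] (U : Submodule K V) (i l : ℕ) (f : ℕ → ℕ)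
    (hf : Monotone f) (hfs : ∀ a ≤ l, ∃ j ≤ i, f j = a)
    (G : Fin (i + 1) → Submodule K V) (hG : Monotone G) (hU : ∀ j, G j ≤ U)
    (hd : ∀ j : Fin (i + 1), finrank K (G j) = f j) :
    ∃ A : Fin (l + 1) → Submodule K V, IsFlagIn K l U A ∧
      ∀ (j : Fin (i + 1)) (a : Fin (l + 1)), (a : ℕ) = f j → A a = G j := by
  choose! s hs1 hs2 using hfs
  have hal : ∀ a : Fin (l + 1), (a : ℕ) ≤ l := fun a => by omega
  refine ⟨fun a => G ⟨s a, Nat.lt_succ_of_le (hs1 a (hal a))⟩, ⟨?_, fun a => hU _, ?_⟩, ?_⟩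
  · intro a b hab
    rcases hab.eq_or_lt with rfl | hlt
    · exact le_rfl
    · apply hG
      by_contra hc
      have h1 : s b ≤ s a := by
        have : ¬ (s a ≤ s b) := hc
        omega
      have h2 := hf h1
      rw [hs2 _ (hal a), hs2 _ (hal b)] at h2
      have : (a : ℕ) < b := hlt
      omega
  · intro a
    rw [hd]
    exact hs2 _ (hal a)
  · intro j a haj
    have hr : finrank K (G ⟨s a, Nat.lt_succ_of_le (hs1 a (hal a))⟩) = finrank K (G j) := by
      rw [hd, hd, ← haj]; exact hs2 _ (hal a)
    rcases le_total (⟨s a, Nat.lt_succ_of_le (hs1 a (hal a))⟩ : Fin (i + 1)) j with h | h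
    · exact Submodule.eq_of_le_of_finrank_eq (hG h) hr
    · exact (Submodule.eq_of_le_of_finrank_eq (hG h) hr.symm).symm

end

/-- Let `𝒱 = 𝒱₁ ⊕ 𝒱₂` with `dim 𝒱 = g`, `dim 𝒱₁ = k`, `dim 𝒱₂ = g - k`.
Fix `0 ≤ i ≤ g`, `max (0, i+k-g) ≤ l ≤ min (i, k)` and `J ⊆ {1, …, i}` with `#J = l`.
Then the shuffle map `α_J`, sending a pair of flags `((ℱ_j)_{j≤l}, (𝒢_j)_{j≤i-l})` in
`𝒱₁ × 𝒱₂` to the flag `(ℱ_{φ(j)} ⊕ 𝒢_{φ'(j)})_{j≤i}` (with `φ (j) = #(J ∩ {1,…,j})` and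
`φ' (j) = j - φ (j)`), is a well-defined bijection onto `Z_{g,i,k,J}`.
(The `min`s in the index arithmetic are redundant under the stated hypotheses and are only
there to make the bundled index proofs go through.) -/
theorem stmt5 {K V : Type*} [Field K] [AddCommGroup V] [Module K V] [FiniteDimensional K V]
    (g k : ℕ) (hg : finrank K V = g) (V1 V2 : Submodule K V)
    (hcompl : IsCompl V1 V2) (hk1 : finrank K V1 = k) (hk2 : finrank K V2 = g - k)
    (i l : ℕ) (hi : i ≤ g) (hl1 : max 0 (i + k - g) ≤ l) (hl2 : l ≤ min i k)
    (J : Finset ℕ) (hJ : J ⊆ Finset.Icc 1 i) (hJcard : J.card = l) :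
    Set.BijOn
      (fun pr : (Fin (l + 1) → Submodule K V) × (Fin (i - l + 1) → Submodule K V) =>
        fun j : Fin (i + 1) =>
          pr.1 ⟨min (phiJ J (j : ℕ)) l, by omega⟩ ⊔
          pr.2 ⟨min ((j : ℕ) - phiJ J (j : ℕ)) (i - l), by omega⟩)
      {pr | IsFlagIn K l V1 pr.1 ∧ IsFlagIn K (i - l) V2 pr.2}
      (ZJ K i V1 V2 J) := by
  have hd := hcompl.disjoint
  have hli : l ≤ i := by omega
  have hlast : phiJ J i = l := by rw [phiJ_last hJ, hJcard]
  have hphil : ∀ j : Fin (i + 1), phiJ J j ≤ l := fun j =>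
    hlast ▸ phiJ_mono J (Nat.le_of_lt_succ j.2)
  have hpsil : ∀ j : Fin (i + 1), (j : ℕ) - phiJ J j ≤ i - l := fun j =>
    hlast ▸ psiJ_mono J (Nat.le_of_lt_succ j.2)
  have hs1 : ∀ a ≤ l, ∃ j ≤ i, phiJ J j = a := fun a ha =>
    nat_ivt (phiJ J) (phiJ_zero hJ) (fun j => by rw [phiJ_succ]; split_ifs <;> omega) i a
      (by omega)
  have hs2 : ∀ a ≤ i - l, ∃ j ≤ i, j - phiJ J j = a := fun a ha =>
    nat_ivt (fun j => j - phiJ J j) (by simp)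
      (fun j => by rw [phiJ_succ]; split_ifs <;> omega) i a
      (by omega)
  refine ⟨?_, ?_, ?_⟩
  · rintro ⟨A, B⟩ ⟨⟨hA1, hA2, hA3⟩, ⟨hB1, hB2, hB3⟩⟩
    refine ⟨⟨?_, fun _ => le_top, ?_⟩, ?_⟩
    · intro j j' hjj
      apply sup_le_sup
      · apply hA1
        have := phiJ_mono J (show (j : ℕ) ≤ j' from hjj)
        rw [Fin.mk_le_mk]
        omega
      · apply hB1
        have := psiJ_mono J (show (j : ℕ) ≤ j' from hjj)
        dsimp only at this
        rw [Fin.mk_le_mk]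
        omega
    · intro j
      have h1 := hphil j
      have h2 := hpsil j
      have h3 := phiJ_le hJ (j : ℕ)
      dsimp only
      rw [finrank_sup_parts hd (hA2 _) (hB2 _), hA3, hB3]
      dsimp only
      omega
    · intro j hj1 hj2
      dsimp only
      simp only [sup_inf_left_part hd (hA2 _) (hB2 _), sup_inf_right_part hd (hA2 _) (hB2 _),
        true_and]
      obtain ⟨n, rfl⟩ : ∃ n, j = n + 1 := ⟨j - 1, by omega⟩
      have h1 := hphil ⟨n + 1, by omega⟩
      have h2 := hphil ⟨n, by omega⟩
      have h3 := phiJ_succ J n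
      dsimp only at h1 h2
      constructor
      · intro hne
        by_contra hc
        rw [if_neg hc] at h3
        apply hne
        congr 2
        simp [h3]
      · intro hmem heq
        rw [if_pos hmem] at h3
        have h4 := congrArg (fun W : Submodule K V => finrank K W) heq
        rw [hA3, hA3] at h4
        simp only [Nat.add_sub_cancel] at h4
        omega
  · rintro ⟨A, B⟩ ⟨⟨hA1, hA2, hA3⟩, ⟨hB1, hB2, hB3⟩⟩ ⟨A', B'⟩
      ⟨⟨hA1', hA2', hA3'⟩, ⟨hB1', hB2', hB3'⟩⟩ heq
    dsimp only at *
    refine Prod.ext (funext fun a => ?_) (funext fun a => ?_)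
    · obtain ⟨j, hj, hja⟩ := hs1 a (by omega)
      have h := congrArg (· ⊓ V1) (congrFun heq ⟨j, by omega⟩)
      dsimp only at h
      rw [sup_inf_left_part hd (hA2 _) (hB2 _), sup_inf_left_part hd (hA2' _) (hB2' _)] at h
      have e : (⟨min (phiJ J j) l, by omega⟩ : Fin (l + 1)) = a := by
        apply Fin.ext
        dsimp only
        omega
      rw [e] at h
      exact h
    · obtain ⟨j, hj, hja⟩ := hs2 a (by omega)
      have h := congrArg (· ⊓ V2) (congrFun heq ⟨j, by omega⟩)
      dsimp only at h
      rw [sup_inf_right_part hd (hA2 _) (hB2 _), sup_inf_right_part hd (hA2' _) (hB2' _)] at h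
      have e : (⟨min (j - phiJ J j) (i - l), by omega⟩ : Fin (i - l + 1)) = a := by
        apply Fin.ext
        dsimp only
        omega
      rw [e] at h
      exact h
  · rintro F ⟨⟨hF1, -, hF3⟩, hF⟩
    have hsplit : ∀ j : Fin (i + 1), F j = (F j ⊓ V1) ⊔ (F j ⊓ V2) := by
      intro j
      by_cases hj : (j : ℕ) = 0
      · have h := hF3 j
        rw [hj, Submodule.finrank_eq_zero] at h
        simp [h]
      · exact (hF j (by omega) (by omega)).1
    have hsum : ∀ j : Fin (i + 1), finrank K (F j ⊓ V1 : Submodule K V) +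
        finrank K (F j ⊓ V2 : Submodule K V) = j := by
      intro j
      rw [← finrank_sup_parts hd inf_le_right inf_le_right, ← hsplit j, hF3]
    have hdim : ∀ (j : ℕ) (hj : j < i + 1),
        finrank K (F ⟨j, hj⟩ ⊓ V1 : Submodule K V) = phiJ J j := by
      intro j
      induction j with
      | zero =>
        intro hj
        have h := hsum ⟨0, hj⟩
        rw [phiJ_zero hJ]
        dsimp only at h
        omega
      | succ n ih =>
        intro hj
        have ih := ih (by omega)
        have e1 := hsum ⟨n, by omega⟩
        have e2 := hsum ⟨n + 1, hj⟩
        have hle : F ⟨n, by omega⟩ ≤ F ⟨n + 1, hj⟩ := hF1 (by rw [Fin.mk_le_mk]; omega)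
        have m1 := Submodule.finrank_mono (inf_le_inf_right V1 hle)
        have m2 := Submodule.finrank_mono (inf_le_inf_right V2 hle)
        have hiff := (hF (n + 1) (by omega) (by omega)).2
        simp only [Nat.add_sub_cancel] at hiff
        rw [phiJ_succ]
        dsimp only at e1 e2
        split_ifs with hmem
        · have hne := hiff.2 hmem
          have : finrank K (F ⟨n, by omega⟩ ⊓ V1 : Submodule K V) ≠
              finrank K (F ⟨n + 1, hj⟩ ⊓ V1 : Submodule K V) := fun hc =>
            hne (Submodule.eq_of_le_of_finrank_eq (inf_le_inf_right V1 hle) hc).symm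
          omega
        · have heq := not_not.1 (mt hiff.1 hmem)
          rw [heq, ih, add_zero]
    obtain ⟨A, hA, hA'⟩ := exists_flag V1 i l (phiJ J) (phiJ_mono J) hs1 (fun j => F j ⊓ V1)
      (fun a b h => inf_le_inf_right _ (hF1 h)) (fun j => inf_le_right) (fun j => hdim j j.2)
    obtain ⟨B, hB, hB'⟩ := exists_flag V2 i (i - l) (fun j => j - phiJ J j) (psiJ_mono J) hs2
      (fun j => F j ⊓ V2)
      (fun a b h => inf_le_inf_right _ (hF1 h)) (fun j => inf_le_right)
      (fun j => by
        have h1 := hdim j j.2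
        have h2 := hsum j
        dsimp only [Fin.eta] at h1 ⊢
        omega)
    refine ⟨(A, B), ⟨hA, hB⟩, funext fun j => ?_⟩
    dsimp only
    rw [hA' j _ (min_eq_left (hphil j)), hB' j _ (min_eq_left (hpsil j))]
    exact (hsplit j).symm
end

section
/- Let g ≥ 1 and let F : 𝔽^{2g} → 𝔽^{2g} be the σ-semilinear map with F(e_i) = e_i and F(e_{g+i}) = 0 for 1 ≤ i ≤ g, and V : 𝔽^{2g} → 𝔽^{2g} the σ⁻¹-semilinear map with V(e_i) = 0 and V(e_{g+i}) = e_{g+i} for 1 ≤ i ≤ g. Then the set of symplectic flags (W_j)_{j=0}^{g} in 𝔽^{2g} stable under F and V is finite of cardinality 2^g · ∏_{l=1}^{g} (p^l − 1) / (p − 1)^g. -/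
/-- The set of symplectic flags `0 = W_0 ⊂ W_1 ⊂ ⋯ ⊂ W_g` in `𝔽^{2g}` (with `dim W_j = j`,
`W_g` totally isotropic for the alternating form `B`) that are stable under `F` and `V`.
The index set of the standard basis is `Fin g ⊕ Fin g`, with `e_i = Pi.single (inl i) 1`
and `e_{g+i} = Pi.single (inr i) 1`. -/
def StableSympFlags {𝔽 : Type*} [Field 𝔽] (g : ℕ)
    (B : (Fin g ⊕ Fin g → 𝔽) → (Fin g ⊕ Fin g → 𝔽) → 𝔽)
    (F V : (Fin g ⊕ Fin g → 𝔽) → (Fin g ⊕ Fin g → 𝔽)) :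
    Set (Fin (g + 1) → Submodule 𝔽 (Fin g ⊕ Fin g → 𝔽)) :=
  {W | W 0 = ⊥ ∧ Monotone W ∧ (∀ j : Fin (g + 1), Module.finrank 𝔽 (W j) = (j : ℕ)) ∧
    (∀ x ∈ W (Fin.last g), ∀ y ∈ W (Fin.last g), B x y = 0) ∧
    ∀ j, ∀ x ∈ W j, F x ∈ W j ∧ V x ∈ W j}

section aux
open Module

theorem chain_count {X : Type*} [Finite X] (x0 : X) (R : X → X → Prop) (Q : ℕ → X → Prop)
    (c g : ℕ) (M : ℕ → ℕ) (h0 : Q 0 x0) (hs : ∀ k x y, Q k x → R x y → Q (k+1) y)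
    (hc : ∀ k x, k < g → Q k x → {y | R x y}.ncard * c = M k) (n : ℕ) (hn : n ≤ g) :
    (∀ W : Fin (n+1) → X, (W 0 = x0 ∧ ∀ i : Fin n, R (W i.castSucc) (W i.succ)) → Q n (W (Fin.last n))) ∧
    {W : Fin (n+1) → X | W 0 = x0 ∧ ∀ i : Fin n, R (W i.castSucc) (W i.succ)}.ncard * c ^ n
      = ∏ k ∈ Finset.range n, M k := by
  classical
  induction n with
  | zero =>
    constructor
    · rintro W ⟨h, -⟩
      simpa [h] using h0
    · have : {W : Fin (0+1) → X | W 0 = x0 ∧ ∀ i : Fin 0, R (W i.castSucc) (W i.succ)} = {fun _ => x0} := by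
        ext W
        simp only [Set.mem_ofPred_eq, Set.mem_singleton_iff]
        constructor
        · rintro ⟨h, -⟩
          funext i
          rw [show i = 0 from Fin.ext (by omega), h]
        · rintro rfl
          simp
      rw [this]; simp
  | succ n ih =>
    obtain ⟨ih1, ih2⟩ := ih (by omega)
    constructor
    · rintro W ⟨h, h'⟩
      have := ih1 (fun i => W i.castSucc) ⟨by simpa using h, fun i => h' i.castSucc⟩
      exact hs _ _ _ this (h' (Fin.last n))
    · set S := {W : Fin (n+1) → X | W 0 = x0 ∧ ∀ i : Fin n, R (W i.castSucc) (W i.succ)} with hS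
      set S' := {W : Fin (n+1+1) → X | W 0 = x0 ∧ ∀ i : Fin (n+1), R (W i.castSucc) (W i.succ)} with hS'
      have : Fintype X := Fintype.ofFinite X
      have key : S'.ncard * c = S.ncard * M n := by
        rw [Set.ncard_eq_toFinset_card' S', Set.ncard_eq_toFinset_card' S]
        rw [Finset.card_eq_sum_card_fiberwise (f := fun W : Fin (n+1+1) → X => fun i : Fin (n+1) => W i.castSucc) (t := S.toFinset)]
        · rw [Finset.sum_mul, Finset.card_eq_sum_ones, Finset.sum_mul]
          refine Finset.sum_congr rfl fun W hW => ?_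
          rw [one_mul]
          have hW' : W ∈ S := by simpa using hW
          rw [← hc n (W (Fin.last n)) (by omega) (ih1 W hW')]
          congr 1
          rw [Set.ncard_eq_toFinset_card']
          symm
          refine Finset.card_bij (fun y _ => (Fin.snoc W y : Fin (n+1+1) → X)) ?_ ?_ ?_
          · intro y hy
            have hy : R (W (Fin.last n)) y := by simpa using hy
            simp only [Finset.mem_filter, Set.mem_toFinset]
            refine ⟨⟨?_, ?_⟩, ?_⟩
            · rw [← Fin.castSucc_zero, Fin.snoc_castSucc]; exact hW'.1
            · intro i
              induction i using Fin.lastCases with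
              | last => rw [Fin.succ_last, Fin.snoc_last, Fin.snoc_castSucc]; exact hy
              | cast i => rw [Fin.snoc_castSucc, Fin.succ_castSucc, Fin.snoc_castSucc]; exact hW'.2 i
            · funext i; rw [Fin.snoc_castSucc]
          · intro a _ b _ h
            have := congrFun h (Fin.last _)
            simpa using this
          · intro Y hY
            simp only [Finset.mem_filter, Set.mem_toFinset] at hY
            obtain ⟨⟨h1, h2⟩, rfl⟩ := hY
            refine ⟨Y (Fin.last _), ?_, ?_⟩
            · simpa using h2 (Fin.last n)
            · exact Fin.snoc_init_self Y
        · intro W hW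
          have hW : W ∈ S' := by simpa using hW
          have : (fun i : Fin (n+1) => W i.castSucc) ∈ S := ⟨by simpa using hW.1, fun i => hW.2 i.castSucc⟩
          simpa using this
      rw [Finset.prod_range_succ, ← ih2, pow_succ]
      calc _ = (S'.ncard * c) * c ^ n := by ring
        _ = _ := by rw [key]; ring

theorem ext_count {p : ℕ} [Fact p.Prime] {E : Type*} [AddCommGroup E] [Module (ZMod p) E] [Finite E]
    (A C : Submodule (ZMod p) E) (hAC : A ≤ C) :
    {A' : Submodule (ZMod p) E | A ≤ A' ∧ A' ≤ C ∧ finrank (ZMod p) A' = finrank (ZMod p) A + 1}.ncard * (p - 1)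
      = p ^ (finrank (ZMod p) C - finrank (ZMod p) A) - 1 := by
  classical
  have : Fintype E := Fintype.ofFinite E
  have : Fintype (Submodule (ZMod p) E) := Fintype.ofFinite _
  have hcard : ∀ D : Submodule (ZMod p) E, (D : Set E).toFinset.card = p ^ finrank (ZMod p) D := by
    intro D
    rw [Set.toFinset_card, Fintype.card_eq_nat_card]
    have := Module.natCard_eq_pow_finrank (K := ZMod p) (V := D)
    simpa using this
  have hdiff : ∀ D : Submodule (ZMod p) E, A ≤ D →
      ((D : Set E).toFinset \ (A : Set E).toFinset).card = p ^ finrank (ZMod p) D - p ^ finrank (ZMod p) A := by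
    intro D hD
    rw [Finset.card_sdiff_of_subset (by simpa using hD), hcard, hcard]
  have hp : 0 < p := (Fact.out : p.Prime).pos
  have hle := Submodule.finrank_mono hAC
  set T := {A' : Submodule (ZMod p) E | A ≤ A' ∧ A' ≤ C ∧ finrank (ZMod p) A' = finrank (ZMod p) A + 1} with hT
  have main := Finset.card_eq_sum_card_fiberwise
    (f := fun v : E => A ⊔ Submodule.span (ZMod p) {v}) (s := (C : Set E).toFinset \ (A : Set E).toFinset)
    (t := T.toFinset) (by
      intro v hv
      simp only [Finset.coe_sdiff, Set.coe_toFinset, Set.mem_sdiff, SetLike.mem_coe] at hv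
      simp only [Set.coe_toFinset, hT, Set.mem_ofPred_eq]
      refine ⟨le_sup_left, sup_le hAC (by simpa using hv.1), ?_⟩
      have h1 := Submodule.finrank_sup_add_finrank_inf_eq A (Submodule.span (ZMod p) {v})
      have hv0 : v ≠ 0 := fun h => hv.2 (h ▸ A.zero_mem)
      rw [finrank_span_singleton hv0] at h1
      have : A ⊓ Submodule.span (ZMod p) {v} = ⊥ := by
        rw [← disjoint_iff]
        exact (Submodule.disjoint_span_singleton' hv0).2 hv.2
      rw [this, finrank_bot] at h1
      simpa using h1)
  rw [hdiff C hAC, Finset.sum_congr rfl (g := fun _ => p ^ (finrank (ZMod p) A + 1) - p ^ finrank (ZMod p) A)] at main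
  · rw [Finset.sum_const, smul_eq_mul, ← Set.ncard_eq_toFinset_card'] at main
    have e1 : p ^ (finrank (ZMod p) A + 1) - p ^ finrank (ZMod p) A = p ^ finrank (ZMod p) A * (p - 1) := by
      rw [pow_succ, Nat.mul_sub, mul_one]
    have e2 : p ^ (finrank (ZMod p) C) - p ^ finrank (ZMod p) A
        = p ^ finrank (ZMod p) A * (p ^ (finrank (ZMod p) C - finrank (ZMod p) A) - 1) := by
      rw [Nat.mul_sub, mul_one, ← pow_add, Nat.add_sub_cancel' hle]
    rw [e1, e2] at main
    apply Nat.eq_of_mul_eq_mul_left (pow_pos hp (finrank (ZMod p) A))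
    rw [main]; ring
  · intro A' hA'
    have hA' : A' ∈ T := by simpa using hA'
    obtain ⟨h1, h2, h3⟩ := hA'
    rw [← h3, ← hdiff A' h1]
    congr 1
    ext v
    simp only [Finset.mem_filter, Finset.mem_sdiff, Set.mem_toFinset, SetLike.mem_coe]
    constructor
    · rintro ⟨⟨hv, hv'⟩, rfl⟩
      exact ⟨Submodule.mem_sup_right (Submodule.mem_span_singleton_self v), hv'⟩
    · rintro ⟨hv, hv'⟩
      refine ⟨⟨h2 hv, hv'⟩, ?_⟩
      have hle' : A ⊔ Submodule.span (ZMod p) {v} ≤ A' := sup_le h1 (by simpa using hv)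
      apply Submodule.eq_of_le_of_finrank_le hle'
      rw [h3]
      have hlt : A < A ⊔ Submodule.span (ZMod p) {v} :=
        lt_of_le_of_ne le_sup_left (fun h => hv' (h ▸ Submodule.mem_sup_right (Submodule.mem_span_singleton_self v)))
      exact Submodule.finrank_lt_finrank_of_lt hlt

/-- If `U` is stable under coordinatewise `τ`, it is spanned by its `τ`-fixed vectors. -/
theorem descent {K ι : Type*} [Field K] [Fintype ι] (τ : K → K) (h0 : τ 0 = 0) (h1 : τ 1 = 1)
    (U : Submodule K (ι → K)) (hU : ∀ x ∈ U, (fun i => τ (x i)) ∈ U) :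
    U ≤ Submodule.span K {x | x ∈ U ∧ ∀ i, τ (x i) = x i} := by
  classical
  intro v
  induction hn : (Finset.univ.filter fun i => v i ≠ 0).card using Nat.strong_induction_on generalizing v with
  | _ n ih =>
  intro hv
  by_cases hv0 : v = 0
  · rw [hv0]; exact Submodule.zero_mem _
  -- minimal-support vector
  let P : ℕ → Prop := fun m => ∃ w ∈ U, w ≠ 0 ∧ (∀ i, v i = 0 → w i = 0) ∧ (Finset.univ.filter fun i => w i ≠ 0).card = m
  have hP : ∃ m, P m := ⟨_, v, hv, hv0, fun _ h => h, rfl⟩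
  obtain ⟨w, hw, hw0, hws, hwc⟩ := Nat.find_spec hP
  obtain ⟨i, hi⟩ : ∃ i, w i ≠ 0 := by
    by_contra! h
    exact hw0 (funext h)
  set u := (w i)⁻¹ • w with hu
  have huU : u ∈ U := U.smul_mem _ hw
  have hui : u i = 1 := by simp [hu, hi]
  have hus : ∀ j, w j = 0 → u j = 0 := fun j h => by simp [hu, h]
  have hfix : ∀ j, τ (u j) = u j := by
    by_contra! hne
    obtain ⟨j, hj⟩ := hne
    set z : ι → K := (fun i => τ (u i)) - u with hz
    have hzs : ∀ j, w j = 0 → z j = 0 := fun j h => by simp [hz, hus j h, h0]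
    have hPz : P (Finset.univ.filter fun i => z i ≠ 0).card := by
      refine ⟨z, U.sub_mem (hU u huU) huU, ?_, fun j h => hzs j (hws j h), rfl⟩
      intro h
      exact hj (sub_eq_zero.1 (congrFun h j))
    have hmin := Nat.find_min' hP hPz
    rw [← hwc] at hmin
    refine absurd hmin (not_le.2 (Finset.card_lt_card ?_))
    rw [Finset.ssubset_iff_of_subset]
    · exact ⟨i, by simpa using hi, by simp [hz, hui, h1]⟩
    · intro j hj
      simp only [Finset.mem_filter, Finset.mem_univ, true_and] at hj ⊢
      exact fun h => hj (hzs j h)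
  have hvi : v i ≠ 0 := fun h => hi (hws i h)
  have hrec := ih (Finset.univ.filter fun j => (v - v i • u) j ≠ 0).card (by
    rw [← hn]
    apply Finset.card_lt_card
    rw [Finset.ssubset_iff_of_subset]
    · exact ⟨i, by simpa using hvi, by simp [hui]⟩
    · intro j hj
      simp only [Finset.mem_filter, Finset.mem_univ, true_and] at hj ⊢
      intro h
      apply hj
      simp [h, hus j (hws j h)]) rfl (U.sub_mem hv (U.smul_mem _ huU))
  have : v = (v - v i • u) + v i • u := by simp
  rw [this]
  exact Submodule.add_mem _ hrec (Submodule.smul_mem _ _ (Submodule.subset_span ⟨huU, hfix⟩))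

section pairs
variable {p : ℕ} [Fact p.Prime] {g : ℕ}

/-- pairs of subspaces of `𝔽_p^g` -/
abbrev PairX (p g : ℕ) := Submodule (ZMod p) (Fin g → ZMod p) × Submodule (ZMod p) (Fin g → ZMod p)

/-- orthogonality of the two members of a pair -/
def PairPerp (x : PairX p g) : Prop := ∀ a ∈ x.1, ∀ b ∈ x.2, a ⬝ᵥ b = 0

/-- one step of a flag of pairs -/
def PairStep (x y : PairX p g) : Prop :=
  x ≤ y ∧ finrank (ZMod p) y.1 + finrank (ZMod p) y.2
    = finrank (ZMod p) x.1 + finrank (ZMod p) x.2 + 1 ∧ PairPerp y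

/-- orthogonal complement for the dot product -/
noncomputable def orthC (B : Submodule (ZMod p) (Fin g → ZMod p)) : Submodule (ZMod p) (Fin g → ZMod p) :=
  B.dualAnnihilator.comap (dotProductEquiv (ZMod p) (Fin g)).toLinearMap

theorem mem_orthC (B : Submodule (ZMod p) (Fin g → ZMod p)) (a : Fin g → ZMod p) :
    a ∈ orthC B ↔ ∀ b ∈ B, a ⬝ᵥ b = 0 := by
  simp [orthC, Submodule.mem_dualAnnihilator]

theorem finrank_orthC (B : Submodule (ZMod p) (Fin g → ZMod p)) :
    finrank (ZMod p) (orthC B) + finrank (ZMod p) B = g := by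
  have h1 : finrank (ZMod p) (orthC B) = finrank (ZMod p) B.dualAnnihilator := by
    unfold orthC
    rw [← LinearEquiv.finrank_map_eq (dotProductEquiv (ZMod p) (Fin g)),
      Submodule.map_comap_eq_of_surjective (dotProductEquiv (ZMod p) (Fin g)).surjective]
  have h2 := Subspace.finrank_add_finrank_dualAnnihilator_eq B
  have h3 : finrank (ZMod p) (Fin g → ZMod p) = g := by simp
  omega

theorem step_count (k : ℕ) (x : PairX p g)
    (hx : finrank (ZMod p) x.1 + finrank (ZMod p) x.2 = k ∧ PairPerp x) :
    {y | PairStep x y}.ncard * (p - 1) = 2 * (p ^ (g - k) - 1) := by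
  obtain ⟨hk, hperp⟩ := hx
  have hA : x.1 ≤ orthC x.2 := fun a ha => (mem_orthC _ _).2 (hperp a ha)
  have hB : x.2 ≤ orthC x.1 := fun b hb => (mem_orthC _ _).2
    (fun a ha => by rw [dotProduct_comm]; exact hperp a ha b hb)
  have c1 := ext_count x.1 (orthC x.2) hA
  have c2 := ext_count x.2 (orthC x.1) hB
  have d1 := finrank_orthC x.1
  have d2 := finrank_orthC x.2
  rw [show finrank (ZMod p) (orthC x.2) - finrank (ZMod p) x.1 = g - k by omega] at c1
  rw [show finrank (ZMod p) (orthC x.1) - finrank (ZMod p) x.2 = g - k by omega] at c2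
  have hset : {y | PairStep x y} =
      (fun A' => (A', x.2)) '' {A' | x.1 ≤ A' ∧ A' ≤ orthC x.2 ∧
        finrank (ZMod p) A' = finrank (ZMod p) x.1 + 1} ∪
      (fun B' => (x.1, B')) '' {B' | x.2 ≤ B' ∧ B' ≤ orthC x.1 ∧
        finrank (ZMod p) B' = finrank (ZMod p) x.2 + 1} := by
    ext ⟨A', B'⟩
    simp only [Set.mem_ofPred_eq, Set.mem_union, Set.mem_image, Prod.mk.injEq]
    constructor
    · rintro ⟨⟨h1, h2⟩, h3, h4⟩
      dsimp only at h1 h2 h3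
      have f1 := Submodule.finrank_mono h1
      have f2 := Submodule.finrank_mono h2
      by_cases hc : finrank (ZMod p) B' = finrank (ZMod p) x.2
      · have := Submodule.eq_of_le_of_finrank_eq h2 hc.symm
        left
        refine ⟨A', ⟨h1, fun a ha => (mem_orthC _ _).2 fun b hb => h4 a ha b (h2 hb), by omega⟩, rfl, this⟩
      · have := Submodule.eq_of_le_of_finrank_eq h1 (by omega)
        right
        refine ⟨B', ⟨h2, fun b hb => (mem_orthC _ _).2 fun a ha => ?_, by omega⟩, this, rfl⟩
        rw [dotProduct_comm]
        exact h4 a (h1 ha) b hb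
    · rintro (⟨A, ⟨h1, h2, h3⟩, rfl, rfl⟩ | ⟨A, ⟨h1, h2, h3⟩, rfl, rfl⟩)
      · refine ⟨⟨h1, le_rfl⟩, by dsimp only; omega, fun a ha b hb => (mem_orthC _ _).1 (h2 ha) b hb⟩
      · refine ⟨⟨le_rfl, h1⟩, by dsimp only; omega, fun a ha b hb => ?_⟩
        rw [dotProduct_comm]
        exact (mem_orthC _ _).1 (h2 hb) a ha
  rw [hset, Set.ncard_union_eq, Set.ncard_image_of_injective, Set.ncard_image_of_injective, add_mul,
    c1, c2, two_mul]
  · intro a b h; exact (Prod.mk.inj h).2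
  · intro a b h; exact (Prod.mk.inj h).1
  · rw [Set.disjoint_left]
    rintro _ ⟨A, ⟨h1, h2, h3⟩, rfl⟩ ⟨B, ⟨h4, h5, h6⟩, h⟩
    have := (Prod.mk.inj h).1
    rw [← this] at h3
    omega

/-- the flags of pairs -/
def PairFlags (p g : ℕ) [Fact p.Prime] : Set (Fin (g+1) → PairX p g) :=
  {W | W 0 = (⊥, ⊥) ∧ ∀ i : Fin g, PairStep (W i.castSucc) (W i.succ)}

theorem pairFlags_count :
    (PairFlags p g).ncard * (p - 1) ^ g = 2 ^ g * ∏ l ∈ Finset.Icc 1 g, (p ^ l - 1) := by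
  have := (chain_count (X := PairX p g) (⊥, ⊥) PairStep
    (fun k x => finrank (ZMod p) x.1 + finrank (ZMod p) x.2 = k ∧ PairPerp x) (p - 1) g
    (fun k => 2 * (p ^ (g - k) - 1)) ⟨by simp, by
      intro a ha b hb
      have ha : a = 0 := by simpa using ha
      simp [ha]⟩ (by
      rintro k x y ⟨h1, h2⟩ ⟨h3, h4, h5⟩
      exact ⟨by omega, h5⟩) (fun k x _ h => step_count k x h) g le_rfl).2
  unfold PairFlags
  rw [this, Finset.prod_mul_distrib, Finset.prod_const, Finset.card_range]
  congr 1
  rw [← Finset.prod_range_reflect, Finset.range_eq_Ico, Finset.prod_Ico_eq_prod_range]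
  have e : Finset.Icc 1 g = Finset.Ico 1 (g + 1) := by ext; simp
  rw [e, Finset.prod_Ico_eq_prod_range]
  simp only [Nat.sub_zero, Nat.add_sub_cancel]
  refine Finset.prod_congr rfl fun i hi => ?_
  have := Finset.mem_range.1 hi
  rw [show g - (g - 1 - (0 + i)) = 1 + i by omega]

end pairs

section ext
variable {p : ℕ} [Fact p.Prime] {g : ℕ} {K : Type*} [Field K] [Algebra (ZMod p) K]

/-- extension of scalars -/
def extK (K : Type*) [Field K] [Algebra (ZMod p) K] (A : Submodule (ZMod p) (Fin g → ZMod p)) :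
    Submodule K (Fin g → K) :=
  Submodule.span K ((fun a : Fin g → ZMod p => algebraMap (ZMod p) K ∘ a) '' A)

theorem mem_extK {A : Submodule (ZMod p) (Fin g → ZMod p)} {a : Fin g → ZMod p} (ha : a ∈ A) :
    algebraMap (ZMod p) K ∘ a ∈ extK K A := Submodule.subset_span ⟨a, ha, rfl⟩

theorem finrank_extK (A : Submodule (ZMod p) (Fin g → ZMod p)) :
    finrank K (extK K A) = finrank (ZMod p) A := by
  let b := Module.finBasis (ZMod p) A
  have hli : LinearIndependent (ZMod p) (fun i => (b i : Fin g → ZMod p)) :=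
    b.linearIndependent.map' A.subtype (by simp)
  have hli' := (linearIndependent_algebraMap_comp_iff (S := K)).2 hli
  have hspan : extK K A = Submodule.span K (Set.range fun i => algebraMap (ZMod p) K ∘ (b i : Fin g → ZMod p)) := by
    apply le_antisymm
    · apply Submodule.span_le.2
      rintro _ ⟨a, ha, rfl⟩
      have h := congrArg Subtype.val (b.sum_repr ⟨a, ha⟩)
      have : algebraMap (ZMod p) K ∘ a = ∑ i, algebraMap (ZMod p) K (b.repr ⟨a, ha⟩ i) •
          (algebraMap (ZMod p) K ∘ (b i : Fin g → ZMod p)) := by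
        funext j
        have hj := congrFun h j
        simp only [Submodule.coe_sum, Submodule.coe_smul, Finset.sum_apply, Pi.smul_apply, smul_eq_mul] at hj
        simp only [Function.comp, Finset.sum_apply, Pi.smul_apply, smul_eq_mul]
        rw [← hj, map_sum]
        simp
      simp only [SetLike.mem_coe]
      rw [this]
      exact Submodule.sum_mem _ fun i _ => Submodule.smul_mem _ _ (Submodule.subset_span ⟨i, rfl⟩)
    · apply Submodule.span_le.2
      rintro _ ⟨i, rfl⟩
      exact mem_extK (b i).2
  rw [hspan, finrank_span_eq_card hli']
  simp

theorem extK_mono {A A' : Submodule (ZMod p) (Fin g → ZMod p)} (h : A ≤ A') : extK K A ≤ extK K A' :=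
  Submodule.span_mono (Set.image_mono h)

theorem le_of_extK_le {A A' : Submodule (ZMod p) (Fin g → ZMod p)} (h : extK K A ≤ extK K A') : A ≤ A' := by
  have h1 : extK K (A ⊔ A') ≤ extK K A' := by
    apply Submodule.span_le.2
    rintro _ ⟨c, hc, rfl⟩
    obtain ⟨a, ha, a', ha', rfl⟩ := Submodule.mem_sup.1 hc
    have : (algebraMap (ZMod p) K ∘ (a + a')) = algebraMap (ZMod p) K ∘ a + algebraMap (ZMod p) K ∘ a' := by
      funext j; simp
    simp only [SetLike.mem_coe, this]
    exact Submodule.add_mem _ (h (mem_extK ha)) (mem_extK ha')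
  have h2 := Submodule.finrank_mono h1
  rw [finrank_extK, finrank_extK] at h2
  have := Submodule.eq_of_le_of_finrank_le (le_sup_right : A' ≤ A ⊔ A') h2
  rw [this]; exact le_sup_left

/-- the stable subspace attached to a pair -/
def phi (K : Type*) [Field K] [Algebra (ZMod p) K] (x : PairX p g) : Submodule K (Fin g ⊕ Fin g → K) :=
  ((extK K x.1).prod (extK K x.2)).comap (LinearEquiv.sumArrowLequivProdArrow (Fin g) (Fin g) K K).toLinearMap

theorem mem_phi (x : PairX p g) (v : Fin g ⊕ Fin g → K) :
    v ∈ phi K x ↔ (fun i => v (Sum.inl i)) ∈ extK K x.1 ∧ (fun i => v (Sum.inr i)) ∈ extK K x.2 := by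
  rfl

/-- the product of submodules as a product of modules -/
def prodSubEquiv {M N : Type*} [AddCommGroup M] [AddCommGroup N] [Module K M] [Module K N]
    (U : Submodule K M) (U' : Submodule K N) : U.prod U' ≃ₗ[K] U × U' where
  toFun x := (⟨x.1.1, x.2.1⟩, ⟨x.1.2, x.2.2⟩)
  invFun x := ⟨(x.1.1, x.2.1), x.1.2, x.2.2⟩
  map_add' _ _ := rfl
  map_smul' _ _ := rfl

theorem finrank_phi (x : PairX p g) :
    finrank K (phi K x) = finrank (ZMod p) x.1 + finrank (ZMod p) x.2 := by
  unfold phi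
  rw [← LinearEquiv.finrank_map_eq (LinearEquiv.sumArrowLequivProdArrow (Fin g) (Fin g) K K),
      Submodule.map_comap_eq_of_surjective (LinearEquiv.sumArrowLequivProdArrow (Fin g) (Fin g) K K).surjective,
      LinearEquiv.finrank_eq (prodSubEquiv _ _), Module.finrank_prod, finrank_extK, finrank_extK]

theorem phi_le_iff (x y : PairX p g) : phi K x ≤ phi K y ↔ x ≤ y := by
  constructor
  · intro h
    constructor
    · apply le_of_extK_le (K := K)
      intro a ha
      have := h ((mem_phi x (Sum.elim a 0)).2 ⟨ha, Submodule.zero_mem _⟩)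
      exact ((mem_phi _ _).1 this).1
    · apply le_of_extK_le (K := K)
      intro a ha
      have := h ((mem_phi x (Sum.elim 0 a)).2 ⟨Submodule.zero_mem _, ha⟩)
      exact ((mem_phi _ _).1 this).2
  · rintro ⟨h1, h2⟩ v hv
    exact ⟨extK_mono h1 hv.1, extK_mono h2 hv.2⟩

theorem extK_perp {A B : Submodule (ZMod p) (Fin g → ZMod p)} (h : ∀ a ∈ A, ∀ b ∈ B, a ⬝ᵥ b = 0)
    {x y : Fin g → K} (hx : x ∈ extK K A) (hy : y ∈ extK K B) : x ⬝ᵥ y = 0 := by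
  induction hx using Submodule.span_induction with
  | mem x hx =>
    obtain ⟨a, ha, rfl⟩ := hx
    induction hy using Submodule.span_induction with
    | mem y hy =>
      obtain ⟨b, hb, rfl⟩ := hy
      have := congrArg (algebraMap (ZMod p) K) (h a ha b hb)
      rw [RingHom.map_dotProduct, map_zero] at this
      exact this
    | zero => simp
    | add x y _ _ h1 h2 => rw [dotProduct_add, h1, h2, add_zero]
    | smul c x _ h => rw [dotProduct_smul, h, smul_zero]
  | zero => simp
  | add x y _ _ h1 h2 => rw [add_dotProduct, h1, h2, add_zero]
  | smul c x _ h => rw [smul_dotProduct, h, smul_zero]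

/-- `extK` is closed under coordinatewise maps fixing the prime field and semilinear. -/
theorem extK_stable (τ : K ≃+* K) (A : Submodule (ZMod p) (Fin g → ZMod p)) {x : Fin g → K}
    (hx : x ∈ extK K A) : (fun i => τ (x i)) ∈ extK K A := by
  induction hx using Submodule.span_induction with
  | mem x hx =>
    obtain ⟨a, ha, rfl⟩ := hx
    have : (fun i => τ ((algebraMap (ZMod p) K ∘ a) i)) = algebraMap (ZMod p) K ∘ a := by
      funext i
      have : τ.toRingHom.comp (algebraMap (ZMod p) K) = algebraMap (ZMod p) K := Subsingleton.elim _ _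
      exact congrArg (fun f => f (a i)) this
    simp only [this]
    exact mem_extK ha
  | zero =>
    have : (fun i => τ ((0 : Fin g → K) i)) = 0 := by funext i; simp
    rw [this]
    exact Submodule.zero_mem _
  | add x y _ _ h1 h2 =>
    have : (fun i => τ ((x + y) i)) = (fun i => τ (x i)) + fun i => τ (y i) := by funext i; simp
    rw [this]
    exact Submodule.add_mem _ h1 h2
  | smul c x _ h =>
    have : (fun i => τ ((c • x) i)) = τ c • fun i => τ (x i) := by funext i; simp
    rw [this]
    exact Submodule.smul_mem _ (τ c) h

/-- restriction of scalars: the `𝔽_p`-points of a subspace -/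
def pts (U : Submodule K (Fin g → K)) : Submodule (ZMod p) (Fin g → ZMod p) where
  carrier := {a | algebraMap (ZMod p) K ∘ a ∈ U}
  zero_mem' := by
    have : algebraMap (ZMod p) K ∘ (0 : Fin g → ZMod p) = 0 := by funext j; simp
    simp [this]
  add_mem' := by
    intro a b ha hb
    have : (algebraMap (ZMod p) K ∘ (a + b)) = algebraMap (ZMod p) K ∘ a + algebraMap (ZMod p) K ∘ b := by
      funext j; simp
    simp only [Set.mem_ofPred_eq, this]
    exact U.add_mem ha hb
  smul_mem' := by
    intro c a ha
    have : (algebraMap (ZMod p) K ∘ (c • a)) = algebraMap (ZMod p) K c • algebraMap (ZMod p) K ∘ a := by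
      funext j; simp
    simp only [Set.mem_ofPred_eq, this]
    exact U.smul_mem _ ha

theorem extK_pts (τ : K → K) (h0 : τ 0 = 0) (h1 : τ 1 = 1)
    (hτ : ∀ x, τ x = x → ∃ a : ZMod p, algebraMap (ZMod p) K a = x)
    (U : Submodule K (Fin g → K)) (hU : ∀ x ∈ U, (fun i => τ (x i)) ∈ U) :
    extK K (pts (p := p) U) = U := by
  apply le_antisymm
  · apply Submodule.span_le.2
    rintro _ ⟨a, ha, rfl⟩
    exact ha
  · refine (descent τ h0 h1 U hU).trans (Submodule.span_le.2 ?_)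
    rintro x ⟨hx, hf⟩
    choose a ha using fun i => hτ _ (hf i)
    have : x = algebraMap (ZMod p) K ∘ a := funext fun i => (ha i).symm
    rw [this] at hx ⊢
    exact mem_extK (show a ∈ pts U from hx)

end ext

section stable
variable {p : ℕ} [Fact p.Prime] {g : ℕ} {K : Type*} [Field K] [Algebra (ZMod p) K]

theorem phi_stable (τ τ' : K ≃+* K) (x : PairX p g) (v : Fin g ⊕ Fin g → K) (hv : v ∈ phi K x) :
    (Sum.elim (fun i => τ (v (Sum.inl i))) 0 : Fin g ⊕ Fin g → K) ∈ phi K x ∧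
    (Sum.elim 0 (fun i => τ' (v (Sum.inr i))) : Fin g ⊕ Fin g → K) ∈ phi K x := by
  rw [mem_phi] at hv
  exact ⟨(mem_phi _ _).2 ⟨extK_stable τ _ hv.1, Submodule.zero_mem _⟩,
    (mem_phi _ _).2 ⟨Submodule.zero_mem _, extK_stable τ' _ hv.2⟩⟩

theorem stable_eq_phi (τ τ' : K ≃+* K)
    (hτ : ∀ x, τ x = x → ∃ a : ZMod p, algebraMap (ZMod p) K a = x)
    (hτ' : ∀ x, τ' x = x → ∃ a : ZMod p, algebraMap (ZMod p) K a = x)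
    (W : Submodule K (Fin g ⊕ Fin g → K))
    (hW : ∀ v ∈ W, (Sum.elim (fun i => τ (v (Sum.inl i))) 0 : Fin g ⊕ Fin g → K) ∈ W ∧
      (Sum.elim 0 (fun i => τ' (v (Sum.inr i))) : Fin g ⊕ Fin g → K) ∈ W) :
    ∃ x : PairX p g, phi K x = W := by
  set e := LinearEquiv.sumArrowLequivProdArrow (Fin g) (Fin g) K K with he
  set U1 : Submodule K (Fin g → K) := W.map (LinearMap.funLeft K K Sum.inl) with hU1
  set U2 : Submodule K (Fin g → K) := W.map (LinearMap.funLeft K K Sum.inr) with hU2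
  have s1 : ∀ x ∈ U1, (fun i => τ (x i)) ∈ U1 := by
    rintro _ ⟨v, hv, rfl⟩
    exact ⟨_, (hW v hv).1, rfl⟩
  have s2 : ∀ x ∈ U2, (fun i => τ' (x i)) ∈ U2 := by
    rintro _ ⟨v, hv, rfl⟩
    exact ⟨_, (hW v hv).2, rfl⟩
  have t1 : U1 ≤ W.comap (e.symm.toLinearMap ∘ₗ LinearMap.inl K _ _) := by
    refine (descent τ (map_zero _) (map_one _) U1 s1).trans (Submodule.span_le.2 ?_)
    rintro _ ⟨⟨v, hv, rfl⟩, hf⟩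
    have := (hW v hv).1
    have h2 : (fun i => τ (v (Sum.inl i))) = fun i => v (Sum.inl i) := funext hf
    rw [h2] at this
    exact this
  have t2 : U2 ≤ W.comap (e.symm.toLinearMap ∘ₗ LinearMap.inr K _ _) := by
    refine (descent τ' (map_zero _) (map_one _) U2 s2).trans (Submodule.span_le.2 ?_)
    rintro _ ⟨⟨v, hv, rfl⟩, hf⟩
    have := (hW v hv).2
    have h2 : (fun i => τ' (v (Sum.inr i))) = fun i => v (Sum.inr i) := funext hf
    rw [h2] at this
    exact this
  refine ⟨(pts U1, pts U2), ?_⟩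
  ext v
  rw [mem_phi]
  dsimp only
  rw [extK_pts τ (map_zero _) (map_one _) hτ U1 s1, extK_pts τ' (map_zero _) (map_one _) hτ' U2 s2]
  constructor
  · rintro ⟨h1, h2⟩
    have h1 : (Sum.elim (fun i => v (Sum.inl i)) 0 : Fin g ⊕ Fin g → K) ∈ W := t1 h1
    have h2 : (Sum.elim 0 (fun i => v (Sum.inr i)) : Fin g ⊕ Fin g → K) ∈ W := t2 h2
    convert! W.add_mem h1 h2 using 1
    funext s
    cases s <;> simp
  · intro h
    exact ⟨⟨v, h, rfl⟩, ⟨v, h, rfl⟩⟩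

theorem fixed_mem [CharP K p] (x : K) (hx : x ^ p = x) : ∃ a : ZMod p, algebraMap (ZMod p) K a = x := by
  have h := (Subfield.mem_bot_iff_pow_eq_self K p).2 hx
  rw [← ZMod.fieldRange_castHom_eq_bot p] at h
  obtain ⟨a, ha⟩ := h
  refine ⟨a, ?_⟩
  rw [← ha]
  exact congrArg (fun f : ZMod p →+* K => f a) (Subsingleton.elim _ _)

theorem phi_isotropic_iff (x : PairX p g)
    (B : (Fin g ⊕ Fin g → K) → (Fin g ⊕ Fin g → K) → K)
    (hB : ∀ x y, B x y =
      ∑ i : Fin g, (x (Sum.inl i) * y (Sum.inr i) - x (Sum.inr i) * y (Sum.inl i))) :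
    (∀ v ∈ phi K x, ∀ w ∈ phi K x, B v w = 0) ↔ PairPerp x := by
  constructor
  · intro h a ha b hb
    have := h (Sum.elim (algebraMap (ZMod p) K ∘ a) 0)
      ((mem_phi _ _).2 ⟨mem_extK ha, Submodule.zero_mem _⟩)
      (Sum.elim 0 (algebraMap (ZMod p) K ∘ b))
      ((mem_phi _ _).2 ⟨Submodule.zero_mem _, mem_extK hb⟩)
    rw [hB] at this
    apply (algebraMap (ZMod p) K).injective
    rw [RingHom.map_dotProduct, map_zero]
    simpa [dotProduct] using this
  · intro h v hv w hw
    rw [mem_phi] at hv hw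
    have h1 := extK_perp h hv.1 hw.2
    have h2 := extK_perp h hw.1 hv.2
    simp only [dotProduct] at h1 h2
    rw [hB, Finset.sum_sub_distrib, h1, zero_sub, neg_eq_zero, ← h2]
    exact Finset.sum_congr rfl fun i _ => mul_comm _ _

end stable

end aux

/-- **the ordinary case.** Let `g ≥ 1`, let `F` be the `σ`-semilinear map on
`𝔽^{2g}` with `F e_i = e_i`, `F e_{g+i} = 0` and `V` the `σ⁻¹`-semilinear map with
`V e_i = 0`, `V e_{g+i} = e_{g+i}` (`1 ≤ i ≤ g`). Then the set of symplectic flags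
`(W_j)_{j=0}^{g}` stable under `F` and `V` is finite of cardinality
`2 ^ g ⬝ ∏_{l=1}^{g} (p ^ l - 1) / (p - 1) ^ g`
(the cardinality identity is stated multiplied through by `(p - 1) ^ g`). -/
theorem stmt8 {p : ℕ} (hp : p.Prime) {𝔽 : Type*} [Field 𝔽] [IsAlgClosed 𝔽] [CharP 𝔽 p]
    (g : ℕ) (hg : 1 ≤ g)
    (B : (Fin g ⊕ Fin g → 𝔽) → (Fin g ⊕ Fin g → 𝔽) → 𝔽)
    (hB : ∀ x y, B x y =
      ∑ i : Fin g, (x (Sum.inl i) * y (Sum.inr i) - x (Sum.inr i) * y (Sum.inl i)))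
    (F V : (Fin g ⊕ Fin g → 𝔽) → (Fin g ⊕ Fin g → 𝔽))
    (hFadd : ∀ x y, F (x + y) = F x + F y)
    (hVadd : ∀ x y, V (x + y) = V x + V y)
    (hFsmul : ∀ (c : 𝔽) x, F (c • x) = c ^ p • F x)
    (hVsmul : ∀ (c : 𝔽) x, V (c ^ p • x) = c • V x)
    (hFe1 : ∀ i : Fin g, F (Pi.single (Sum.inl i) 1) = Pi.single (Sum.inl i) 1)
    (hFe2 : ∀ i : Fin g, F (Pi.single (Sum.inr i) 1) = 0)
    (hVe1 : ∀ i : Fin g, V (Pi.single (Sum.inl i) 1) = 0)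
    (hVe2 : ∀ i : Fin g, V (Pi.single (Sum.inr i) 1) = Pi.single (Sum.inr i) 1) :
    (StableSympFlags g B F V).Finite ∧
      (StableSympFlags g B F V).ncard * (p - 1) ^ g =
        2 ^ g * ∏ l ∈ Finset.Icc 1 g, (p ^ l - 1) := by
  classical
  have : Fact p.Prime := ⟨hp⟩
  let _ : Algebra (ZMod p) 𝔽 := ZMod.algebra 𝔽 p
  have : ExpChar 𝔽 p := ExpChar.prime hp
  let τ : 𝔽 ≃+* 𝔽 := frobeniusEquiv 𝔽 p
  have hτ : ∀ x, τ x = x ^ p := fun x => rfl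
  have hFx : ∀ x, F x = Sum.elim (fun i => τ (x (Sum.inl i))) 0 := by
    intro x
    have hx : x = ∑ s, x s • (Pi.single s 1 : Fin g ⊕ Fin g → 𝔽) := pi_eq_sum_univ' x
    have hsum : F (∑ s, x s • (Pi.single s 1 : Fin g ⊕ Fin g → 𝔽)) =
        ∑ s, F (x s • (Pi.single s 1 : Fin g ⊕ Fin g → 𝔽)) :=
      map_sum (AddMonoidHom.mk' F hFadd) _ _
    rw [← hx] at hsum
    rw [hsum, Fintype.sum_sum_type]
    simp only [hFsmul, hFe1, hFe2, smul_zero, Finset.sum_const_zero, add_zero]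
    funext s
    cases s <;> simp [Finset.sum_apply, Pi.single_apply, hτ]
  have hVx : ∀ x, V x = Sum.elim (0 : Fin g → 𝔽) (fun i => τ.symm (x (Sum.inr i))) := by
    intro x
    have hx : x = ∑ s, x s • (Pi.single s 1 : Fin g ⊕ Fin g → 𝔽) := pi_eq_sum_univ' x
    have hsum : V (∑ s, x s • (Pi.single s 1 : Fin g ⊕ Fin g → 𝔽)) =
        ∑ s, V (x s • (Pi.single s 1 : Fin g ⊕ Fin g → 𝔽)) :=
      map_sum (AddMonoidHom.mk' V hVadd) _ _
    have hVsmul' : ∀ (c : 𝔽) x, V (c • x) = τ.symm c • V x := by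
      intro c x
      rw [← hVsmul, ← hτ, τ.apply_symm_apply]
    rw [← hx] at hsum
    rw [hsum, Fintype.sum_sum_type]
    simp only [hVsmul', hVe1, hVe2, smul_zero, Finset.sum_const_zero, zero_add]
    funext s
    cases s <;> simp [Finset.sum_apply, Pi.single_apply]
  have hfix : ∀ x, τ x = x → ∃ a : ZMod p, algebraMap (ZMod p) 𝔽 a = x := fun x hx => fixed_mem x hx
  have hfix' : ∀ x, τ.symm x = x → ∃ a : ZMod p, algebraMap (ZMod p) 𝔽 a = x := fun x hx =>
    hfix x (by rw [τ.symm_apply_eq] at hx; exact hx.symm)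
  have hinj : Function.Injective (phi 𝔽 : PairX p g → _) := fun x y h =>
    le_antisymm ((phi_le_iff (K := 𝔽) x y).1 h.le) ((phi_le_iff (K := 𝔽) y x).1 h.ge)
  have hset : StableSympFlags g B F V = (fun W : Fin (g + 1) → PairX p g => fun j => phi 𝔽 (W j)) ''
      PairFlags p g := by
    ext W
    constructor
    · rintro ⟨h0, hm, hd, hi, hs⟩
      have hex : ∀ j, ∃ x : PairX p g, phi 𝔽 x = W j := fun j =>
        stable_eq_phi τ τ.symm hfix hfix' (W j) (fun v hv => by
          have := hs j v hv
          rwa [hFx, hVx] at this)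
      choose X hX using hex
      have hWX : W = fun j => phi 𝔽 (X j) := funext fun j => (hX j).symm
      subst hWX
      have hmX : Monotone X := fun i j hij => (phi_le_iff (K := 𝔽) _ _).1 (hm hij)
      have hperp := (phi_isotropic_iff _ B hB).1 hi
      simp only [finrank_phi] at hd
      refine ⟨X, ⟨?_, fun i => ⟨hmX (Fin.castSucc_le_succ i), ?_, ?_⟩⟩, rfl⟩
      · have : _ = 0 := hd 0
        have h1 : Module.finrank (ZMod p) (X 0).1 = 0 := by omega
        have h2 : Module.finrank (ZMod p) (X 0).2 = 0 := by omega
        exact Prod.ext (Submodule.finrank_eq_zero.1 h1) (Submodule.finrank_eq_zero.1 h2)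
      · rw [hd, hd]; simp
      · intro a ha b hb
        exact hperp a ((hmX (Fin.le_last _)).1 ha) b ((hmX (Fin.le_last _)).2 hb)
    · rintro ⟨X, ⟨h0, hs⟩, rfl⟩
      have hmX : Monotone X := Fin.monotone_iff_le_succ.2 fun i => (hs i).1
      have hd : ∀ j : Fin (g + 1), Module.finrank (ZMod p) (X j).1 + Module.finrank (ZMod p) (X j).2 = j := by
        intro j
        induction j using Fin.induction with
        | zero => rw [h0]; simp
        | succ i ih => rw [(hs i).2.1, ih]; simp
      refine ⟨?_, fun i j hij => (phi_le_iff (K := 𝔽) _ _).2 (hmX hij), fun j => ?_, ?_, fun j v hv => ?_⟩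
      · apply Submodule.finrank_eq_zero.1
        rw [finrank_phi, hd]; rfl
      · rw [finrank_phi, hd]
      · apply (phi_isotropic_iff _ B hB).2
        obtain ⟨n, rfl⟩ : ∃ n, g = n + 1 := ⟨g - 1, by omega⟩
        exact (hs (Fin.last n)).2.2
      · rw [hFx, hVx]
        exact phi_stable τ τ.symm _ v hv
  have hinj' : Function.Injective (fun W : Fin (g + 1) → PairX p g => fun j => phi 𝔽 (W j)) :=
    fun X Y h => funext fun j => hinj (congrFun h j)
  rw [hset]
  refine ⟨(Set.toFinite _).image _, ?_⟩
  rw [Set.ncard_image_of_injective _ hinj']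
  exact pairFlags_count
end

section
/- Let f : X → Y be a proper morphism of algebraic varieties over an algebraically closed field K. Assume that Y is irreducible of dimension d ∈ ℕ and that for every closed point y of Y the fiber f⁻¹(y) is irreducible of dimension e ∈ ℕ. Then X is irreducible of dimension d + e. -/
open AlgebraicGeometry CategoryTheory

lemma s10_dim_le_of_integral {R S : Type*} [CommRing R] [CommRing S] [Algebra R S]
    [Algebra.IsIntegral R S] : ringKrullDim S ≤ ringKrullDim R := by
  refine Order.krullDim_le_of_strictMono (PrimeSpectrum.comap (algebraMap R S)) ?_
  intro p q hpq
  exact Ideal.comap_lt_comap_of_integral_mem_sdiff (I := p.asIdeal) (J := q.asIdeal) hpq.le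
    (Set.exists_of_ssubset hpq).choose_spec (Algebra.IsIntegral.isIntegral _)

lemma s10_height_mvPoly (K : Type*) [Field K] (n : ℕ) (M : Ideal (MvPolynomial (Fin n) K))
    [M.IsMaximal] : M.height = n := by
  induction n with
  | zero =>
    have h : ringKrullDim (MvPolynomial (Fin 0) K) = 0 := by simp
    have := Ideal.height_le_ringKrullDim_of_ne_top (Ideal.IsPrime.ne_top' (I := M))
    rw [h] at this
    have h2 : M.height ≤ 0 := by exact_mod_cast this
    simpa using h2
  | succ n ih =>
    let e := (MvPolynomial.finSuccEquiv K n).toRingEquiv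
    rw [← e.height_map M]
    set M' := M.map e
    have : M'.IsMaximal := Ideal.map_isMaximal_of_equiv e
    have h1 : (M'.under (MvPolynomial (Fin n) K)).IsMaximal :=
      Polynomial.isMaximal_comap_C_of_isJacobsonRing M'
    have h2 : M'.LiesOver (M'.under (MvPolynomial (Fin n) K)) := ⟨rfl⟩
    rw [Polynomial.height_eq_height_add_one (M'.under (MvPolynomial (Fin n) K)) M', ih]
    simp

/-- Maximal ideals of an affine domain have height the transcendence degree. -/
lemma s10_height_eq_trdeg (K : Type*) [Field K] (B : Type*) [CommRing B] [IsDomain B] [Algebra K B]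
    [Algebra.FiniteType K B] : ∃ n : ℕ, Algebra.trdeg K B = n ∧
      ∀ (q : Ideal B), q.IsMaximal → q.height = n := by
  obtain ⟨n, g, hinj, hintg⟩ := exists_integral_inj_algHom_of_fg K B
  algebraize [g.toRingHom]
  have : IsNoetherianRing B := Algebra.FiniteType.isNoetherianRing K B
  have : FaithfulSMul (MvPolynomial (Fin n) K) B := by
    rw [faithfulSMul_iff_algebraMap_injective]; exact hinj
  refine ⟨n, ?_, fun q hq => ?_⟩
  · have h1 := lift_trdeg_add_eq K (MvPolynomial (Fin n) K) B
    rw [trdeg_eq_zero (R := MvPolynomial (Fin n) K) (A := B), MvPolynomial.trdeg_of_isDomain] at h1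
    have := h1.symm
    simpa using this
  · let p := q.under (MvPolynomial (Fin n) K)
    have hp : p.IsMaximal := Ideal.isMaximal_comap_of_isIntegral_of_isMaximal q
    have : q.LiesOver p := ⟨rfl⟩
    rw [Ideal.height_eq_height_add_of_liesOver_of_hasGoingDown p q, s10_height_mvPoly]
    have hp' : ringKrullDim (B ⧸ p.map (algebraMap (MvPolynomial (Fin n) K) B)) ≤ 0 := by
      have : Algebra.IsIntegral (MvPolynomial (Fin n) K ⧸ p) (B ⧸ p.map (algebraMap (MvPolynomial (Fin n) K) B)) := by
        constructor
        intro x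
        obtain ⟨x, rfl⟩ := Ideal.Quotient.mk_surjective x
        have h := (Algebra.IsIntegral.isIntegral (R := MvPolynomial (Fin n) K) x).map
          (Ideal.Quotient.mkₐ (MvPolynomial (Fin n) K) (p.map (algebraMap (MvPolynomial (Fin n) K) B)))
        exact h.tower_top
      have h0 := s10_dim_le_of_integral (R := MvPolynomial (Fin n) K ⧸ p) 
        (S := B ⧸ p.map (algebraMap (MvPolynomial (Fin n) K) B))
      let _ := Ideal.Quotient.field p
      simpa using h0
    set q' := q.map (Ideal.Quotient.mk (p.map (algebraMap (MvPolynomial (Fin n) K) B)))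
    have h3 : q' ≠ ⊤ := by
      have : q'.IsMaximal := by
        refine .map_of_surjective_of_ker_le Ideal.Quotient.mk_surjective ?_
        rw [Ideal.mk_ker]; exact Ideal.map_comap_le
      exact this.ne_top
    have := (Ideal.height_le_ringKrullDim_of_ne_top h3).trans hp'
    have h2 : q'.height ≤ 0 := by exact_mod_cast this
    simp at h2
    simp [h2]


/-- spreading out integrality from the generic fibre -/
lemma s10_integral_mult {P A B Bk : Type*} [CommRing P] [Nontrivial P] [CommRing A]
    [CommRing B] [CommRing Bk] [Algebra A P] [Algebra A B] [Algebra P B] [IsScalarTower A P B] [Algebra B Bk] [IsDomain A]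
    [IsLocalization (Algebra.algebraMapSubmonoid B (nonZeroDivisors A)) Bk] (x : B)
    (hx : ((algebraMap B Bk).comp (algebraMap P B)).IsIntegralElem (algebraMap B Bk x)) :
    ∃ d : A, d ≠ 0 ∧ IsIntegral P (algebraMap A B d * x) := by
  obtain ⟨p, hp, hpx⟩ := hx
  have h1 : algebraMap B Bk (Polynomial.eval₂ (algebraMap P B) x (p * Polynomial.X)) = 0 := by
    rw [Polynomial.hom_eval₂, Polynomial.eval₂_mul, hpx, zero_mul]
  rw [IsLocalization.map_eq_zero_iff (Algebra.algebraMapSubmonoid B (nonZeroDivisors A))] at h1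
  obtain ⟨⟨_, d, hd, rfl⟩, h⟩ := h1
  refine ⟨d, nonZeroDivisors.ne_zero hd, (p * Polynomial.X).scaleRoots (algebraMap A P d), ?_, ?_⟩
  · rw [Polynomial.monic_scaleRoots_iff]; exact hp.mul Polynomial.monic_X
  · rw [IsScalarTower.algebraMap_apply A P B, Polynomial.scaleRoots_eval₂_mul]
    rw [hp.natDegree_mul Polynomial.monic_X, Polynomial.natDegree_X, pow_succ, mul_assoc,
      ← IsScalarTower.algebraMap_apply A P B]
    erw [h]
    simp

attribute [local instance] MvPolynomial.algebraMvPolynomial in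
lemma s10_spread {A k B Bk : Type} [CommRing A] [IsDomain A] [Field k] [CommRing B] [CommRing Bk]
    [Algebra A k] [IsFractionRing A k] [Algebra A B] [Algebra B Bk] [Algebra A Bk] [Algebra k Bk]
    [IsScalarTower A B Bk] [IsScalarTower A k Bk]
    [IsLocalization (Algebra.algebraMapSubmonoid B (nonZeroDivisors A)) Bk] [Nontrivial Bk]
    [Algebra.FiniteType k Bk] :
    ∃ (r : ℕ) (b : Fin r → B),
      (∃ p : Ideal B, p.IsPrime ∧
        Function.Injective ((Ideal.Quotient.mkₐ A p).comp
          (MvPolynomial.aeval b : MvPolynomial (Fin r) A →ₐ[A] B))) ∧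
      ∀ x : B, ∃ d : A, d ≠ 0 ∧
        (MvPolynomial.aeval b : MvPolynomial (Fin r) A →ₐ[A] B).toRingHom.IsIntegralElem
          (algebraMap A B d * x) := by
  obtain ⟨r, g, hinj, hintg⟩ := exists_integral_inj_algHom_of_fg k Bk
  have hb : ∀ i, ∃ (b : B) (s : A), s ≠ 0 ∧ algebraMap A Bk s * g (MvPolynomial.X i) =
      algebraMap B Bk b := by
    intro i
    obtain ⟨⟨b, ⟨_, s, hs, rfl⟩⟩, h⟩ := IsLocalization.surj
      (Algebra.algebraMapSubmonoid B (nonZeroDivisors A)) (g (MvPolynomial.X i))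
    refine ⟨b, s, nonZeroDivisors.ne_zero hs, ?_⟩
    rw [mul_comm, ← h, IsScalarTower.algebraMap_apply A B Bk]
  choose b s hs hbs using hb
  have hs' : ∀ i, algebraMap A k (s i) ≠ 0 := fun i => by
    simpa using hs i
  let σ : MvPolynomial (Fin r) k ≃ₐ[k] MvPolynomial (Fin r) k := AlgEquiv.ofAlgHom
    (MvPolynomial.aeval fun i => MvPolynomial.C (algebraMap A k (s i)) * MvPolynomial.X i)
    (MvPolynomial.aeval fun i => MvPolynomial.C (algebraMap A k (s i))⁻¹ * MvPolynomial.X i)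
    (by
      ext1 i
      simp only [AlgHom.comp_apply, MvPolynomial.aeval_X, map_mul, AlgHom.id_apply]
      rw [← MvPolynomial.algebraMap_eq, AlgHom.commutes, MvPolynomial.algebraMap_eq, ← mul_assoc,
        ← map_mul, inv_mul_cancel₀ (hs' i)]
      simp)
    (by
      ext1 i
      simp only [AlgHom.comp_apply, MvPolynomial.aeval_X, map_mul, AlgHom.id_apply]
      rw [← MvPolynomial.algebraMap_eq, AlgHom.commutes, MvPolynomial.algebraMap_eq, ← mul_assoc,
        ← map_mul, mul_inv_cancel₀ (hs' i)]
      simp)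
  let g' : MvPolynomial (Fin r) k →ₐ[k] Bk := g.comp σ.toAlgHom
  have hinj' : Function.Injective g' := hinj.comp σ.injective
  have hintg' : g'.toRingHom.IsIntegral :=
    RingHom.IsIntegral.trans σ.toAlgHom.toRingHom g.toRingHom
      (RingHom.isIntegral_of_surjective _ σ.surjective) hintg
  have hg'X : ∀ i, g' (MvPolynomial.X i) = algebraMap B Bk (b i) := by
    intro i
    rw [← hbs]
    simp only [g', σ, AlgHom.comp_apply]
    change g (MvPolynomial.aeval _ (MvPolynomial.X i)) = _
    rw [MvPolynomial.aeval_X, map_mul, ← MvPolynomial.algebraMap_eq, AlgHom.commutes,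
      ← IsScalarTower.algebraMap_apply]
  let φ : MvPolynomial (Fin r) A →ₐ[A] B := MvPolynomial.aeval b
  have hcomm : (algebraMap B Bk).comp φ.toRingHom = g'.toRingHom.comp
      (algebraMap (MvPolynomial (Fin r) A) (MvPolynomial (Fin r) k)) := by
    rw [MvPolynomial.algebraMap_def]
    apply MvPolynomial.ringHom_ext
    · intro a
      have h2 : g' (MvPolynomial.C (algebraMap A k a)) = algebraMap A Bk a := by
        rw [← MvPolynomial.algebraMap_eq, AlgHom.commutes, ← IsScalarTower.algebraMap_apply]
      simp [φ, h2, ← IsScalarTower.algebraMap_apply A B Bk]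
    · intro i
      simp [φ, hg'X]
  have hAk : Function.Injective (algebraMap (MvPolynomial (Fin r) A) (MvPolynomial (Fin r) k)) :=
    MvPolynomial.map_injective _ (IsFractionRing.injective A k)
  refine ⟨r, b, ?_, ?_⟩
  · let _ := g'.toRingHom.toAlgebra
    have : Algebra.IsIntegral (MvPolynomial (Fin r) k) Bk := ⟨hintg'⟩
    obtain ⟨Q, -, hQ, hQ2⟩ := Ideal.exists_ideal_over_prime_of_isIntegral
      (⊥ : Ideal (MvPolynomial (Fin r) k)) (⊥ : Ideal Bk)
      (by
        intro x hx
        have : g' x = 0 := hx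
        exact hinj' (by rw [this, map_zero]))
    refine ⟨Q.comap (algebraMap B Bk), inferInstance, ?_⟩
    rw [injective_iff_map_eq_zero]
    intro x hx
    have h1 : φ x ∈ Q.comap (algebraMap B Bk) := Ideal.Quotient.eq_zero_iff_mem.mp hx
    have h2 : g' (algebraMap _ (MvPolynomial (Fin r) k) x) ∈ Q := by
      have := RingHom.congr_fun hcomm x
      change algebraMap B Bk (φ x) = g' _ at this
      rw [← this]; exact h1
    have h3 : algebraMap _ (MvPolynomial (Fin r) k) x ∈ (⊥ : Ideal (MvPolynomial (Fin r) k)) := by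
      rw [← hQ2]; exact h2
    exact hAk (by rw [map_zero]; exact h3)
  · intro x
    let _ := φ.toRingHom.toAlgebra
    have : IsScalarTower A (MvPolynomial (Fin r) A) B := IsScalarTower.of_algebraMap_eq' (by
      exact φ.comp_algebraMap.symm)
    let _ := g'.toRingHom.toAlgebra
    let _ := ((algebraMap B Bk).comp φ.toRingHom).toAlgebra
    have : IsScalarTower (MvPolynomial (Fin r) A) (MvPolynomial (Fin r) k) Bk :=
      IsScalarTower.of_algebraMap_eq' hcomm
    obtain ⟨⟨_, c, hc, rfl⟩, hcx⟩ := IsIntegral.exists_multiple_integral_of_isLocalization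
      ((nonZeroDivisors A).map (MvPolynomial.C (σ := Fin r)))
      (Rₘ := MvPolynomial (Fin r) k) (algebraMap B Bk x) (hintg' _)
    obtain ⟨d, hd, hdx⟩ := s10_integral_mult (P := MvPolynomial (Fin r) A) (A := A) (Bk := Bk)
      (algebraMap A B c * x) (by
        convert! hcx using 1
        change _ = (algebraMap B Bk (φ (MvPolynomial.C c))) * _
        rw [map_mul]
        congr 2
        exact (φ.commutes c).symm)
    refine ⟨d * c, mul_ne_zero hd (nonZeroDivisors.ne_zero hc), ?_⟩
    rw [map_mul, mul_assoc]
    exact hdx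


/-- Generic fibre dimension. -/
lemma s10_generic (K : Type) {A B : Type} [Field K] [CommRing A] [IsDomain A] [Algebra K A]
    [Algebra.FiniteType K A] [CommRing B] [Algebra A B] [Algebra.FiniteType A B] [Algebra K B]
    [IsScalarTower K A B] :
    ∃ a : A, a ≠ 0 ∧ ∀ m : Ideal A, m.IsMaximal → a ∉ m → ∀ e : ℕ,
      ((e : ℕ∞) : WithBot ℕ∞) ≤ ringKrullDim (B ⧸ m.map (algebraMap A B)) →
      ∃ p : Ideal B, p.IsPrime ∧ p.comap (algebraMap A B) = ⊥ ∧
        ∀ q : Ideal (B ⧸ p), q.IsMaximal → m.height + e ≤ q.height := by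
  classical
  let k := FractionRing A
  let Bk := Localization (Algebra.algebraMapSubmonoid B (nonZeroDivisors A))
  let _ : Algebra k Bk := localizationAlgebra (nonZeroDivisors A) B
  have : IsScalarTower A k Bk := IsScalarTower.of_algebraMap_eq' (by
    change _ = (IsLocalization.map Bk (algebraMap A B) _ : k →+* Bk).comp (algebraMap A k)
    rw [IsLocalization.map_comp, ← IsScalarTower.algebraMap_eq A B Bk])
  have : Algebra.FiniteType k Bk := by
    have h : (algebraMap A B).FiniteType := (RingHom.finiteType_algebraMap).mpr ‹_›
    have : IsLocalization (Submonoid.map (algebraMap A B) (nonZeroDivisors A)) Bk :=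
      inferInstanceAs (IsLocalization (Algebra.algebraMapSubmonoid B (nonZeroDivisors A)) Bk)
    exact (RingHom.finiteType_algebraMap (A := k) (B := Bk)).mp
      (RingHom.finiteType_localizationPreserves (algebraMap A B) (nonZeroDivisors A) k Bk h)
  rcases subsingleton_or_nontrivial Bk with hs | hs
  · have h1 : algebraMap B Bk 1 = 0 := Subsingleton.elim _ _
    rw [IsLocalization.map_eq_zero_iff (Algebra.algebraMapSubmonoid B (nonZeroDivisors A))] at h1
    obtain ⟨⟨_, d, hd, rfl⟩, h⟩ := h1
    have h' : algebraMap A B d = 0 := by simpa using h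
    refine ⟨d, nonZeroDivisors.ne_zero hd, fun m hm hdm e he => ?_⟩
    exfalso
    have htop : m.map (algebraMap A B) = ⊤ := by
      obtain ⟨y, z, hz, hyz⟩ := hm.exists_inv hdm
      rw [Ideal.eq_top_iff_one]
      have : algebraMap A B z = 1 := by
        have := congrArg (algebraMap A B) hyz
        simpa [h'] using this
      rw [← this]; exact Ideal.mem_map_of_mem _ hz
    have : Subsingleton (B ⧸ m.map (algebraMap A B)) := Ideal.Quotient.subsingleton_iff.mpr htop
    rw [ringKrullDim_eq_bot_of_subsingleton] at he
    simp at he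
  obtain ⟨r, b, ⟨p, hp, hpinj⟩, hintg⟩ := s10_spread (A := A) (k := k) (B := B) (Bk := Bk)
  choose d hd hdint using hintg
  obtain ⟨G, hG⟩ := (Algebra.FiniteType.out : (⊤ : Subalgebra A B).FG)
  refine ⟨∏ x ∈ G, d x, Finset.prod_ne_zero_iff.mpr fun x _ => hd x, fun m hm ham e he => ?_⟩
  have hdm : ∀ x ∈ G, d x ∉ m := fun x hx hxm => ham (Ideal.mem_of_dvd m (Finset.dvd_prod_of_mem d hx) hxm)
  let _ : Field (A ⧸ m) := Ideal.Quotient.field m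
  let F := B ⧸ m.map (algebraMap A B)
  let π : B →+* F := Ideal.Quotient.mk _
  let ψ : MvPolynomial (Fin r) (A ⧸ m) →ₐ[A ⧸ m] F := MvPolynomial.aeval fun i => π (b i)
  have hcommA : ∀ x : A, algebraMap (A ⧸ m) F (Ideal.Quotient.mk m x) = π (algebraMap A B x) :=
    fun x => rfl
  have hcomm : π.comp (MvPolynomial.aeval b : MvPolynomial (Fin r) A →ₐ[A] B).toRingHom =
      ψ.toRingHom.comp (MvPolynomial.map (Ideal.Quotient.mk m)) := by
    apply MvPolynomial.ringHom_ext
    · intro a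
      simp [ψ, hcommA]
    · intro i
      simp [ψ]
  let _ := ψ.toRingHom.toAlgebra
  have : IsScalarTower (A ⧸ m) (MvPolynomial (Fin r) (A ⧸ m)) F :=
    IsScalarTower.of_algebraMap_eq' ψ.comp_algebraMap.symm
  have hFA : ∀ x : A, IsIntegral (MvPolynomial (Fin r) (A ⧸ m)) (π (algebraMap A B x)) := by
    intro x
    rw [← hcommA, IsScalarTower.algebraMap_apply (A ⧸ m) (MvPolynomial (Fin r) (A ⧸ m)) F]
    exact isIntegral_algebraMap
  have hFint : Algebra.IsIntegral (MvPolynomial (Fin r) (A ⧸ m)) F := by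
    constructor
    intro x
    obtain ⟨x, rfl⟩ := Ideal.Quotient.mk_surjective x
    have hx : x ∈ Algebra.adjoin A (G : Set B) := by rw [hG]; trivial
    change IsIntegral _ (π x)
    induction hx using Algebra.adjoin_induction with
    | mem x hx =>
      have h1 : IsIntegral (MvPolynomial (Fin r) (A ⧸ m)) (π (algebraMap A B (d x) * x)) := by
        obtain ⟨P, hP, hPx⟩ := hdint x
        refine ⟨P.map (MvPolynomial.map (Ideal.Quotient.mk m)), hP.map _, ?_⟩
        rw [Polynomial.eval₂_map]
        change Polynomial.eval₂ (ψ.toRingHom.comp _) _ _ = _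
        rw [← hcomm, ← Polynomial.hom_eval₂, hPx, map_zero]
      obtain ⟨y, z, hz, hyz⟩ := hm.exists_inv (hdm x hx)
      have h2 : π x = π (algebraMap A B y) * π (algebraMap A B (d x) * x) := by
        rw [← map_mul, ← mul_assoc, ← map_mul, map_mul, ← hcommA]
        have : Ideal.Quotient.mk m (y * d x) = 1 := by
          rw [← map_one (Ideal.Quotient.mk m), ← hyz, map_add, Ideal.Quotient.eq_zero_iff_mem.mpr hz,
            add_zero]
        rw [this, map_one, one_mul]
      rw [h2]
      exact (hFA y).mul h1
    | algebraMap x => exact hFA x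
    | add x y _ _ hx hy => rw [map_add]; exact hx.add hy
    | mul x y _ _ hx hy => rw [map_mul]; exact hx.mul hy
  have her : e ≤ r := by
    have h1 := he.trans (s10_dim_le_of_integral (R := MvPolynomial (Fin r) (A ⧸ m)) (S := F))
    simp at h1
    exact_mod_cast h1
  have hindep : AlgebraicIndependent A (fun i => Ideal.Quotient.mk p (b i)) := by
    rw [algebraicIndependent_iff_injective_aeval]
    convert! hpinj
    ext1 i
    simp
  have hAinj : Function.Injective (algebraMap A (B ⧸ p)) := hindep.algebraMap_injective
  refine ⟨p, hp, ?_, fun q hq => ?_⟩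
  · rw [← Ideal.mk_ker (I := p), RingHom.comap_ker]
    exact (RingHom.injective_iff_ker_eq_bot _).mp hAinj
  have : Algebra.FiniteType K B := Algebra.FiniteType.trans (S := A) ‹_› ‹_›
  have : Algebra.FiniteType K (B ⧸ p) := inferInstance
  obtain ⟨n, hn, hn'⟩ := s10_height_eq_trdeg K A
  obtain ⟨n', hn1, hn2⟩ := s10_height_eq_trdeg K (B ⧸ p)
  rw [hn' m hm, hn2 q hq]
  have : FaithfulSMul A (B ⧸ p) := (faithfulSMul_iff_algebraMap_injective _ _).mpr hAinj
  have htr := trdeg_add_eq K A (A := B ⧸ p)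
  have hle := hindep.cardinalMk_le_trdeg
  rw [hn, hn1] at htr
  rw [Cardinal.mk_fin] at hle
  have : (n : Cardinal) + r ≤ n' := by
    rw [← htr]; gcongr
  have : n + r ≤ n' := by exact_mod_cast this
  have : n + e ≤ n' := by omega
  exact_mod_cast this


lemma s10_chart {X Y : Scheme.{0}} (f : X ⟶ Y) [LocallyOfFiniteType f] {A : CommRingCat.{0}}
    (j : Spec A ⟶ Y) [IsOpenImmersion j] (x : X) (hx : f x ∈ Set.range j) :
    ∃ (B : CommRingCat.{0}) (i : Spec B ⟶ X) (φ : A ⟶ B), IsOpenImmersion i ∧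
      i ≫ f = Spec.map φ ≫ j ∧ φ.hom.FiniteType ∧ x ∈ Set.range i := by
  obtain ⟨B, i, hi, hxi, hr⟩ := Scheme.exists_affine_mem_range_and_range_subset
    (X := X) (x := x) (U := f ⁻¹ᵁ j.opensRange) (by simpa using hx)
  have hr' : Set.range (i ≫ f) ⊆ Set.range j := by
    rintro _ ⟨t, rfl⟩
    have : i t ∈ f ⁻¹ᵁ j.opensRange := hr ⟨t, rfl⟩
    simpa using this
  let g := IsOpenImmersion.lift j (i ≫ f) hr'
  refine ⟨B, i, Spec.preimage g, hi, ?_, ?_, hxi⟩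
  · rw [Spec.map_preimage, IsOpenImmersion.lift_fac]
  · have h1 : LocallyOfFiniteType (g ≫ j) := by
      rw [IsOpenImmersion.lift_fac]; infer_instance
    have h2 : LocallyOfFiniteType g := locallyOfFiniteType_of_comp g j
    rw [← Spec.map_preimage g] at h2
    exact (HasRingHomProperty.Spec_iff (P := @LocallyOfFiniteType)).mp h2

lemma s10_closed {X : Scheme.{0}} {R : CommRingCat.{0}} (i : Spec R ⟶ X) [IsOpenImmersion i]
   (t : Spec R) (h : IsClosed {i t}) : t.asIdeal.IsMaximal := by
  have : IsClosed ({t} : Set (Spec R)) := by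
    have := h.preimage i.continuous
    rwa [← Set.image_singleton, Set.preimage_image_eq _ i.isOpenEmbedding.injective] at this
  exact (PrimeSpectrum.isClosed_singleton_iff_isMaximal t).mp this

lemma s10_jac {K : Type} [Field K] {X : Scheme.{0}} (s : X ⟶ Spec (CommRingCat.of K))
    [LocallyOfFiniteType s] : JacobsonSpace X := LocallyOfFiniteType.jacobsonSpace s



lemma s10_dim_chart {K : Type} [Field K] {Z : Scheme.{0}} [IsIntegral Z]
    (s : Z ⟶ Spec (CommRingCat.of K)) [LocallyOfFiniteType s] (z : Z) :
    ∃ n : ℕ, ∃ U : Set Z, IsOpen U ∧ z ∈ U ∧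
      ∀ w ∈ U, IsClosed ({w} : Set Z) → Order.coheight w = (n : ℕ∞) := by
  obtain ⟨B, i, φ, hi, hc, hft, hz⟩ := s10_chart s (𝟙 (Spec (CommRingCat.of K))) z ⟨s z, by simp⟩
  have : Nonempty (Spec B) := ⟨hz.choose⟩
  have : IsIntegral (Spec B) := isIntegral_of_isOpenImmersion i
  have : IsDomain B := (affine_isIntegral_iff B).mp this
  let _ : Algebra K B := φ.hom.toAlgebra
  have : Algebra.FiniteType K B := hft
  obtain ⟨n, -, hn⟩ := s10_height_eq_trdeg K B
  refine ⟨n, Set.range i, i.isOpenEmbedding.isOpen_range, hz, ?_⟩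
  rintro _ ⟨t, rfl⟩ hcl
  have := coheight_eq_of_isOpenImmersion (x := t) i
  refine this.trans ?_
  rw [← idealHeight_eq_coheight]
  exact hn _ (s10_closed i t hcl)

lemma s10_dim {K : Type} [Field K] {Z : Scheme.{0}} [IsIntegral Z]
    (s : Z ⟶ Spec (CommRingCat.of K)) [LocallyOfFiniteType s] :
    ∃ N : ℕ, topologicalKrullDim Z = (N : ℕ∞) ∧
      ∀ z : Z, IsClosed ({z} : Set Z) → Order.coheight z = (N : ℕ∞) := by
  have : JacobsonSpace Z := LocallyOfFiniteType.jacobsonSpace s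
  have hcl : ∀ z : Z, ∃ w : Z, z ⤳ w ∧ IsClosed ({w} : Set Z) := by
    intro z
    obtain ⟨w, hw, hw'⟩ := nonempty_inter_closedPoints (Z := closure {z})
      ⟨z, subset_closure rfl⟩ isClosed_closure.isLocallyClosed
    exact ⟨w, specializes_iff_mem_closure.mpr hw, hw'⟩
  obtain ⟨w₀, -, hw₀⟩ := hcl (genericPoint Z)
  obtain ⟨N, U, hU, hwU, hN⟩ := s10_dim_chart s w₀
  have key : ∀ z : Z, IsClosed ({z} : Set Z) → Order.coheight z = (N : ℕ∞) := by
    intro z hz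
    obtain ⟨N', U', hU', hzU', hN'⟩ := s10_dim_chart s z
    obtain ⟨v, hv, hv'⟩ := nonempty_inter_closedPoints (Z := U ∩ U')
      (nonempty_preirreducible_inter hU hU' ⟨_, hwU⟩ ⟨_, hzU'⟩) (hU.inter hU').isLocallyClosed
    rw [hN' z hzU' hz, ← hN' v hv.2 hv', hN v hv.1 hv']
  refine ⟨N, ?_, key⟩
  rw [topologicalKrullDim, Order.krullDim_eq_of_orderIso irreducibleSetEquivPoints]
  let _ := specializationOrder Z
  rw [Order.krullDim_eq_iSup_coheight]
  apply le_antisymm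
  · refine iSup_le fun z => ?_
    obtain ⟨w, hzw, hw⟩ := hcl z
    have h1 : w ≤ z := hzw
    rw [← key w hw]
    exact_mod_cast Order.coheight_anti h1
  · rw [← key w₀ hw₀]
    exact le_iSup (fun z : Z => ((Order.coheight z : ℕ∞) : WithBot ℕ∞)) w₀


lemma s10_fib {X Y : Scheme.{0}} (f : X ⟶ Y) {A B : CommRingCat.{0}} (i : Spec B ⟶ X)
    (j : Spec A ⟶ Y) [IsOpenImmersion i] [IsOpenImmersion j] (φ : A ⟶ B)
    (hc : i ≫ f = Spec.map φ ≫ j) (v : Spec A) (hv : v.asIdeal.IsMaximal) :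
    ∃ g : PrimeSpectrum (B ⧸ v.asIdeal.map φ.hom) → (f ⁻¹' {j v} : Set X),
      Topology.IsOpenEmbedding g ∧
      (∀ t, (g t).1 = i (PrimeSpectrum.comap (Ideal.Quotient.mk (v.asIdeal.map φ.hom)) t)) ∧
      Set.range g = Subtype.val ⁻¹' (Set.range i) := by
  have hfi : ∀ t, f (i t) = j (Spec.map φ t) := fun t => by
    rw [← Scheme.Hom.comp_apply, hc, Scheme.Hom.comp_apply]
  let c := PrimeSpectrum.comap (Ideal.Quotient.mk (v.asIdeal.map φ.hom))
  have hcr : Set.range c = PrimeSpectrum.zeroLocus (v.asIdeal.map φ.hom) := by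
    have := range_comap_of_surjective _ (Ideal.Quotient.mk (v.asIdeal.map φ.hom))
      Ideal.Quotient.mk_surjective
    rwa [Ideal.mk_ker] at this
  have hiff : ∀ t : Spec B, t ∈ Set.range c ↔ f (i t) = j v := by
    intro t
    rw [hcr, hfi, j.isOpenEmbedding.injective.eq_iff]
    change (v.asIdeal.map φ.hom : Set B) ⊆ (t.asIdeal : Set B) ↔ _
    rw [SetLike.coe_subset_coe, Ideal.map_le_iff_le_comap]
    constructor
    · intro h
      apply PrimeSpectrum.ext
      exact (hv.eq_of_le (PrimeSpectrum.comap φ.hom t).isPrime.ne_top h).symm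
    · intro h
      rw [← h]; exact le_rfl
  let g : PrimeSpectrum (B ⧸ v.asIdeal.map φ.hom) → (f ⁻¹' {j v} : Set X) :=
    fun t => ⟨i (c t), (hiff _).mp ⟨t, rfl⟩⟩
  have hr : Set.range g = Subtype.val ⁻¹' (Set.range i) := by
    ext ⟨x, hx⟩
    constructor
    · rintro ⟨t, ht⟩
      exact ⟨c t, congrArg Subtype.val ht⟩
    · rintro ⟨t, rfl⟩
      obtain ⟨u, hu⟩ := (hiff t).mpr hx
      exact ⟨u, Subtype.ext (congrArg i hu)⟩
  have hcemb : Topology.IsEmbedding c := (PrimeSpectrum.isClosedEmbedding_comap_of_surjective _ _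
      Ideal.Quotient.mk_surjective).isEmbedding
  have hemb : Topology.IsEmbedding (Subtype.val ∘ g) := i.isOpenEmbedding.isEmbedding.comp hcemb
  refine ⟨g, ⟨(Topology.IsEmbedding.of_comp_iff Topology.IsEmbedding.subtypeVal).mp hemb, ?_⟩, fun _ => rfl, hr⟩
  rw [hr]
  exact i.isOpenEmbedding.isOpen_range.preimage continuous_subtype_val

lemma s10_fib_le {X Y : Scheme.{0}} (f : X ⟶ Y) {A B : CommRingCat.{0}} (i : Spec B ⟶ X)
    (j : Spec A ⟶ Y) [IsOpenImmersion i] [IsOpenImmersion j] (φ : A ⟶ B)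
    (hc : i ≫ f = Spec.map φ ≫ j) (v : Spec A) (hv : v.asIdeal.IsMaximal) :
    ringKrullDim (B ⧸ v.asIdeal.map φ.hom) ≤ topologicalKrullDim (f ⁻¹' {j v} : Set X) := by
  obtain ⟨g, hg, -⟩ := s10_fib f i j φ hc v hv
  rw [← PrimeSpectrum.topologicalKrullDim_eq_ringKrullDim]
  exact hg.isInducing.topologicalKrullDim_le

/-- a point of `F` near which the dimension is at least `e`. -/
lemma s10_point {F : Type*} [TopologicalSpace F] {e : ℕ}
    (h : ((e : ℕ∞) : WithBot ℕ∞) ≤ topologicalKrullDim F) :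
    ∃ x : F, ∀ (T : Type) [TopologicalSpace T] (g : T → F), Topology.IsOpenEmbedding g →
      x ∈ Set.range g → ((e : ℕ∞) : WithBot ℕ∞) ≤ topologicalKrullDim T := by
  obtain ⟨p, hp⟩ := (Order.le_krullDim_iff (α := TopologicalSpace.IrreducibleCloseds F)).mp h
  obtain ⟨x, hx⟩ := (p 0).isIrreducible.nonempty
  refine ⟨x, fun T _ g hg => ?_⟩
  rintro ⟨t, rfl⟩
  let Z : TopologicalSpace.IrreducibleCloseds T :=
    ⟨closure {t}, isIrreducible_singleton.closure, isClosed_closure⟩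
  have hZ : TopologicalSpace.IrreducibleCloseds.map g hg.continuous Z ≤ p 0 := by
    change closure (g '' closure {t}) ⊆ (p 0 : Set F)
    rw [closure_image_closure hg.continuous, Set.image_singleton]
    exact closure_minimal (Set.singleton_subset_iff.mpr hx) (p 0).isClosed
  have h1 : (e : ℕ∞) ≤ Order.coheight (p 0) := by
    rw [← hp]; exact Order.length_le_coheight_head
  have h2 : (e : ℕ∞) ≤ Order.coheight Z := by
    rw [← hg.coheight_map]
    exact h1.trans (Order.coheight_anti hZ)
  calc ((e : ℕ∞) : WithBot ℕ∞) ≤ (Order.coheight Z : ℕ∞) := by exact_mod_cast h2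
    _ ≤ _ := Order.coheight_le_krullDim Z

lemma s10_le_fib {X Y : Scheme.{0}} (f : X ⟶ Y) {A : CommRingCat.{0}} 
    (j : Spec A ⟶ Y) [IsOpenImmersion j]  (v : Spec A) (hv : v.asIdeal.IsMaximal) {e : ℕ}
    (h : ((e : ℕ∞) : WithBot ℕ∞) ≤ topologicalKrullDim (f ⁻¹' {j v} : Set X)) :
    ∃ x : X, f x = j v ∧ ∀ (B : CommRingCat.{0}) (i : Spec B ⟶ X) [IsOpenImmersion i] (φ : A ⟶ B)
      (_ : i ≫ f = Spec.map φ ≫ j), x ∈ Set.range i → 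
      ((e : ℕ∞) : WithBot ℕ∞) ≤ ringKrullDim (B ⧸ v.asIdeal.map φ.hom) := by
  obtain ⟨x, hx⟩ := s10_point h
  refine ⟨x.1, x.2, fun B i _ φ hc hxi => ?_⟩
  obtain ⟨g, hg, -, hr⟩ := s10_fib f i j φ hc v hv
  rw [← PrimeSpectrum.topologicalKrullDim_eq_ringKrullDim]
  exact hx _ g hg (by rw [hr]; exact hxi)


lemma s10_sub {X : Scheme.{0}} (x : X) : ∃ (Z : Scheme.{0}) (ι : Z ⟶ X), IsIntegral Z ∧
    IsClosedImmersion ι ∧ Set.range ι = closure {x} := by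
  let I := Scheme.IdealSheafData.vanishingIdeal (X := X) ⟨closure {x}, isClosed_closure⟩
  have hr : Set.range I.subschemeι = closure {x} := by
    rw [Scheme.IdealSheafData.range_subschemeι]
    simp [I]
  have hred : IsReduced I.subscheme := by
    have : ∀ U, IsReduced (I.subschemeCover.openCover.X U) := by
      intro U
      change IsReduced (Spec (.of (Γ(X, U.1) ⧸ I.ideal U)))
      have : _root_.IsReduced (Γ(X, U.1) ⧸ I.ideal U) := by
        rw [← Ideal.isRadical_iff_quotient_reduced]
        simp only [I]
        exact PrimeSpectrum.isRadical_vanishingIdeal _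
      infer_instance
    exact IsReduced.of_openCover _ I.subschemeCover.openCover
  have hirr : IrreducibleSpace I.subscheme := by
    have h1 : Topology.IsInducing I.subschemeι := I.subschemeι.isEmbedding.isInducing
    obtain ⟨z, hz⟩ : x ∈ Set.range I.subschemeι := by rw [hr]; exact subset_closure rfl
    have h2 : closure {z} = Set.univ := by
      rw [h1.closure_eq_preimage_closure_image, Set.image_singleton, hz, ← hr,
        Set.preimage_range]
    rw [irreducibleSpace_def, Set.top_eq_univ, ← h2]
    exact isIrreducible_singleton.closure
  exact ⟨_, I.subschemeι, isIntegral_of_irreducibleSpace_of_isReduced _, inferInstance, hr⟩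

lemma s10_fibineq {K : Type} [Field K] {Z Y : Scheme.{0}} (s : Y ⟶ Spec (CommRingCat.of K))
    [LocallyOfFiniteType s] (g : Z ⟶ Y) [LocallyOfFiniteType g] (z : Z)
    (hz : IsClosed ({z} : Set Z)) (hy : IsClosed ({g z} : Set Y)) :
    ((Order.coheight z : ℕ∞) : WithBot ℕ∞) ≤
      (Order.coheight (g z) : ℕ∞) + topologicalKrullDim (g ⁻¹' {g z} : Set Z) := by
  obtain ⟨A, j, α, hj, hcA, hftA, v, hv⟩ := s10_chart s (𝟙 (Spec (CommRingCat.of K))) (g z)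
    ⟨s (g z), by simp⟩
  obtain ⟨B, i, φ, hi, hc, hft, w, rfl⟩ := s10_chart g j z ⟨v, hv⟩
  have hwv : Spec.map φ w = v := by
    apply j.isOpenEmbedding.injective
    rw [hv, ← Scheme.Hom.comp_apply, ← hc, Scheme.Hom.comp_apply]
  rw [← hv] at hy ⊢
  have hvm := s10_closed j v hy
  have hwm := s10_closed i w hz
  have h1 : Order.coheight (i w) = w.asIdeal.height :=
    (coheight_eq_of_isOpenImmersion (x := w) i).trans (idealHeight_eq_coheight _ _).symm
  have h2 : Order.coheight (j v) = v.asIdeal.height :=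
    (coheight_eq_of_isOpenImmersion (x := v) j).trans (idealHeight_eq_coheight _ _).symm
  let _ : Algebra K A := α.hom.toAlgebra
  have : Algebra.FiniteType K A := hftA
  let _ : Algebra A B := φ.hom.toAlgebra
  have : Algebra.FiniteType A B := hft
  have : IsNoetherianRing A := Algebra.FiniteType.isNoetherianRing K A
  have : IsNoetherianRing B := Algebra.FiniteType.isNoetherianRing A B
  have : w.asIdeal.LiesOver v.asIdeal := ⟨by rw [← hwv]; rfl⟩
  have h3 := Ideal.height_le_height_add_of_liesOver v.asIdeal w.asIdeal
  have h4 := s10_fib_le g i j φ hc v hvm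
  have hle : v.asIdeal.map φ.hom ≤ w.asIdeal := Ideal.map_le_iff_le_comap.mpr (by rw [← hwv]; exact le_rfl)
  have hne : w.asIdeal.map (Ideal.Quotient.mk (v.asIdeal.map φ.hom)) ≠ ⊤ := by
    intro htop
    have := congrArg (Ideal.comap (Ideal.Quotient.mk (v.asIdeal.map φ.hom))) htop
    rw [Ideal.comap_map_of_surjective _ Ideal.Quotient.mk_surjective, ← RingHom.ker_eq_comap_bot,
      Ideal.mk_ker, sup_eq_left.mpr hle, Ideal.comap_top] at this
    exact hwm.ne_top this
  have h5 := Ideal.height_le_ringKrullDim_of_ne_top hne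
  rw [h1, h2]
  calc ((w.asIdeal.height : ℕ∞) : WithBot ℕ∞) ≤ _ := WithBot.coe_le_coe.mpr h3
    _ = (v.asIdeal.height : ℕ∞) + ((w.asIdeal.map (Ideal.Quotient.mk (v.asIdeal.map φ.hom))).height : ℕ∞) := by
      rw [WithBot.coe_add]; rfl
    _ ≤ _ := by gcongr; exact h5.trans h4


lemma s10_generic2 {K : Type} [Field K] {A B : CommRingCat.{0}} [IsDomain A]
    (α : CommRingCat.of K ⟶ A) (hα : α.hom.FiniteType) (φ : A ⟶ B) (hφ : φ.hom.FiniteType) :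
    ∃ a : A, a ≠ 0 ∧ ∀ m : Ideal A, m.IsMaximal → a ∉ m → ∀ e : ℕ,
      ((e : ℕ∞) : WithBot ℕ∞) ≤ ringKrullDim (B ⧸ m.map φ.hom) →
      ∃ p : Ideal B, p.IsPrime ∧ p.comap φ.hom = ⊥ ∧
        ∀ q : Ideal (B ⧸ p), q.IsMaximal → m.height + e ≤ q.height := by
  let _ : Algebra K A := α.hom.toAlgebra
  have : Algebra.FiniteType K A := hα
  let _ : Algebra A B := φ.hom.toAlgebra
  have : Algebra.FiniteType A B := hφ
  let _ : Algebra K B := (φ.hom.comp α.hom).toAlgebra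
  have : IsScalarTower K A B := IsScalarTower.of_algebraMap_eq' rfl
  exact s10_generic K (A := A) (B := B)

lemma s10_stepB {K : Type} [Field K] {X Y : Scheme.{0}} (s : Y ⟶ Spec (CommRingCat.of K))
    [LocallyOfFiniteType s] [IsIntegral Y] (f : X ⟶ Y) [LocallyOfFiniteType f] [QuasiCompact f]
    (d e : ℕ) (hd : ∀ y : Y, IsClosed ({y} : Set Y) → Order.coheight y = (d : ℕ∞))
    (he : ∀ y : Y, IsClosed ({y} : Set Y) →
      ((e : ℕ∞) : WithBot ℕ∞) ≤ topologicalKrullDim (f ⁻¹' {y} : Set X)) :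
    ∃ ζ : X, closure {f ζ} = Set.univ ∧ ∀ (Z : Type) [TopologicalSpace Z] (ι : Z → X),
      Topology.IsInducing ι → Set.range ι = closure {ζ} →
      (((d + e : ℕ) : ℕ∞) : WithBot ℕ∞) ≤ topologicalKrullDim Z := by
  classical
  have : JacobsonSpace Y := LocallyOfFiniteType.jacobsonSpace s
  obtain ⟨A, j, α, hj, hcA, hftA, v₀, hv₀⟩ := s10_chart s (𝟙 (Spec (CommRingCat.of K)))
    (genericPoint Y) ⟨s (genericPoint Y), by simp⟩
  have : Nonempty (Spec A) := ⟨v₀⟩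
  have : IsIntegral (Spec A) := isIntegral_of_isOpenImmersion j
  have : IsDomain A := (affine_isIntegral_iff A).mp this
  have hW : IsCompact (f ⁻¹' (Set.range j)) :=
    QuasiCompact.isCompact_preimage (f := f) _ j.isOpenEmbedding.isOpen_range
      (isCompact_range j.continuous)
  have hch : ∀ x : (f ⁻¹' (Set.range j) : Set X), ∃ (B : CommRingCat.{0}) (i : Spec B ⟶ X)
      (φ : A ⟶ B), IsOpenImmersion i ∧
      i ≫ f = Spec.map φ ≫ j ∧ φ.hom.FiniteType ∧ x.1 ∈ Set.range i :=
    fun x => s10_chart f j x.1 x.2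
  choose B i φ hi hc hft hx using hch
  choose a ha0 ha using fun x => s10_generic2 α hftA (φ x) (hft x)
  obtain ⟨t, ht⟩ := hW.elim_finite_subcover (fun x => Set.range (i x))
    (fun x => (i x).isOpenEmbedding.isOpen_range)
    (fun x hxW => Set.mem_iUnion.mpr ⟨⟨x, hxW⟩, hx ⟨x, hxW⟩⟩)
  let a' : A := ∏ x ∈ t, a x
  have ha' : a' ≠ 0 := Finset.prod_ne_zero_iff.mpr fun x _ => ha0 x
  -- a closed point of the chart off the bad locus
  obtain ⟨y, ⟨v, hvD, rfl⟩, hycl⟩ := nonempty_inter_closedPoints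
    (Z := j '' (PrimeSpectrum.basicOpen a' : Set (PrimeSpectrum A)))
    (Set.Nonempty.image _ ⟨⟨⊥, Ideal.isPrime_bot⟩, by
      change a' ∉ (⊥ : Ideal A)
      simpa using ha'⟩)
    (j.isOpenEmbedding.isOpenMap _ (PrimeSpectrum.basicOpen a').isOpen).isLocallyClosed
  replace hvD : a' ∉ v.asIdeal := hvD
  have hvm := s10_closed j v hycl
  obtain ⟨x, hxv, hxe⟩ := s10_le_fib f j v hvm (he _ hycl)
  obtain ⟨k, hk⟩ := Set.mem_iUnion.mp (ht (show x ∈ f ⁻¹' (Set.range j) from ⟨v, hxv.symm⟩))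
  obtain ⟨hkt, hxk⟩ := Set.mem_iUnion.mp hk
  have := hi k
  have hake : a k ∉ v.asIdeal := fun h =>
    hvD (Ideal.mem_of_dvd _ (Finset.dvd_prod_of_mem a hkt) h)
  obtain ⟨p, hp, hpA, hq⟩ := ha k v.asIdeal hvm hake e (hxe _ (i k) (φ k) (hc k) hxk)
  let P : Spec (B k) := ⟨p, hp⟩
  refine ⟨i k P, ?_, ?_⟩
  · have h1 : f (i k P) = j (Spec.map (φ k) P) := by
      rw [← Scheme.Hom.comp_apply, hc, Scheme.Hom.comp_apply]
    have h2 : Spec.map (φ k) P = genericPoint (Spec A) := by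
      rw [genericPoint_eq_bot_of_affine]
      exact PrimeSpectrum.ext hpA
    have h3 : j (genericPoint (Spec A)) = genericPoint Y :=
      genericPoint_eq_of_isOpenImmersion j
    rw [h1, h2, h3]
    exact (genericPoint_spec Y)
  · intro Z _ ι hι hr
    let c := PrimeSpectrum.comap (Ideal.Quotient.mk p)
    have hcemb : Topology.IsEmbedding c := (PrimeSpectrum.isClosedEmbedding_comap_of_surjective _ _
      Ideal.Quotient.mk_surjective).isEmbedding
    have hlift : ∀ u, ∃ z, ι z = i k (c u) := by
      intro u
      have : i k (c u) ∈ Set.range ι := by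
        rw [hr, ← specializes_iff_mem_closure]
        refine Specializes.map ?_ (i k).continuous
        refine (PrimeSpectrum.le_iff_specializes P (c u)).mp ?_
        change p ≤ Ideal.comap (Ideal.Quotient.mk p) u.asIdeal
        intro r hr
        rw [Ideal.mem_comap, Ideal.Quotient.eq_zero_iff_mem.mpr hr]
        exact zero_mem _
      exact this
    choose g hg using hlift
    have hcomp : ι ∘ g = i k ∘ c := funext hg
    have hgi : Topology.IsInducing g := by
      rw [← hι.of_comp_iff, hcomp]
      exact (i k).isOpenEmbedding.isInducing.comp hcemb.isInducing
    have h1 := hgi.topologicalKrullDim_le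
    rw [PrimeSpectrum.topologicalKrullDim_eq_ringKrullDim] at h1
    refine le_trans ?_ h1
    obtain ⟨q, hqm⟩ := Ideal.exists_maximal (B k ⧸ p)
    have h2 := hq q hqm
    have h3 : v.asIdeal.height = d := by
      rw [← hd _ hycl]
      exact ((coheight_eq_of_isOpenImmersion (x := v) j).trans (idealHeight_eq_coheight _ _).symm).symm
    rw [h3] at h2
    refine le_trans ?_ (Ideal.height_le_ringKrullDim_of_ne_top hqm.ne_top)
    exact_mod_cast h2


lemma s10_full {F W : Type*} [TopologicalSpace F] [TopologicalSpace W] [hF : IrreducibleSpace F]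
    (h : W → F) (hh : Topology.IsClosedEmbedding h) {e : ℕ}
    (he : topologicalKrullDim F = (e : ℕ∞))
    (hW : ((e : ℕ∞) : WithBot ℕ∞) ≤ topologicalKrullDim W) : Set.range h = Set.univ := by
  obtain ⟨p, hp⟩ := (Order.le_krullDim_iff (α := TopologicalSpace.IrreducibleCloseds W)).mp hW
  let p' := p.map _ (TopologicalSpace.IrreducibleCloseds.map_strictMono_of_isInducing hh.isInducing)
  let T : TopologicalSpace.IrreducibleCloseds F :=
    ⟨Set.univ, IrreducibleSpace.isIrreducible_univ F, isClosed_univ⟩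
  by_contra hne
  have hlt : p'.last < T := by
    refine lt_of_le_of_ne (fun x _ => Set.mem_univ x) fun heq => hne ?_
    have h1 : (p'.last : Set F) = Set.univ := by rw [heq]; rfl
    have h2 : (p'.last : Set F) ⊆ Set.range h := by
      change closure (h '' _) ⊆ _
      exact closure_minimal (Set.image_subset_range _ _) hh.isClosed_range
    rw [h1] at h2
    exact Set.univ_subset_iff.mp h2
  have h3 := Order.LTSeries.length_le_krullDim (p'.snoc T hlt)
  have h4 : (p'.snoc T hlt).length = e + 1 := by simp [p', hp]
  rw [h4] at h3
  have h5 : (((e + 1 : ℕ) : ℕ∞) : WithBot ℕ∞) ≤ ((e : ℕ∞) : WithBot ℕ∞) := by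
    rw [← he]; exact h3
  have : e + 1 ≤ e := by exact_mod_cast h5
  omega

/-- Let `f : X ⟶ Y` be a proper morphism of algebraic varieties
(reduced schemes of finite type) over an algebraically closed field `K`. Assume that `Y` is
irreducible of dimension `d` and that for every closed point `y` of `Y` the fiber
`f⁻¹ (y)` is irreducible of dimension `e`. Then `X` is irreducible of dimension `d + e`. -/
theorem stmt10 {K : Type} [Field K] [IsAlgClosed K]
    (X Y : Scheme) [IsReduced X] [IsReduced Y]
    (sX : X ⟶ Spec (CommRingCat.of K)) (sY : Y ⟶ Spec (CommRingCat.of K))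
    [LocallyOfFiniteType sX] [QuasiCompact sX]
    [LocallyOfFiniteType sY] [QuasiCompact sY]
    (f : X ⟶ Y) (hf : f ≫ sY = sX) [IsProper f]
    (d e : ℕ)
    (hYirr : IrreducibleSpace Y) (hYdim : topologicalKrullDim Y = (d : ℕ∞))
    (hfib : ∀ y : Y, IsClosed ({y} : Set Y) →
      IrreducibleSpace (f.base ⁻¹' {y}) ∧
        topologicalKrullDim (f.base ⁻¹' {y}) = (e : ℕ∞)) :
    IrreducibleSpace X ∧ topologicalKrullDim X = ((d + e : ℕ) : ℕ∞) := by
  have hfirr : ∀ y : Y, IsClosed ({y} : Set Y) → IrreducibleSpace (f ⁻¹' {y} : Set X) :=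
    fun y hy => (hfib y hy).1
  have hfdim : ∀ y : Y, IsClosed ({y} : Set Y) →
      topologicalKrullDim (f ⁻¹' {y} : Set X) = (e : ℕ∞) :=
    fun y hy => (hfib y hy).2
  clear hfib
  have : IsIntegral Y := isIntegral_of_irreducibleSpace_of_isReduced _
  have : JacobsonSpace X := LocallyOfFiniteType.jacobsonSpace sX
  have : JacobsonSpace Y := LocallyOfFiniteType.jacobsonSpace sY
  obtain ⟨N, hN, hd⟩ := s10_dim sY
  obtain rfl : N = d := by rw [hYdim] at hN; exact_mod_cast hN.symm
  obtain ⟨ζ, hζ, hζdim⟩ := s10_stepB sY f N e hd (fun y hy => (hfdim y hy).ge)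
  obtain ⟨Z, ι, _, _, hr⟩ := s10_sub ζ
  have hι : Topology.IsClosedEmbedding ι := ι.isClosedEmbedding
  have : JacobsonSpace Z := LocallyOfFiniteType.jacobsonSpace (ι ≫ sX)
  obtain ⟨M, hM, hMz⟩ := s10_dim (ι ≫ sX)
  have hM1 : N + e ≤ M := by
    have := hζdim Z ι hι.isInducing hr
    rw [hM] at this
    exact_mod_cast this
  let g := ι ≫ f
  have hgcl : IsClosedMap g := g.isClosedMap
  have hgsurj : Set.range g = Set.univ := by
    rw [← Set.univ_subset_iff, ← hζ]
    refine closure_minimal ?_ hgcl.isClosed_range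
    obtain ⟨z, hz⟩ : ζ ∈ Set.range ι := by rw [hr]; exact subset_closure rfl
    rw [Set.singleton_subset_iff]
    exact ⟨z, by simp [g, hz]⟩
  have hfull : ∀ y : Y, IsClosed ({y} : Set Y) → M ≤ N + e ∧ f ⁻¹' {y} ⊆ Set.range ι := by
    intro y hy
    obtain ⟨z₀, hz₀⟩ : y ∈ Set.range g := by rw [hgsurj]; trivial
    obtain ⟨z, hzy, hzcl⟩ := nonempty_inter_closedPoints (Z := g ⁻¹' {y}) ⟨z₀, hz₀⟩
      (hy.preimage g.continuous).isLocallyClosed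
    obtain rfl : g z = y := hzy
    have h1 := s10_fibineq sY g z hzcl hy
    rw [hMz z hzcl, hd _ hy] at h1
    let r : (g ⁻¹' {g z} : Set Z) → (f ⁻¹' {g z} : Set X) :=
      fun w => ⟨ι w.1, by
        have := w.2
        simpa [g] using this⟩
    have hremb : Topology.IsClosedEmbedding r := by
      refine Topology.IsClosedEmbedding.of_comp_iff
        (Topology.IsClosedEmbedding.subtypeVal (hy.preimage f.continuous)) |>.mp ?_
      exact hι.comp (Topology.IsClosedEmbedding.subtypeVal (hy.preimage g.continuous))
    have h2 := hremb.isInducing.topologicalKrullDim_le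
    rw [hfdim _ hy] at h2
    have hfd : ∃ k : ℕ, topologicalKrullDim (g ⁻¹' {g z} : Set Z) = (k : ℕ∞) := by
      generalize topologicalKrullDim (g ⁻¹' {g z} : Set Z) = D at h1 h2
      induction D with
      | bot => simp at h1
      | coe D =>
        have h2' : D ≤ e := by exact_mod_cast h2
        obtain ⟨k, hk⟩ := ENat.ne_top_iff_exists.mp (ne_top_of_le_ne_top (ENat.natCast_ne_top e) h2')
        exact ⟨k, by rw [hk]⟩
    obtain ⟨k, hk⟩ := hfd
    rw [hk] at h1 h2
    have h1' : M ≤ N + k := by exact_mod_cast h1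
    have h2' : k ≤ e := by exact_mod_cast h2
    refine ⟨by omega, ?_⟩
    have hek : e ≤ k := by omega
    have := hfirr _ hy
    have h3 := s10_full r hremb (hfdim _ hy) (by rw [hk]; exact_mod_cast hek)
    intro x hx
    have : (⟨x, hx⟩ : (f ⁻¹' {g z} : Set X)) ∈ Set.range r := by rw [h3]; trivial
    obtain ⟨w, hw⟩ := this
    exact ⟨w.1, congrArg Subtype.val hw⟩
  have hrange : Set.range ι = Set.univ := by
    rw [← Set.univ_subset_iff, ← closure_closedPoints]
    refine closure_minimal ?_ hι.isClosed_range
    intro x hx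
    have : IsClosed ({f x} : Set Y) := by
      rw [← Set.image_singleton]
      exact f.isClosedMap _ hx
    exact (hfull _ this).2 rfl
  have hM2 : M = N + e := by
    obtain ⟨y, -, hy⟩ := nonempty_inter_closedPoints (Z := (Set.univ : Set Y)) Set.univ_nonempty
      isOpen_univ.isLocallyClosed
    exact le_antisymm (hfull y hy).1 hM1
  constructor
  · rw [irreducibleSpace_def, Set.top_eq_univ, ← hrange, hr]
    exact isIrreducible_singleton.closure
  · have hhom : IsHomeomorph ι :=
      ⟨hι.continuous, hι.isEmbedding.isOpenEmbedding_of_surjective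
        (Set.range_eq_univ.mp hrange) |>.isOpenMap, hι.injective, Set.range_eq_univ.mp hrange⟩
    rw [← hhom.topologicalKrullDim_eq, hM, hM2]
end

section
/- Let f : X → Y be a proper morphism of algebraic varieties over an algebraically closed field K. Let B ⊆ Y be a locally closed subset which is equi-dimensional of dimension d ∈ ℕ, and let A ⊆ X be a locally closed subset for which there exists e ∈ ℕ such that for every closed point b ∈ B the set f⁻¹(b) ∩ A is irreducible of dimension e and dense in f⁻¹(b) ∩ Ā, where Ā denotes the closure of A in X. Then f⁻¹(B) ∩ A is equi-dimensional of dimension d + e, and the number of irreducible components of f⁻¹(B) ∩ A equals the number of irreducible components of B. -/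
open AlgebraicGeometry CategoryTheory

theorem h11_height_mvPoly {k : Type} [Field k] (n : ℕ) (m : Ideal (MvPolynomial (Fin n) k))
    [hm : m.IsMaximal] : m.height = n := by
  induction n with
  | zero =>
    have h0 : ringKrullDim (MvPolynomial (Fin 0) k) = 0 := by simp
    have := Ideal.height_le_ringKrullDim_of_ne_top hm.ne_top
    rw [h0] at this
    have h1 : m.height ≤ 0 := by exact_mod_cast this
    simpa using h1
  | succ n ih =>
    let e := (MvPolynomial.finSuccEquiv k n).toRingEquiv
    have h1 : (m.map e).IsMaximal := Ideal.map_isMaximal_of_equiv e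
    have h2 : ((m.map e).comap (Polynomial.C)).IsMaximal :=
      Polynomial.isMaximal_comap_C_of_isJacobsonRing _
    have h3 : (m.map e).LiesOver ((m.map e).comap (Polynomial.C)) := ⟨rfl⟩
    have h4 := Polynomial.height_eq_height_add_one ((m.map e).comap (Polynomial.C)) (m.map e)
    rw [ih, RingEquiv.height_map] at h4
    rw [h4]; simp

theorem h11_krull_le_of_integral {A B : Type} [CommRing A] [CommRing B] (g : A →+* B)
    (hg : g.IsIntegral) : ringKrullDim B ≤ ringKrullDim A := by
  algebraize [g]
  have : Algebra.IsIntegral A B := ⟨hg⟩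
  refine Order.krullDim_le_of_strictMono (PrimeSpectrum.comap (algebraMap A B)) ?_
  intro p q hpq
  exact Ideal.IsIntegral.comap_lt_comap (I := p.asIdeal) (J := q.asIdeal) hpq

/-- heights of maximal ideals in a finitely generated domain -/
theorem h11_height_aux {k S : Type} [Field k] [CommRing S] [IsDomain S] [Algebra k S]
    [Algebra.FiniteType k S] :
    ∃ s : ℕ, (∀ n : Ideal S, n.IsMaximal → n.height = s) ∧ Algebra.trdeg k S = s ∧
      ringKrullDim S = s := by
  obtain ⟨s, g, hinj, hintg⟩ := exists_integral_inj_algHom_of_fg k S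
  algebraize [g.toRingHom]
  have : Algebra.IsIntegral (MvPolynomial (Fin s) k) S := ⟨hintg⟩
  have : FaithfulSMul (MvPolynomial (Fin s) k) S :=
    (faithfulSMul_iff_algebraMap_injective _ _).mpr hinj
  have hN : IsNoetherianRing S := Algebra.FiniteType.isNoetherianRing k S
  have hh : ∀ n : Ideal S, n.IsMaximal → n.height = s := by
    intro n hn
    have hm : (n.under (MvPolynomial (Fin s) k)).IsMaximal := inferInstance
    rw [Ideal.height_eq_height_add_of_liesOver_of_hasGoingDown
      (n.under (MvPolynomial (Fin s) k)) n, h11_height_mvPoly]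
    set m := (n.under (MvPolynomial (Fin s) k)) with hmdef
    have h0 : ringKrullDim (S ⧸ m.map (algebraMap _ S)) ≤ 0 := by
      have hf : ringKrullDim (MvPolynomial (Fin s) k ⧸ m) = 0 :=
        ringKrullDim_eq_zero_of_isField ((Ideal.Quotient.maximal_ideal_iff_isField_quotient m).mp hm)
      rw [← hf]
      refine h11_krull_le_of_integral
        (Ideal.quotientMap (m.map (algebraMap _ S)) (algebraMap _ S) Ideal.le_comap_map) ?_
      refine RingHom.IsIntegral.tower_top (Ideal.Quotient.mk m) _ ?_
      rw [Ideal.quotientMap_comp_mk]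
      exact RingHom.IsIntegral.trans _ _ hintg
        (RingHom.isIntegral_of_surjective _ Ideal.Quotient.mk_surjective)
    have hne : n.map (Ideal.Quotient.mk (m.map (algebraMap _ S))) ≠ ⊤ := by
      have : (n.map (Ideal.Quotient.mk (m.map (algebraMap _ S)))).IsPrime :=
        Ideal.isPrime_map_quotientMk_of_isPrime (Ideal.map_le_iff_le_comap.mpr le_rfl)
      exact this.ne_top
    have h1 := (Ideal.height_le_ringKrullDim_of_ne_top hne).trans h0
    have h2 : (n.map (Ideal.Quotient.mk (m.map (algebraMap _ S)))).height ≤ 0 := by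
      exact_mod_cast h1
    rw [nonpos_iff_eq_zero.mp h2, add_zero]
  refine ⟨s, hh, ?_, ?_⟩
  · have h1 := trdeg_add_eq k (MvPolynomial (Fin s) k) (A := S)
    rw [trdeg_eq_zero_iff (R := MvPolynomial (Fin s) k) (A := S) |>.mpr inferInstance, MvPolynomial.trdeg_of_isDomain] at h1
    simpa using h1.symm
  · apply le_antisymm
    · rw [ringKrullDim_le_iff_isMaximal_height_le]
      intro n hn
      rw [hh n hn]; rfl
    · obtain ⟨n, hn⟩ := Ideal.exists_maximal S
      have := Ideal.height_le_ringKrullDim_of_ne_top hn.ne_top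
      rw [hh n hn] at this
      exact this

theorem h11_height_eq {k S : Type} [Field k] [CommRing S] [IsDomain S] [Algebra k S]
    [Algebra.FiniteType k S] (n : Ideal S) (hn : n.IsMaximal) :
    (n.height : WithBot ℕ∞) = ringKrullDim S := by
  obtain ⟨s, h1, h2, h3⟩ := h11_height_aux (k := k) (S := S)
  rw [h3, h1 n hn]; rfl

/-- algebraic form of the lower bound -/
theorem h11_alg_L {k R S : Type} [Field k] [CommRing R] [IsDomain R] [Algebra k R]
    [Algebra.FiniteType k R] [CommRing S] [IsDomain S] [Algebra k S]
    [Algebra.FiniteType k S] (φ : R →+* S) (n : Ideal S) (hn : n.IsMaximal) :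
    ringKrullDim S ≤ ringKrullDim R + ringKrullDim (S ⧸ (n.comap φ).map φ) := by
  algebraize [φ]
  have : IsNoetherianRing S := Algebra.FiniteType.isNoetherianRing k S
  have : IsNoetherianRing R := Algebra.FiniteType.isNoetherianRing k R
  rw [← h11_height_eq (k := k) n hn]
  have hL : n.LiesOver (n.comap φ) := ⟨rfl⟩
  have h1 := Ideal.height_le_height_add_of_liesOver (n.comap φ) n
  have hne : n.map (Ideal.Quotient.mk ((n.comap φ).map (algebraMap R S))) ≠ ⊤ := by
    have : (n.map (Ideal.Quotient.mk ((n.comap φ).map (algebraMap R S)))).IsPrime :=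
      Ideal.isPrime_map_quotientMk_of_isPrime (Ideal.map_le_iff_le_comap.mpr le_rfl)
    exact this.ne_top
  refine (WithBot.coe_le_coe.mpr h1).trans ?_
  rw [WithBot.coe_add]
  exact add_le_add (Ideal.height_le_ringKrullDim_of_ne_top (hn.isPrime.comap φ).ne_top)
    (Ideal.height_le_ringKrullDim_of_ne_top hne)

/-- localizing does not change the dimension -/
theorem h11_dim_away {k S : Type} [Field k] [CommRing S] [IsDomain S] [Algebra k S]
    [Algebra.FiniteType k S] (h : S) (hh : h ≠ 0) :
    ringKrullDim (Localization.Away h) = ringKrullDim S := by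
  have hdom : IsDomain (Localization.Away h) :=
    IsLocalization.isDomain_localization (powers_le_nonZeroDivisors_of_noZeroDivisors hh)
  have hfs : Algebra.FiniteType S (Localization.Away h) :=
    IsLocalization.finiteType_of_monoid_fg (Submonoid.powers h) _
  have : Algebra.FiniteType k (Localization.Away h) := Algebra.FiniteType.trans (S := S) ‹_› hfs
  have hJ : IsJacobsonRing S := isJacobsonRing_of_finiteType (A := k)
  obtain ⟨n, hn⟩ := Ideal.exists_maximal (Localization.Away h)
  have hm : (n.under S).IsMaximal :=
    (IsLocalization.isMaximal_iff_isMaximal_disjoint (Localization.Away h) h n).mp hn |>.1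
  rw [← h11_height_eq (k := k) n hn, ← h11_height_eq (k := k) _ hm]
  congr 1
  exact (IsLocalization.height_under (Submonoid.powers h) n).symm

attribute [local instance] MvPolynomial.algebraMvPolynomial in
theorem h11_generic {R S : Type} [CommRing R] [IsDomain R] [CommRing S] [IsDomain S] [Algebra R S]
    [FaithfulSMul R S] [Algebra.FiniteType R S] :
    ∃ r : ℕ, (r : Cardinal) ≤ Algebra.trdeg R S ∧ ∃ m : R, m ≠ 0 ∧
      ∀ p : Ideal R, p.IsMaximal → m ∉ p →
        ringKrullDim (S ⧸ p.map (algebraMap R S)) ≤ r := by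
  classical
  let K := FractionRing R
  let L := FractionRing S
  have hRL : FaithfulSMul R L := FaithfulSMul.trans R S L
  letI : Algebra K L := FractionRing.liftAlgebra R L
  have : IsScalarTower R K L := FractionRing.isScalarTower_liftAlgebra R L
  obtain ⟨T, hT⟩ := Algebra.FiniteType.out (R := R) (A := S)
  let SK := Algebra.adjoin K (algebraMap S L '' (T : Set S))
  have hSKft : Algebra.FiniteType K SK :=
    Algebra.FiniteType.adjoin_of_finite (T.finite_toSet.image _)
  have hden : ∀ z ∈ SK, ∃ d : R, d ≠ 0 ∧ ∃ s : S, algebraMap R L d * z = algebraMap S L s := by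
    intro z hz
    induction hz using Algebra.adjoin_induction with
    | mem x hx =>
      obtain ⟨s, hs, rfl⟩ := hx
      exact ⟨1, one_ne_zero, s, by simp⟩
    | algebraMap c =>
      obtain ⟨a, b, hb, rfl⟩ := IsFractionRing.div_surjective (A := R) c
      refine ⟨b, nonZeroDivisors.ne_zero hb, algebraMap R S a, ?_⟩
      have hb0 : algebraMap R L b ≠ 0 := by
        simpa using nonZeroDivisors.ne_zero hb
      rw [map_div₀, ← IsScalarTower.algebraMap_apply R K L, ← IsScalarTower.algebraMap_apply R K L,
        ← IsScalarTower.algebraMap_apply R S L]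
      rw [mul_comm]; exact div_mul_cancel₀ _ hb0
    | add x y hx hy h1 h2 =>
      obtain ⟨d, hd, s, hs⟩ := h1
      obtain ⟨d', hd', s', hs'⟩ := h2
      refine ⟨d * d', mul_ne_zero hd hd', algebraMap R S d' * s + algebraMap R S d * s', ?_⟩
      simp only [map_mul, map_add, ← hs, ← hs', ← IsScalarTower.algebraMap_apply R S L]
      ring
    | mul x y hx hy h1 h2 =>
      obtain ⟨d, hd, s, hs⟩ := h1
      obtain ⟨d', hd', s', hs'⟩ := h2
      refine ⟨d * d', mul_ne_zero hd hd', s * s', ?_⟩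
      simp only [map_mul, ← hs, ← hs']
      ring
  obtain ⟨r, g, hginj, hgint⟩ := exists_integral_inj_algHom_of_fg K SK
  choose d hd x hx using fun i : Fin r => hden (g (MvPolynomial.X i) : SK) (g (MvPolynomial.X i)).2
  have hdL : ∀ i, algebraMap R L (d i) ≠ 0 := fun i => by simpa using hd i
  refine ⟨r, ?_, ?_⟩
  · have h1 := trdeg_add_eq R S (A := L)
    rw [trdeg_eq_zero_iff (R := S) (A := L) |>.mpr (IsLocalization.isAlgebraic L (nonZeroDivisors S)), add_zero] at h1
    have h2 := trdeg_add_eq R K (A := L)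
    have : Algebra.IsAlgebraic R K := IsLocalization.isAlgebraic K (nonZeroDivisors R)
    rw [trdeg_eq_zero_iff.mpr this, zero_add] at h2
    rw [h1, ← h2]
    have h3 := trdeg_le_of_injective (SK.val.comp g)
      (Subtype.val_injective.comp hginj)
    rw [MvPolynomial.trdeg_of_isDomain] at h3
    simpa using h3
  -- the evaluation map
  let h : MvPolynomial (Fin r) K →ₐ[K] L := MvPolynomial.aeval (fun i => algebraMap S L (x i))
  let u : MvPolynomial (Fin r) K →ₐ[K] MvPolynomial (Fin r) K :=
    MvPolynomial.aeval (fun i => MvPolynomial.C (algebraMap R K (d i))⁻¹ * MvPolynomial.X i)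
  have hu : SK.val.comp g = h.comp u := by
    apply MvPolynomial.algHom_ext
    intro i
    have := hx i
    simp only [AlgHom.comp_apply, h, u, MvPolynomial.aeval_X, map_mul, MvPolynomial.aeval_C,
      map_inv₀, Subalgebra.val_apply]
    rw [← this, ← IsScalarTower.algebraMap_apply R K L,
      inv_mul_cancel_left₀ (hdL i)]
  have hintg : ∀ y ∈ T, h.toRingHom.IsIntegralElem (algebraMap S L y) := by
    intro y hy
    have h1 : (⟨algebraMap S L y, Algebra.subset_adjoin ⟨y, hy, rfl⟩⟩ : SK) ∈ (⊤ : Set SK) := trivial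
    have h2 := hgint (⟨algebraMap S L y, Algebra.subset_adjoin ⟨y, hy, rfl⟩⟩ : SK)
    have h3 : (SK.val.toRingHom.comp g.toRingHom).IsIntegralElem (algebraMap S L y) := by
      obtain ⟨P, hP, hP2⟩ := h2
      refine ⟨P, hP, ?_⟩
      have := congrArg SK.val.toRingHom hP2
      rw [Polynomial.hom_eval₂] at this
      simpa using this
    have h4 : SK.val.toRingHom.comp g.toRingHom = h.toRingHom.comp u.toRingHom := by
      have := congrArg AlgHom.toRingHom hu
      exact this
    rw [h4] at h3
    exact RingHom.isIntegralElem.of_comp _ _ h3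
  -- clear denominators
  let φ : MvPolynomial (Fin r) R →ₐ[R] S := MvPolynomial.aeval x
  have hclear : ∀ y ∈ T, ∃ m : R, m ≠ 0 ∧ φ.toRingHom.IsIntegralElem (algebraMap R S m * y) := by
    intro y hy
    letI a1 : Algebra (MvPolynomial (Fin r) K) L := h.toRingHom.toAlgebra
    letI a2 : Algebra (MvPolynomial (Fin r) R) S := φ.toRingHom.toAlgebra
    have t2 : IsScalarTower (MvPolynomial (Fin r) R) S L := inferInstance
    have t1 : IsScalarTower (MvPolynomial (Fin r) R) (MvPolynomial (Fin r) K) L := by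
      refine IsScalarTower.of_algebraMap_eq' ?_
      rw [IsScalarTower.algebraMap_eq (MvPolynomial (Fin r) R) S L]
      change (algebraMap S L).comp φ.toRingHom = h.toRingHom.comp (MvPolynomial.map (algebraMap R K))
      apply MvPolynomial.ringHom_ext
      · intro c
        simp [φ, h, ← IsScalarTower.algebraMap_apply]
      · intro i
        simp [φ, h]
    have hi : IsIntegral (MvPolynomial (Fin r) K) (algebraMap S L y) := hintg y hy
    obtain ⟨⟨_, m, hm, rfl⟩, hmi⟩ := hi.exists_multiple_integral_of_isLocalization
      ((nonZeroDivisors R).map (MvPolynomial.C (σ := Fin r)))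
    refine ⟨m, nonZeroDivisors.ne_zero hm, ?_⟩
    have hmi' : IsIntegral (MvPolynomial (Fin r) R) (algebraMap S L (algebraMap R S m * y)) := by
      convert! hmi using 1
      rw [Submonoid.smul_def, Algebra.smul_def, map_mul]
      congr 1
      change _ = algebraMap S L (φ (MvPolynomial.C m))
      simp [φ]
    exact (isIntegral_algebraMap_iff (IsFractionRing.injective S L)).mp hmi'
  choose! m hm hmi using hclear
  refine ⟨∏ y ∈ T, m y, Finset.prod_ne_zero_iff.mpr hm, ?_⟩
  intro p hp hmp
  letI : Field (R ⧸ p) := Ideal.Quotient.field p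
  have hdim : ringKrullDim (MvPolynomial (Fin r) (R ⧸ p)) = r := by simp
  rw [← hdim]
  let q : R ⧸ p →+* S ⧸ p.map (algebraMap R S) :=
    Ideal.quotientMap _ (algebraMap R S) Ideal.le_comap_map
  let ψ : MvPolynomial (Fin r) (R ⧸ p) →+* S ⧸ p.map (algebraMap R S) :=
    MvPolynomial.eval₂Hom q (fun i => Ideal.Quotient.mk _ (x i))
  refine h11_krull_le_of_integral ψ ?_
  have hψC : ∀ c : R, ψ (MvPolynomial.C (Ideal.Quotient.mk p c)) =
      Ideal.Quotient.mk _ (algebraMap R S c) := by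
    intro c
    simp [ψ, q]
  have hcomp : ψ.comp (MvPolynomial.map (Ideal.Quotient.mk p)) =
      (Ideal.Quotient.mk (p.map (algebraMap R S))).comp φ.toRingHom := by
    apply MvPolynomial.ringHom_ext
    · intro c
      simp [φ, hψC]
    · intro i
      simp [φ, ψ]
  intro s
  obtain ⟨s, rfl⟩ := Ideal.Quotient.mk_surjective s
  have hs : s ∈ Algebra.adjoin R (T : Set S) := by rw [hT]; trivial
  induction hs using Algebra.adjoin_induction with
  | mem y hy =>
    have hmy : m y ∉ p := fun hc => hmp (Ideal.mem_of_dvd _ (Finset.dvd_prod_of_mem m hy) hc)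
    have h0 : Ideal.Quotient.mk p (m y) ≠ 0 := by
      rwa [Ne, Ideal.Quotient.eq_zero_iff_mem]
    have h1 : ψ.IsIntegralElem (Ideal.Quotient.mk _ (algebraMap R S (m y) * y)) := by
      apply RingHom.isIntegralElem.of_comp (MvPolynomial.map (Ideal.Quotient.mk p)) ψ
      rw [hcomp]
      obtain ⟨P, hP, hP2⟩ := hmi y hy
      refine ⟨P, hP, ?_⟩
      rw [← Polynomial.hom_eval₂, hP2, map_zero]
    have h2 := RingHom.IsIntegralElem.mul ψ
      (RingHom.isIntegralElem_map ψ (x := MvPolynomial.C (Ideal.Quotient.mk p (m y))⁻¹)) h1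
    rw [map_mul, ← hψC, ← mul_assoc, ← map_mul, ← map_mul, inv_mul_cancel₀ h0, map_one, map_one,
      one_mul] at h2
    exact h2
  | algebraMap c => rw [← hψC]; exact RingHom.isIntegralElem_map ψ
  | add a b _ _ h1 h2 => rw [map_add]; exact RingHom.IsIntegralElem.add ψ h1 h2
  | mul a b _ _ h1 h2 => rw [map_mul]; exact RingHom.IsIntegralElem.mul ψ h1 h2

/-- algebraic form of the upper bound -/
theorem h11_alg_U {k R S : Type} [Field k] [CommRing R] [IsDomain R] [Algebra k R]
    [Algebra.FiniteType k R] [CommRing S] [IsDomain S] [Algebra k S]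
    [Algebra.FiniteType k S] (φ : R →ₐ[k] S) (hφ : Function.Injective φ) :
    ∃ m : R, m ≠ 0 ∧ ∀ p : Ideal R, p.IsMaximal → m ∉ p →
        ringKrullDim R + ringKrullDim (S ⧸ p.map φ.toRingHom) ≤ ringKrullDim S := by
  algebraize [φ.toRingHom]
  have : FaithfulSMul R S :=
    (faithfulSMul_iff_algebraMap_injective _ _).mpr hφ
  have : Algebra.FiniteType R S := Algebra.FiniteType.of_restrictScalars_finiteType k R S
  obtain ⟨r, hr, m, hm, H⟩ := h11_generic (R := R) (S := S)
  refine ⟨m, hm, fun p hp hmp => ?_⟩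
  have h1 := H p hp hmp
  obtain ⟨a, -, ha, ha'⟩ := h11_height_aux (k := k) (S := R)
  obtain ⟨b, -, hb, hb'⟩ := h11_height_aux (k := k) (S := S)
  have h2 := trdeg_add_eq k R (A := S)
  rw [ha, hb] at h2
  have h3 : ((a + r : ℕ) : Cardinal) ≤ b := by
    rw [← h2]; push_cast; gcongr
  have h4 : a + r ≤ b := by exact_mod_cast h3
  rw [ha', hb']
  refine (add_le_add le_rfl h1).trans ?_
  exact_mod_cast h4

/-- an affine integral chart for a pair of locally closed irreducible subsets -/
structure H11Chart (K : Type) [Field K] {X Y : Type} [TopologicalSpace X] [TopologicalSpace Y]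
    (f : X → Y) (W : Set X) (C : Set Y) where
  R : Type
  S : Type
  [crR : CommRing R]
  [crS : CommRing S]
  [domR : IsDomain R]
  [domS : IsDomain S]
  [algR : Algebra K R]
  [algS : Algebra K S]
  [ftR : Algebra.FiniteType K R]
  [ftS : Algebra.FiniteType K S]
  φ : R →ₐ[K] S
  i : PrimeSpectrum R → Y
  j : PrimeSpectrum S → X
  V : Set Y
  U : Set X
  hi : Topology.IsEmbedding i
  hj : Topology.IsEmbedding j
  hV : IsOpen V
  hU : IsOpen U
  ri : Set.range i = C ∩ V
  rj : Set.range j = W ∩ U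
  comm : ∀ s, f (j s) = i (PrimeSpectrum.comap φ.toRingHom s)

attribute [instance] H11Chart.crR H11Chart.crS H11Chart.domR H11Chart.domS H11Chart.algR
  H11Chart.algS H11Chart.ftR H11Chart.ftS

theorem h11_range_quot {R : Type} [CommRing R] (C : Set (PrimeSpectrum R)) (hC : IsClosed C) :
    Set.range (PrimeSpectrum.comap (Ideal.Quotient.mk (PrimeSpectrum.vanishingIdeal C))) = C := by
  rw [range_comap_of_surjective _ _ Ideal.Quotient.mk_surjective, Ideal.mk_ker,
    PrimeSpectrum.zeroLocus_vanishingIdeal_eq_closure, hC.closure_eq]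

theorem h11_chart {K : Type} [Field K] {X Y : Scheme.{0}}
    (sX : X ⟶ Spec (CommRingCat.of K)) (sY : Y ⟶ Spec (CommRingCat.of K))
    [LocallyOfFiniteType sX] [LocallyOfFiniteType sY] (f : X ⟶ Y) (hf : f ≫ sY = sX)
    (W : Set X) (C : Set Y) (hW : IsLocallyClosed W) (hC : IsLocallyClosed C)
    (hW' : IsIrreducible W) (hC' : IsIrreducible C) (hWC : W ⊆ f ⁻¹' C) (w : X) (hw : w ∈ W) :
    ∃ c : H11Chart K f W C, w ∈ c.U := by
  obtain ⟨V0, Z, hV0, hZ, rfl⟩ := hC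
  obtain ⟨U0, Z', hU0, hZ', rfl⟩ := hW
  obtain ⟨R0, g, hg, hfg, hgV⟩ := Scheme.exists_affine_mem_range_and_range_subset
    (x := f w) (U := ⟨V0, hV0⟩) (hWC hw).1
  have hgo := Scheme.Hom.isOpenEmbedding g
  obtain ⟨S0, h, hh, hwh, hhU⟩ := Scheme.exists_affine_mem_range_and_range_subset
    (x := w) (U := ⟨U0 ∩ f ⁻¹' (Set.range g), hU0.inter (hgo.isOpen_range.preimage f.continuous)⟩)
    ⟨hw.1, hfg⟩
  have hho := Scheme.Hom.isOpenEmbedding h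
  have hl : Set.range (h ≫ f) ⊆ Set.range g := by
    rintro _ ⟨x, rfl⟩
    exact (hhU ⟨x, rfl⟩).2
  let l := IsOpenImmersion.lift g (h ≫ f) hl
  have hlf : l ≫ g = h ≫ f := IsOpenImmersion.lift_fac g (h ≫ f) hl
  let φ0 := Spec.preimage l
  let a := Spec.preimage (g ≫ sY)
  have hb : Spec.map (a ≫ φ0) = h ≫ sX := by
    simp only [Spec.map_comp, a, φ0, Spec.map_preimage, ← hf]
    rw [← Category.assoc, hlf, Category.assoc]
  have ha1 : LocallyOfFiniteType (Spec.map a) := by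
    simp only [a, Spec.map_preimage]; infer_instance
  have hb1 : LocallyOfFiniteType (Spec.map (a ≫ φ0)) := by
    rw [hb]; infer_instance
  have ha2 : a.hom.FiniteType := HasRingHomProperty.Spec_iff.mp ha1
  have hb2 : (a ≫ φ0).hom.FiniteType := HasRingHomProperty.Spec_iff.mp hb1
  algebraize [a.hom, (a ≫ φ0).hom]
  let φ1 : R0 →ₐ[K] S0 := { φ0.hom with commutes' := fun r => rfl }
  have hcomm : ∀ s : PrimeSpectrum S0, f (h s) = g (PrimeSpectrum.comap φ0.hom s) := by
    intro s
    have e1 : f (h s) = (h ≫ f) s := rfl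
    have e2 : g (l s) = (l ≫ g) s := rfl
    have e3 : l s = PrimeSpectrum.comap φ0.hom s := by
      conv_lhs => rw [← Spec.map_preimage l]
      exact Spec.map_apply _ _
    exact e1.trans ((congrArg (fun q : Spec S0 ⟶ Y => q s) hlf.symm).trans
      (e2.symm.trans (congrArg g e3)))
  let C0 : Set (PrimeSpectrum R0) := g ⁻¹' Z
  let W0 : Set (PrimeSpectrum S0) := h ⁻¹' Z'
  have hC0 : IsClosed C0 := hZ.preimage g.continuous
  have hW0 : IsClosed W0 := hZ'.preimage h.continuous
  have hC0' : C0 = g ⁻¹' (V0 ∩ Z) := by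
    ext x
    exact ⟨fun hx => ⟨hgV ⟨x, rfl⟩, hx⟩, fun hx => hx.2⟩
  have hW0' : W0 = h ⁻¹' (U0 ∩ Z') := by
    ext x
    exact ⟨fun hx => ⟨(hhU ⟨x, rfl⟩).1, hx⟩, fun hx => hx.2⟩
  have iC : IsIrreducible C0 := by
    rw [hC0']; exact hC'.preimage hgo ⟨f w, hWC hw, hfg⟩
  have iW : IsIrreducible W0 := by
    rw [hW0']; exact hW'.preimage hho ⟨w, hw, hwh⟩
  have pC := PrimeSpectrum.isIrreducible_iff_vanishingIdeal_isPrime.mp iC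
  have pW := PrimeSpectrum.isIrreducible_iff_vanishingIdeal_isPrime.mp iW
  have hmaps : ∀ s ∈ W0, PrimeSpectrum.comap φ0.hom s ∈ C0 := by
    intro s hs
    rw [hW0'] at hs
    have := hWC hs
    rw [Set.mem_preimage, hcomm] at this
    exact this.2
  have hle : PrimeSpectrum.vanishingIdeal C0 ≤ (PrimeSpectrum.vanishingIdeal W0).comap φ1 := by
    intro r hr
    rw [Ideal.mem_comap, PrimeSpectrum.mem_vanishingIdeal]
    intro s hs
    exact (PrimeSpectrum.mem_vanishingIdeal _ _).mp hr _ (hmaps s hs)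
  have e1 := PrimeSpectrum.isClosedEmbedding_comap_of_surjective _
    (Ideal.Quotient.mk (PrimeSpectrum.vanishingIdeal C0)) Ideal.Quotient.mk_surjective
  have e2 := PrimeSpectrum.isClosedEmbedding_comap_of_surjective _
    (Ideal.Quotient.mk (PrimeSpectrum.vanishingIdeal W0)) Ideal.Quotient.mk_surjective
  refine ⟨{ R := R0 ⧸ PrimeSpectrum.vanishingIdeal C0
            S := S0 ⧸ PrimeSpectrum.vanishingIdeal W0
            φ := Ideal.quotientMapₐ _ φ1 hle
            i := fun x => g (PrimeSpectrum.comap (Ideal.Quotient.mk _) x)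
            j := fun x => h (PrimeSpectrum.comap (Ideal.Quotient.mk _) x)
            V := Set.range g
            U := Set.range h
            hi := hgo.isEmbedding.comp e1.isEmbedding
            hj := hho.isEmbedding.comp e2.isEmbedding
            hV := hgo.isOpen_range
            hU := hho.isOpen_range
            ri := ?_
            rj := ?_
            comm := ?_ }, hwh⟩
  · exact (Set.range_comp g _).trans ((congrArg (fun q => g '' q) ((h11_range_quot _ hC0).trans hC0')).trans
      Set.image_preimage_eq_inter_range)
  · exact (Set.range_comp h _).trans ((congrArg (fun q => h '' q) ((h11_range_quot _ hW0).trans hW0')).trans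
      Set.image_preimage_eq_inter_range)
  · intro s
    exact (hcomm _).trans (congrArg g rfl)

theorem h11_dim_image {A X : Type} [TopologicalSpace A] [TopologicalSpace X] {j : A → X}
    (hj : Topology.IsEmbedding j) (s : Set A) :
    topologicalKrullDim (j '' s : Set X) = topologicalKrullDim s := by
  let g : s → (j '' s : Set X) := fun x => ⟨j x, ⟨x, x.2, rfl⟩⟩
  have hg : Topology.IsInducing g := by
    have : Topology.IsInducing ((Subtype.val : (j '' s : Set X) → X) ∘ g) :=
      hj.isInducing.comp Topology.IsInducing.subtypeVal
    exact Topology.IsInducing.of_comp_iff Topology.IsInducing.subtypeVal |>.mp this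
  have hb : Function.Bijective g := by
    constructor
    · intro a b hab
      exact Subtype.ext (hj.injective (congrArg Subtype.val hab))
    · rintro ⟨_, x, hx, rfl⟩
      exact ⟨⟨x, hx⟩, rfl⟩
  have : IsHomeomorph g := by
    rw [isHomeomorph_iff_isEmbedding_surjective]
    exact ⟨⟨hg, hb.1⟩, hb.2⟩
  exact (IsHomeomorph.topologicalKrullDim_eq g this).symm

theorem h11_dim_range {A X : Type} [TopologicalSpace A] [TopologicalSpace X] {j : A → X}
    (hj : Topology.IsEmbedding j) :
    topologicalKrullDim (Set.range j : Set X) = topologicalKrullDim A := by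
  rw [← Set.image_univ, h11_dim_image hj]
  exact IsHomeomorph.topologicalKrullDim_eq _ (Homeomorph.Set.univ A).isHomeomorph

theorem h11_dim_mono {X : Type} [TopologicalSpace X] {s t : Set X} (h : s ⊆ t) :
    topologicalKrullDim s ≤ topologicalKrullDim t :=
  (Topology.IsInducing.topologicalKrullDim_le (f := Set.inclusion h)
    (Topology.IsEmbedding.inclusion h).isInducing)

/-- dimension is attained locally -/
theorem h11_dim_local {X : Type} [TopologicalSpace X] {s : Set X} {n : ℕ}
    (h : (n : WithBot ℕ∞) ≤ topologicalKrullDim s) :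
    ∃ x ∈ s, ∀ U : Set X, IsOpen U → x ∈ U →
      (n : WithBot ℕ∞) ≤ topologicalKrullDim (s ∩ U : Set X) := by
  obtain ⟨l, hl⟩ := Order.le_krullDim_iff.mp h
  obtain ⟨x, hx⟩ := l.head.isIrreducible.nonempty
  refine ⟨x, x.2, fun U hU hxU => ?_⟩
  rw [← Subtype.image_preimage_coe, h11_dim_image Topology.IsEmbedding.subtypeVal]
  have ho : IsOpen (Subtype.val ⁻¹' U : Set s) := hU.preimage continuous_subtype_val
  let o := TopologicalSpace.IrreducibleCloseds.orderIsoOfIsOpenEmbedding _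
    ho.isOpenEmbedding_subtypeVal
  rw [topologicalKrullDim, Order.krullDim_eq_of_orderIso o]
  rw [Order.le_krullDim_iff]
  refine ⟨⟨l.length, fun k => ⟨l k, ⟨⟨x, hxU⟩, ?_⟩⟩, fun k => l.step k⟩, hl⟩
  exact (l.monotone (Fin.zero_le k)) hx

theorem h11_dim_eq_top {X : Type} [TopologicalSpace X] {Z T : Set X} {e : ℕ}
    (hZ : IsIrreducible Z) (hT : IsClosed T) (he : topologicalKrullDim Z = (e : WithBot ℕ∞))
    (h : (e : WithBot ℕ∞) ≤ topologicalKrullDim (Z ∩ T : Set X)) : Z ⊆ T := by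
  by_contra hc
  rw [← Subtype.image_preimage_coe, h11_dim_image Topology.IsEmbedding.subtypeVal] at h
  obtain ⟨l, hl⟩ := Order.le_krullDim_iff.mp h
  have hF : IsClosed (Subtype.val ⁻¹' T : Set Z) := hT.preimage continuous_subtype_val
  let m := TopologicalSpace.IrreducibleCloseds.map
    (Subtype.val : (Subtype.val ⁻¹' T : Set Z) → Z) continuous_subtype_val
  have hm : StrictMono m := TopologicalSpace.IrreducibleCloseds.map_strictMono_of_isInducing
    Topology.IsInducing.subtypeVal
  let l' := l.map m hm
  have : IrreducibleSpace Z := isIrreducible_iff_irreducibleSpace.mp hZ |> fun h => h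
  let tp : TopologicalSpace.IrreducibleCloseds Z :=
    ⟨Set.univ, IrreducibleSpace.isIrreducible_univ Z, isClosed_univ⟩
  have hlast : l'.last < tp := by
    have h1 : (l'.last : Set Z) ⊆ Subtype.val ⁻¹' T := by
      change closure (Subtype.val '' _) ⊆ _
      refine hF.closure_subset_iff.mpr ?_
      rintro _ ⟨y, -, rfl⟩
      exact y.2
    refine lt_of_le_of_ne (fun x _ => trivial) ?_
    intro heq
    apply hc
    intro z hz
    have : (⟨z, hz⟩ : Z) ∈ (l'.last : Set Z) := by rw [heq]; trivial
    exact h1 this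
  have h2 : ((e + 1 : ℕ) : WithBot ℕ∞) ≤ topologicalKrullDim Z :=
    Order.le_krullDim_iff.mpr ⟨l'.snoc tp hlast, by simp [l', hl]⟩
  rw [he] at h2
  have : e + 1 ≤ e := by exact_mod_cast h2
  omega

theorem h11_dim_zeroLocus {S : Type} [CommRing S] (I : Ideal S) :
    topologicalKrullDim (PrimeSpectrum.zeroLocus (I : Set S)) = ringKrullDim (S ⧸ I) := by
  rw [← PrimeSpectrum.topologicalKrullDim_eq_ringKrullDim]
  have := PrimeSpectrum.isClosedEmbedding_comap_of_surjective _
    (Ideal.Quotient.mk I) Ideal.Quotient.mk_surjective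
  rw [← h11_dim_range this.isEmbedding, range_comap_of_surjective _ _ Ideal.Quotient.mk_surjective,
    Ideal.mk_ker]

theorem h11_le_of_nat {a b : WithBot ℕ∞} (h : ∀ n : ℕ, (n : WithBot ℕ∞) ≤ a → (n : WithBot ℕ∞) ≤ b) :
    a ≤ b := by
  induction a with
  | bot => exact bot_le
  | coe a =>
    induction a with
    | top =>
      have h' : ∀ n : ℕ, (n : WithBot ℕ∞) ≤ b := fun n => h n (WithBot.coe_le_coe.mpr le_top)
      induction b with
      | bot => exact absurd (h' 0) (by simp)
      | coe b =>
        refine WithBot.coe_le_coe.mpr ?_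
        have h2 : ∀ n : ℕ, (n : ℕ∞) ≤ b := fun n => by exact_mod_cast h' n
        exact top_le_iff.mpr (ENat.eq_top_iff_forall_ge.mpr h2)
    | coe n => exact h n le_rfl

section
variable {K : Type} [Field K] {X Y : Type} [TopologicalSpace X] [TopologicalSpace Y]
    {f : X → Y} {W : Set X} {C : Set Y} (c : H11Chart K f W C)

theorem H11Chart.dimS : topologicalKrullDim (W ∩ c.U : Set X) = ringKrullDim c.S := by
  rw [← c.rj, h11_dim_range c.hj, PrimeSpectrum.topologicalKrullDim_eq_ringKrullDim]

theorem H11Chart.dimR : topologicalKrullDim (C ∩ c.V : Set Y) = ringKrullDim c.R := by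
  rw [← c.ri, h11_dim_range c.hi, PrimeSpectrum.topologicalKrullDim_eq_ringKrullDim]

theorem H11Chart.fiber (p : PrimeSpectrum c.R) (hp : p.asIdeal.IsMaximal) :
    W ∩ f ⁻¹' {c.i p} ∩ c.U =
      c.j '' PrimeSpectrum.zeroLocus (p.asIdeal.map c.φ.toRingHom : Ideal c.S) := by
  ext x
  constructor
  · rintro ⟨⟨h1, h2⟩, h3⟩
    have : x ∈ Set.range c.j := by rw [c.rj]; exact ⟨h1, h3⟩
    obtain ⟨s, rfl⟩ := this
    refine ⟨s, ?_, rfl⟩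
    rw [Set.mem_preimage, Set.mem_singleton_iff, c.comm] at h2
    have h4 := c.hi.injective h2
    rw [PrimeSpectrum.mem_zeroLocus, SetLike.coe_subset_coe, Ideal.map_le_iff_le_comap]
    rw [← h4]
    exact le_rfl
  · rintro ⟨s, hs, rfl⟩
    have : c.j s ∈ Set.range c.j := ⟨s, rfl⟩
    rw [c.rj] at this
    refine ⟨⟨this.1, ?_⟩, this.2⟩
    rw [Set.mem_preimage, Set.mem_singleton_iff, c.comm]
    congr 1
    rw [PrimeSpectrum.mem_zeroLocus, SetLike.coe_subset_coe, Ideal.map_le_iff_le_comap] at hs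
    apply PrimeSpectrum.ext
    exact (hp.eq_of_le (PrimeSpectrum.comap c.φ.toRingHom s).isPrime.ne_top hs).symm

theorem H11Chart.dim_fiber (p : PrimeSpectrum c.R) (hp : p.asIdeal.IsMaximal) :
    topologicalKrullDim (W ∩ f ⁻¹' {c.i p} ∩ c.U : Set X) =
      ringKrullDim (c.S ⧸ p.asIdeal.map c.φ.toRingHom) := by
  rw [c.fiber p hp, h11_dim_image c.hj, h11_dim_zeroLocus]

theorem h11_max_of_closed {R : Type} [CommRing R] {i : PrimeSpectrum R → Y}
    (hi : Topology.IsEmbedding i) (p : PrimeSpectrum R)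
    (h : IsClosed ({i p} : Set Y)) : p.asIdeal.IsMaximal := by
  rw [← PrimeSpectrum.isClosed_singleton_iff_isMaximal]
  have := h.preimage hi.continuous
  convert this
  ext q
  simp [hi.injective.eq_iff]

end

theorem h11_dim_open {K : Type} [Field K] {X : Scheme.{0}}
    (sX : X ⟶ Spec (CommRingCat.of K)) [LocallyOfFiniteType sX]
    {W U : Set X} (hW : IsLocallyClosed W) (hW' : IsIrreducible W) (hU : IsOpen U)
    (hne : (W ∩ U).Nonempty) : topologicalKrullDim (W ∩ U : Set X) = topologicalKrullDim W := by
  refine le_antisymm (h11_dim_mono Set.inter_subset_left) (h11_le_of_nat fun n hn => ?_)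
  obtain ⟨x, hxW, hx⟩ := h11_dim_local hn
  obtain ⟨c, hc⟩ := h11_chart sX sX (𝟙 X) (by simp) W W hW hW hW' hW' (fun x hx => by simpa) x hxW
  have h1 := hx c.U c.hU hc
  rw [c.dimS] at h1
  obtain ⟨y, hyW, hyU, hyc⟩ := hW'.isPreirreducible U c.U hU c.hU hne ⟨x, hxW, hc⟩
  have : y ∈ Set.range c.j := by rw [c.rj]; exact ⟨hyW, hyc⟩
  obtain ⟨s, rfl⟩ := this
  obtain ⟨_, ⟨g, rfl⟩, hsg, hgU⟩ := PrimeSpectrum.isTopologicalBasis_basic_opens.exists_subset_of_mem_open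
    (show s ∈ c.j ⁻¹' U from hyU) (hU.preimage c.hj.continuous)
  have hg0 : g ≠ 0 := by
    rintro rfl
    simp at hsg
  have e1 := h11_dim_away (k := K) g hg0
  rw [← e1, ← PrimeSpectrum.topologicalKrullDim_eq_ringKrullDim,
    ← h11_dim_range (PrimeSpectrum.localization_away_isOpenEmbedding (Localization.Away g) g).isEmbedding,
    PrimeSpectrum.localization_away_comap_range _ g, ← h11_dim_image c.hj] at h1
  refine h1.trans (h11_dim_mono ?_)
  rintro _ ⟨t, ht, rfl⟩
  have : c.j t ∈ Set.range c.j := ⟨t, rfl⟩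
  rw [c.rj] at this
  exact ⟨this.1, hgU ht⟩

theorem h11_L {K : Type} [Field K] {X Y : Scheme.{0}}
    (sX : X ⟶ Spec (CommRingCat.of K)) (sY : Y ⟶ Spec (CommRingCat.of K))
    [LocallyOfFiniteType sX] [LocallyOfFiniteType sY] (f : X ⟶ Y) (hf : f ≫ sY = sX)
    (W : Set X) (C : Set Y) (hW : IsLocallyClosed W) (hC : IsLocallyClosed C)
    (hW' : IsIrreducible W) (hC' : IsIrreducible C) (hWC : W ⊆ f ⁻¹' C) (w : X) (hw : w ∈ W)
    (hwc : IsClosed ({w} : Set X)) (hbc : IsClosed ({f w} : Set Y)) :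
    topologicalKrullDim W ≤ topologicalKrullDim C +
      topologicalKrullDim (W ∩ f ⁻¹' {f w} : Set X) := by
  obtain ⟨c, hc⟩ := h11_chart sX sY f hf W C hW hC hW' hC' hWC w hw
  rw [← h11_dim_open sX hW hW' c.hU ⟨w, hw, hc⟩, c.dimS]
  have : w ∈ Set.range c.j := by rw [c.rj]; exact ⟨hw, hc⟩
  obtain ⟨n, rfl⟩ := this
  have hn := h11_max_of_closed c.hj n hwc
  rw [c.comm] at hbc ⊢
  have hm := h11_max_of_closed c.hi _ hbc
  have h1 := h11_alg_L (k := K) c.φ.toRingHom n.asIdeal hn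
  refine h1.trans (add_le_add ?_ ?_)
  · rw [← c.dimR]
    exact h11_dim_mono Set.inter_subset_left
  · have h2 := c.dim_fiber _ hm
    rw [PrimeSpectrum.comap_asIdeal] at h2
    rw [← h2]
    exact h11_dim_mono Set.inter_subset_left

theorem h11_U_local {K : Type} [Field K] {X Y : Scheme.{0}}
    (sX : X ⟶ Spec (CommRingCat.of K)) (sY : Y ⟶ Spec (CommRingCat.of K))
    [LocallyOfFiniteType sX] [LocallyOfFiniteType sY] (f : X ⟶ Y) (hf : f ≫ sY = sX)
    (W : Set X) (C : Set Y) (hW : IsLocallyClosed W) (hC : IsLocallyClosed C)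
    (hW' : IsIrreducible W) (hC' : IsIrreducible C) (hWC : W ⊆ f ⁻¹' C)
    (hdom : C ⊆ closure (f '' W)) (w : X) (hw : w ∈ W) :
    ∃ (U : Set X) (D : Set Y), IsOpen U ∧ IsOpen D ∧ w ∈ U ∧ (C ∩ D).Nonempty ∧
      ∀ b ∈ C ∩ D, IsClosed ({b} : Set Y) →
        topologicalKrullDim C + topologicalKrullDim (W ∩ f ⁻¹' {b} ∩ U : Set X) ≤
          topologicalKrullDim W := by
  obtain ⟨c, hc⟩ := h11_chart sX sY f hf W C hW hC hW' hC' hWC w hw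
  have hinj : Function.Injective c.φ := by
    rw [injective_iff_map_eq_zero]
    intro a ha
    have h1 : W ⊆ closure (W ∩ c.U) :=
      subset_closure_inter_of_isPreirreducible_of_isOpen hW'.isPreirreducible c.hU ⟨w, hw, hc⟩
    have h2 : f '' W ⊆ closure (f '' (W ∩ c.U)) :=
      (Set.image_mono h1).trans (image_closure_subset_closure_image f.continuous)
    have h3 : C ⊆ closure (f '' (W ∩ c.U)) :=
      hdom.trans (closure_minimal h2 isClosed_closure)
    have h4 : f '' (W ∩ c.U) ⊆ c.i '' PrimeSpectrum.zeroLocus {a} := by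
      rw [← c.rj]
      rintro _ ⟨_, ⟨s, rfl⟩, rfl⟩
      refine ⟨_, ?_, (c.comm s).symm⟩
      rw [PrimeSpectrum.mem_zeroLocus, Set.singleton_subset_iff]
      change c.φ a ∈ s.asIdeal
      rw [ha]; exact zero_mem _
    have h5 : c.i ⊥ ∈ C := by
      have : c.i ⊥ ∈ Set.range c.i := ⟨_, rfl⟩
      rw [c.ri] at this
      exact this.1
    have h6 := closure_mono h4 (h3 h5)
    have h7 : (⊥ : PrimeSpectrum c.R) ∈ closure (PrimeSpectrum.zeroLocus {a}) := by
      rw [c.hi.closure_eq_preimage_closure_image]; exact h6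
    rw [(PrimeSpectrum.isClosed_zeroLocus _).closure_eq, PrimeSpectrum.mem_zeroLocus,
      Set.singleton_subset_iff] at h7
    simpa using h7
  obtain ⟨m, hm0, hm⟩ := h11_alg_U (k := K) c.φ hinj
  obtain ⟨D', hD', hD''⟩ := c.hi.isOpen_iff.mp (PrimeSpectrum.basicOpen m).isOpen
  refine ⟨c.U, D' ∩ c.V, c.hU, hD'.inter c.hV, hc, ?_, ?_⟩
  · refine ⟨c.i ⊥, ?_⟩
    have h1 : c.i ⊥ ∈ Set.range c.i := ⟨_, rfl⟩
    rw [c.ri] at h1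
    have h2 : (⊥ : PrimeSpectrum c.R) ∈ c.i ⁻¹' D' := by
      rw [hD'']
      simpa [PrimeSpectrum.mem_basicOpen] using hm0
    exact ⟨h1.1, h2, h1.2⟩
  · rintro b ⟨hbC, hbD, hbV⟩ hb
    have h1 : b ∈ Set.range c.i := by rw [c.ri]; exact ⟨hbC, hbV⟩
    obtain ⟨p, rfl⟩ := h1
    have hp := h11_max_of_closed c.hi p hb
    have h2 : p ∈ c.i ⁻¹' D' := hbD
    rw [hD''] at h2
    rw [c.dim_fiber p hp, ← h11_dim_open sX hW hW' c.hU ⟨w, hw, hc⟩, c.dimS,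
      ← h11_dim_open sY hC hC' c.hV ⟨_, hbC, hbV⟩, c.dimR]
    exact hm _ hp h2

theorem h11_U {K : Type} [Field K] {X Y : Scheme.{0}}
    (sX : X ⟶ Spec (CommRingCat.of K)) (sY : Y ⟶ Spec (CommRingCat.of K))
    [LocallyOfFiniteType sX] [LocallyOfFiniteType sY] (f : X ⟶ Y) (hf : f ≫ sY = sX)
    (W : Set X) (C : Set Y) (hW : IsLocallyClosed W) (hC : IsLocallyClosed C)
    (hW' : IsIrreducible W) (hC' : IsIrreducible C) (hWC : W ⊆ f ⁻¹' C)
    (hdom : C ⊆ closure (f '' W)) (hcomp : IsCompact W) :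
    ∃ (D : Set Y), IsOpen D ∧ (C ∩ D).Nonempty ∧
      ∀ b ∈ C ∩ D, IsClosed ({b} : Set Y) → ∀ e : ℕ,
        (e : WithBot ℕ∞) ≤ topologicalKrullDim (W ∩ f ⁻¹' {b} : Set X) →
        topologicalKrullDim C + e ≤ topologicalKrullDim W := by
  choose! U D hU hD hwU hne H using
    h11_U_local sX sY f hf W C hW hC hW' hC' hWC hdom
  obtain ⟨t, ht, htW⟩ := hcomp.elim_nhds_subcover U (fun w hw => (hU w hw).mem_nhds (hwU w hw))
  refine ⟨⋂ w ∈ t, D w, isOpen_biInter_finset fun w hw => hD w (ht w hw), ?_, ?_⟩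
  · classical
    have := isIrreducible_iff_sInter.mp hC' (t.image D) (by
      intro u hu
      obtain ⟨w, hw, rfl⟩ := Finset.mem_image.mp hu
      exact hD w (ht w hw)) (by
      intro u hu
      obtain ⟨w, hw, rfl⟩ := Finset.mem_image.mp hu
      exact hne w (ht w hw))
    simpa using this
  · rintro b ⟨hbC, hbD⟩ hb e he
    obtain ⟨x, hx, hxe⟩ := h11_dim_local he
    obtain ⟨w, hwt, hxw⟩ := Set.mem_iUnion₂.mp (htW hx.1)
    have h1 := hxe (U w) (hU w (ht w hwt)) hxw
    refine le_trans (add_le_add le_rfl h1) (H w (ht w hwt) b ⟨hbC, ?_⟩ hb)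
    exact Set.mem_iInter₂.mp hbD w hwt

theorem h11_irred_between {X : Type} [TopologicalSpace X] {s t : Set X} (hs : IsIrreducible s)
    (h1 : s ⊆ t) (h2 : t ⊆ closure s) : IsIrreducible t := by
  rw [← isIrreducible_iff_closure] at hs ⊢
  rwa [subset_antisymm (closure_minimal h2 isClosed_closure) (closure_mono h1)]

theorem h11_irred_open {X : Type} [TopologicalSpace X] {s U : Set X} (hs : IsIrreducible s)
    (hU : IsOpen U) (hne : (s ∩ U).Nonempty) : IsIrreducible (s ∩ U) := by
  rw [← isIrreducible_iff_closure] at hs ⊢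
  have h : IsPreirreducible s := isPreirreducible_iff_closure.mp hs.isPreirreducible
  have := subset_closure_inter_of_isPreirreducible_of_isOpen h hU hne
  rwa [subset_antisymm (closure_mono Set.inter_subset_left) (closure_minimal this isClosed_closure)]

theorem h11_core {K : Type} [Field K] {X Y : Scheme.{0}}
    (sX : X ⟶ Spec (CommRingCat.of K)) (sY : Y ⟶ Spec (CommRingCat.of K))
    [LocallyOfFiniteType sX] [LocallyOfFiniteType sY] (f : X ⟶ Y) (hf : f ≫ sY = sX)
    [TopologicalSpace.NoetherianSpace X] [JacobsonSpace X] [JacobsonSpace Y]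
    (hfc : IsClosedMap f)
    (A : Set X) (C : Set Y) (hA : IsLocallyClosed A) (hC : IsLocallyClosed C)
    (hC' : IsIrreducible C) (d e : ℕ) (hd : topologicalKrullDim C = (d : WithBot ℕ∞))
    (hfib : ∀ b ∈ C, IsClosed ({b} : Set Y) →
      IsIrreducible (f ⁻¹' {b} ∩ A) ∧
      topologicalKrullDim (f ⁻¹' {b} ∩ A : Set X) = (e : WithBot ℕ∞) ∧
      f ⁻¹' {b} ∩ closure A ⊆ closure (f ⁻¹' {b} ∩ A)) :
    IsIrreducible (f ⁻¹' C ∩ A) ∧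
      topologicalKrullDim (f ⁻¹' C ∩ A : Set X) = ((d + e : ℕ) : WithBot ℕ∞) := by
  classical
  have hcont : Continuous f := f.continuous
  -- `A` is open in its closure
  obtain ⟨O, hO, hAO⟩ : ∃ O : Set X, IsOpen O ∧ A = closure A ∩ O := by
    obtain ⟨O, Q, hO, hQ, rfl⟩ := hA
    refine ⟨O, hO, subset_antisymm (fun x hx => ⟨subset_closure hx, hx.1⟩) ?_⟩
    rintro x ⟨hx1, hx2⟩
    exact ⟨hx2, closure_minimal Set.inter_subset_right hQ hx1⟩
  obtain ⟨V, hV, hCV⟩ : ∃ O : Set Y, IsOpen O ∧ C = closure C ∩ O := by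
    obtain ⟨O, Q, hO, hQ, rfl⟩ := hC
    refine ⟨O, hO, subset_antisymm (fun x hx => ⟨subset_closure hx, hx.1⟩) ?_⟩
    rintro x ⟨hx1, hx2⟩
    exact ⟨hx2, closure_minimal Set.inter_subset_right hQ hx1⟩
  set Z : Set X := f ⁻¹' C ∩ closure A with hZdef
  have hZlc : IsLocallyClosed Z := (hC.preimage hcont).inter isClosed_closure.isLocallyClosed
  have hZO : f ⁻¹' C ∩ A = Z ∩ O := by
    rw [hZdef, Set.inter_assoc, ← hAO]
  -- fibres
  have hfibcl : ∀ b, IsClosed ({b} : Set Y) → IsClosed (f ⁻¹' {b} ∩ closure A) := fun b hb =>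
    (hb.preimage hcont).inter isClosed_closure
  have hfibO : ∀ b : Y, f ⁻¹' {b} ∩ A = (f ⁻¹' {b} ∩ closure A) ∩ O := fun b => by
    rw [Set.inter_assoc, ← hAO]
  have hZb : ∀ b ∈ C, IsClosed ({b} : Set Y) → IsIrreducible (f ⁻¹' {b} ∩ closure A) ∧
      topologicalKrullDim (f ⁻¹' {b} ∩ closure A : Set X) = (e : WithBot ℕ∞) := by
    intro b hbC hb
    obtain ⟨h1, h2, h3⟩ := hfib b hbC hb
    have hirr : IsIrreducible (f ⁻¹' {b} ∩ closure A) :=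
      h11_irred_between h1 (Set.inter_subset_inter_right _ subset_closure) h3
    refine ⟨hirr, ?_⟩
    rw [← h2, hfibO b]
    rw [hfibO b] at h1
    exact (h11_dim_open sX (hfibcl b hb).isLocallyClosed hirr hO h1.nonempty).symm
  -- decompose
  obtain ⟨S, hSfin, hScl, hSirr, hSU⟩ :=
    TopologicalSpace.NoetherianSpace.exists_finite_set_isClosed_irreducible
      (isClosed_closure (s := Z))
  have hZS : Z ⊆ ⋃₀ S := by rw [← hSU]; exact subset_closure
  have htsub : ∀ t ∈ S, t ⊆ closure Z := fun t ht => by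
    rw [hSU]; exact Set.subset_sUnion_of_mem ht
  have hclZA : closure Z ⊆ closure A := closure_minimal Set.inter_subset_right isClosed_closure
  have hclZC : closure Z ⊆ f ⁻¹' closure C :=
    closure_minimal (fun x hx => subset_closure hx.1) (isClosed_closure.preimage hcont)
  have hZt : ∀ t ∈ S, Z ∩ t = t ∩ f ⁻¹' V := by
    intro t ht
    ext x
    constructor
    · rintro ⟨⟨hx1, hx2⟩, hx3⟩
      refine ⟨hx3, ?_⟩
      have hx1' : f x ∈ C := hx1
      rw [hCV] at hx1'
      exact hx1'.2
    · rintro ⟨hx1, hx2⟩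
      have h1 := htsub t ht hx1
      refine ⟨⟨?_, hclZA h1⟩, hx1⟩
      change f x ∈ C
      rw [hCV]
      exact ⟨hclZC h1, hx2⟩
  have hZtlc : ∀ t ∈ S, IsLocallyClosed (Z ∩ t) := fun t ht =>
    hZlc.inter (hScl t ht).isLocallyClosed
  have hZtirr : ∀ t ∈ S, (Z ∩ t).Nonempty → IsIrreducible (Z ∩ t) := by
    intro t ht hne
    rw [hZt t ht] at hne ⊢
    exact h11_irred_open (hSirr t ht) (hV.preimage hcont) hne
  have hZtC : ∀ t, Z ∩ t ⊆ f ⁻¹' C := fun t x hx => hx.1.1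
  have hmemZ : ∀ t ∈ S, ∀ x ∈ t, f x ∈ C → x ∈ Z ∩ t := fun t ht x hx hxC =>
    ⟨⟨hxC, hclZA (htsub t ht hx)⟩, hx⟩
  have hD : ∀ t ∈ S, ∃ D : Set Y, IsOpen D ∧ (C ∩ D).Nonempty ∧
      ∀ b ∈ C ∩ D, IsClosed ({b} : Set Y) → b ∈ f '' t → C ⊆ f '' t ∧
        ((e : WithBot ℕ∞) ≤ topologicalKrullDim (Z ∩ t ∩ f ⁻¹' {b} : Set X) →
        (d : WithBot ℕ∞) + e ≤ topologicalKrullDim (Z ∩ t : Set X)) := by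
    intro t ht
    by_cases hdom : C ⊆ f '' t
    · have hdom' : C ⊆ f '' (Z ∩ t) := by
        intro b hb
        obtain ⟨x, hx, rfl⟩ := hdom hb
        exact ⟨x, hmemZ t ht x hx hb, rfl⟩
      have hne : (Z ∩ t).Nonempty := by
        obtain ⟨b, hb⟩ := hC'.nonempty
        obtain ⟨x, hx, rfl⟩ := hdom' hb
        exact ⟨x, hx⟩
      obtain ⟨D, h1, h2, h3⟩ := h11_U sX sY f hf (Z ∩ t) C (hZtlc t ht) hC (hZtirr t ht hne) hC'
        (hZtC t) (hdom'.trans subset_closure) (TopologicalSpace.NoetherianSpace.isCompact _)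
      rw [hd] at h3
      exact ⟨D, h1, h2, fun b hb hbc _ => ⟨hdom, h3 b hb hbc e⟩⟩
    · refine ⟨(f '' t)ᶜ, (hfc t (hScl t ht)).isOpen_compl, ?_, ?_⟩
      · obtain ⟨b, hb, hb'⟩ := Set.not_subset.mp hdom
        exact ⟨b, hb, hb'⟩
      · intro b hb _ hbt
        exact absurd hbt hb.2
  choose! D hDo hDne hDb using hD
  have hDint : (C ∩ ⋂₀ ((hSfin.toFinset.image D : Finset (Set Y)) : Set (Set Y))).Nonempty := by
    refine isIrreducible_iff_sInter.mp hC' (hSfin.toFinset.image D) ?_ ?_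
    · intro u hu
      obtain ⟨w, hw, rfl⟩ := Finset.mem_image.mp hu
      exact hDo w (hSfin.mem_toFinset.mp hw)
    · intro u hu
      obtain ⟨w, hw, rfl⟩ := Finset.mem_image.mp hu
      exact hDne w (hSfin.mem_toFinset.mp hw)
  have hDopen : IsOpen (⋂₀ ((hSfin.toFinset.image D : Finset (Set Y)) : Set (Set Y))) := by
    refine (Finset.finite_toSet _).isOpen_sInter ?_
    intro u hu
    obtain ⟨w, hw, rfl⟩ := Finset.mem_image.mp hu
    exact hDo w (hSfin.mem_toFinset.mp hw)
  obtain ⟨b, ⟨hbC, hbD⟩, hb⟩ := nonempty_inter_closedPoints hDint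
    (hC.inter hDopen.isLocallyClosed)
  rw [mem_closedPoints_iff] at hb
  have hbD' : ∀ t ∈ S, b ∈ D t := fun t ht => hbD _ (by
    simpa using ⟨t, ht, rfl⟩)
  obtain ⟨hbirr, hbdim⟩ := hZb b hbC hb
  have hbZ : f ⁻¹' {b} ∩ closure A ⊆ Z := by
    rintro x ⟨hx1, hx2⟩
    refine ⟨?_, hx2⟩
    change f x ∈ C
    rwa [show f x = b from hx1]
  obtain ⟨t, htS, hbt⟩ := isIrreducible_iff_sUnion_isClosed.mp hbirr hSfin.toFinset
    (fun z hz => hScl z (hSfin.mem_toFinset.mp hz)) (by simpa using hbZ.trans hZS)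
  have ht : t ∈ S := hSfin.mem_toFinset.mp htS
  obtain ⟨x0, hx0⟩ := hbirr.nonempty
  obtain ⟨hdom, hlow⟩ := hDb t ht b ⟨hbC, hbD' t ht⟩ hb ⟨x0, hbt hx0, hx0.1⟩
  have hlow' : (d : WithBot ℕ∞) + e ≤ topologicalKrullDim (Z ∩ t : Set X) := by
    apply hlow
    rw [← hbdim]
    exact h11_dim_mono fun x hx => ⟨⟨hbZ hx, hbt hx⟩, hx.1⟩
  have hne : (Z ∩ t).Nonempty := ⟨x0, hbZ hx0, hbt hx0⟩
  have hup : ∀ b' ∈ C, IsClosed ({b'} : Set Y) →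
      topologicalKrullDim (Z ∩ t : Set X) ≤
        d + topologicalKrullDim (f ⁻¹' {b'} ∩ closure A ∩ t : Set X) := by
    intro b' hb'C hb'
    obtain ⟨x, hx, hxb⟩ := hdom hb'C
    obtain ⟨w, ⟨hwt, hwb⟩, hw⟩ := nonempty_inter_closedPoints
      (Z := t ∩ f ⁻¹' {b'}) ⟨x, hx, hxb⟩
      ((hScl t ht).inter (hb'.preimage hcont)).isLocallyClosed
    rw [mem_closedPoints_iff] at hw
    have hwb' : f w = b' := hwb
    subst hwb'
    have := h11_L sX sY f hf (Z ∩ t) C (hZtlc t ht) hC (hZtirr t ht hne) hC' (hZtC t) w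
      (hmemZ t ht w hwt hb'C) hw hb'
    rw [hd] at this
    refine this.trans (add_le_add le_rfl (h11_dim_mono ?_))
    rintro y ⟨⟨⟨_, hy1⟩, hy2⟩, hy3⟩
    exact ⟨⟨hy3, hy1⟩, hy2⟩
  have hbt' : ∀ b' ∈ C, IsClosed ({b'} : Set Y) → f ⁻¹' {b'} ∩ closure A ⊆ t := by
    intro b' hb'C hb'
    obtain ⟨h1, h2⟩ := hZb b' hb'C hb'
    refine h11_dim_eq_top h1 (hScl t ht) h2 ?_
    have h3 := hlow'.trans (hup b' hb'C hb')
    generalize topologicalKrullDim (f ⁻¹' {b'} ∩ closure A ∩ t : Set X) = q at h3 ⊢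
    induction q with
    | bot => 
      rw [WithBot.add_bot] at h3
      exact absurd h3 (by rw [le_bot_iff]; exact WithBot.coe_ne_bot (a := ((d + e : ℕ) : ℕ∞)))
    | coe q =>
      have h4 : (d : ℕ∞) + e ≤ d + q := by exact_mod_cast h3
      have h5 : (e : ℕ∞) ≤ q := (ENat.add_le_add_iff_left (ENat.coe_ne_top d)).mp h4
      exact_mod_cast h5
  have hZsubt : Z ⊆ t := by
    by_contra hc
    obtain ⟨x, hx, hxt⟩ := Set.not_subset.mp hc
    obtain ⟨z, ⟨hzZ, hzt⟩, hz⟩ := nonempty_inter_closedPoints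
      (Z := Z ∩ tᶜ) ⟨x, hx, hxt⟩ (hZlc.inter (hScl t ht).isOpen_compl.isLocallyClosed)
    rw [mem_closedPoints_iff] at hz
    have hfz : IsClosed ({f z} : Set Y) := by
      have := hfc _ hz
      rwa [Set.image_singleton] at this
    exact hzt (hbt' (f z) hzZ.1 hfz ⟨rfl, hzZ.2⟩)
  have hZt' : Z ∩ t = Z := Set.inter_eq_left.mpr hZsubt
  have hZirr := hZtirr t ht hne
  rw [hZt'] at hlow' hZirr hup
  have hZdim : topologicalKrullDim Z = ((d + e : ℕ) : WithBot ℕ∞) := by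
    apply le_antisymm
    · refine (hup b hbC hb).trans ?_
      push_cast
      refine add_le_add le_rfl ?_
      rw [← hbdim]
      exact h11_dim_mono Set.inter_subset_left
    · push_cast; exact hlow'
  have hneO : (Z ∩ O).Nonempty := by
    obtain ⟨h1, -, -⟩ := hfib b hbC hb
    obtain ⟨x, hx1, hx2⟩ := h1.nonempty
    rw [← hZO]
    refine ⟨x, ?_, hx2⟩
    change f x ∈ C
    rwa [show f x = b from hx1]
  rw [hZO]
  exact ⟨h11_irred_open hZirr hO hneO, by rw [h11_dim_open sX hZlc hZirr hO hneO, hZdim]⟩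

theorem h11_irred_image_iff {A X : Type} [TopologicalSpace A] [TopologicalSpace X] {j : A → X}
    (hj : Topology.IsInducing j) {s : Set A} (h : IsIrreducible (j '' s)) : IsIrreducible s := by
  refine ⟨h.nonempty.of_image, ?_⟩
  intro u v hu hv hsu hsv
  obtain ⟨u', hu', rfl⟩ := hj.isOpen_iff.mp hu
  obtain ⟨v', hv', rfl⟩ := hj.isOpen_iff.mp hv
  obtain ⟨x, hx, hxu⟩ := hsu
  obtain ⟨y, hy, hyv⟩ := hsv
  obtain ⟨_, ⟨z, hz, rfl⟩, h1, h2⟩ := h.isPreirreducible u' v' hu' hv' ⟨_, ⟨x, hx, rfl⟩, hxu⟩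
    ⟨_, ⟨y, hy, rfl⟩, hyv⟩
  exact ⟨z, hz, h1, h2⟩

theorem h11_final {K : Type} [Field K] {X Y : Scheme.{0}}
    (sX : X ⟶ Spec (CommRingCat.of K)) (sY : Y ⟶ Spec (CommRingCat.of K))
    [LocallyOfFiniteType sX] [LocallyOfFiniteType sY] (f : X ⟶ Y) (hf : f ≫ sY = sX)
    [TopologicalSpace.NoetherianSpace X] [JacobsonSpace X] [JacobsonSpace Y]
    (hfc : IsClosedMap f)
    (A : Set X) (B : Set Y) (hA : IsLocallyClosed A) (hB : IsLocallyClosed B) (d e : ℕ)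
    (hBdim : ∀ C ∈ irreducibleComponents B, topologicalKrullDim C = (d : WithBot ℕ∞))
    (hfib : ∀ b ∈ B, IsClosed ({b} : Set Y) →
      IsIrreducible (f ⁻¹' {b} ∩ A) ∧
      topologicalKrullDim (f ⁻¹' {b} ∩ A : Set X) = (e : WithBot ℕ∞) ∧
      f ⁻¹' {b} ∩ closure A ⊆ closure (f ⁻¹' {b} ∩ A)) :
    (∀ C ∈ irreducibleComponents (f ⁻¹' B ∩ A : Set X),
        topologicalKrullDim C = ((d + e : ℕ) : WithBot ℕ∞)) ∧
      (irreducibleComponents (f ⁻¹' B ∩ A : Set X)).ncard =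
        (irreducibleComponents B).ncard := by
  let g : (f ⁻¹' B ∩ A : Set X) → B := fun m => ⟨f m, m.2.1⟩
  have hg : Continuous g := (f.continuous.comp continuous_subtype_val).subtype_mk _
  have hlc : ∀ C ∈ irreducibleComponents B, IsLocallyClosed (Subtype.val '' C : Set Y) := by
    intro C hC
    obtain ⟨Q, hQ, rfl⟩ := isClosed_induced_iff.mp (isClosed_of_mem_irreducibleComponents C hC)
    rw [Subtype.image_preimage_coe]
    exact hB.inter hQ.isLocallyClosed
  have hcore : ∀ C ∈ irreducibleComponents B, IsIrreducible (g ⁻¹' C) ∧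
      topologicalKrullDim (g ⁻¹' C) = ((d + e : ℕ) : WithBot ℕ∞) := by
    intro C hC
    have h1 : IsIrreducible C := hC.1
    obtain ⟨h2, h3⟩ := h11_core sX sY f hf hfc A (Subtype.val '' C) hA (hlc C hC)
      (h1.image _ continuous_subtype_val.continuousOn) d e
      (by rw [h11_dim_image Topology.IsEmbedding.subtypeVal, hBdim C hC])
      (by
        rintro _ ⟨b, -, rfl⟩ hb
        exact hfib b b.2 hb)
    have h4 : f ⁻¹' (Subtype.val '' C) ∩ A =
        (Subtype.val : (f ⁻¹' B ∩ A : Set X) → X) '' (g ⁻¹' C) := by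
      ext x
      constructor
      · rintro ⟨⟨b, hb, hbx⟩, hxA⟩
        refine ⟨⟨x, ?_, hxA⟩, ?_, rfl⟩
        · change f x ∈ B
          rw [← hbx]; exact b.2
        · change (⟨f x, _⟩ : B) ∈ C
          convert hb
          exact hbx.symm
      · rintro ⟨m, hm, rfl⟩
        exact ⟨⟨g m, hm, rfl⟩, m.2.2⟩
    rw [h4] at h2 h3
    rw [h11_dim_image Topology.IsEmbedding.subtypeVal] at h3
    exact ⟨h11_irred_image_iff Topology.IsInducing.subtypeVal h2, h3⟩
  have hsub : ∀ C ∈ irreducibleComponents B, ∀ C' ∈ irreducibleComponents B,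
      g ⁻¹' C ⊆ g ⁻¹' C' → C ⊆ C' := by
    intro C hC C' hC' h
    by_contra hc
    obtain ⟨x, hx, hxt⟩ := Set.not_subset.mp hc
    have hl := hlc C hC
    obtain ⟨Q, hQ, rfl⟩ := isClosed_induced_iff.mp (isClosed_of_mem_irreducibleComponents C' hC')
    obtain ⟨_, ⟨⟨z, hzC, rfl⟩, hzt⟩, hz⟩ := nonempty_inter_closedPoints
      (Z := (Subtype.val '' C : Set Y) ∩ Qᶜ) ⟨x, ⟨x, hx, rfl⟩, hxt⟩
      (hl.inter hQ.isOpen_compl.isLocallyClosed)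
    rw [mem_closedPoints_iff] at hz
    obtain ⟨y, hy1, hy2⟩ := (hfib z z.2 hz).1.nonempty
    have hy1' : f y = z := hy1
    have hyB : f y ∈ B := by rw [hy1']; exact z.2
    have hgy : g ⟨y, hyB, hy2⟩ = z := Subtype.ext hy1'
    have h5 : (⟨y, hyB, hy2⟩ : (f ⁻¹' B ∩ A : Set X)) ∈ g ⁻¹' C := by
      rw [Set.mem_preimage, hgy]; exact hzC
    have h6 := h h5
    rw [Set.mem_preimage, hgy] at h6
    exact hzt h6
  have hex : ∀ T : Set (f ⁻¹' B ∩ A : Set X), IsIrreducible T →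
      ∃ C ∈ irreducibleComponents B, T ⊆ g ⁻¹' C := by
    intro T hT
    obtain ⟨C, hC, h⟩ := exists_mem_irreducibleComponents_subset_of_isIrreducible _
      (hT.image g hg.continuousOn)
    exact ⟨C, hC, Set.image_subset_iff.mp h⟩
  have heq : irreducibleComponents (f ⁻¹' B ∩ A : Set X) =
      (fun C => g ⁻¹' C) '' irreducibleComponents B := by
    ext T
    constructor
    · intro hT
      obtain ⟨C, hC, h⟩ := hex T hT.1
      exact ⟨C, hC, subset_antisymm (hT.2 (hcore C hC).1 h) h⟩
    · rintro ⟨C, hC, rfl⟩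
      refine ⟨(hcore C hC).1, ?_⟩
      intro T hT hCT
      obtain ⟨C', hC', h⟩ := hex T hT
      have h1 : C ⊆ C' := hsub C hC C' hC' (Set.Subset.trans hCT h)
      have h2 : C' ⊆ C := hC.2 hC'.1 h1
      exact h.trans (Set.preimage_mono h2)
  rw [heq]
  constructor
  · rintro _ ⟨C, hC, rfl⟩
    exact (hcore C hC).2
  · refine Set.ncard_image_of_injOn ?_
    intro C hC C' hC' h
    exact subset_antisymm (hsub C hC C' hC' h.subset) (hsub C' hC' C hC h.superset)

/-- Let `f : X ⟶ Y` be a proper morphism of algebraic varieties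
(reduced schemes of finite type) over an algebraically closed field `K`. Let `B ⊆ Y` be a
locally closed subset, equi-dimensional of dimension `d` (every irreducible component of `B`
has dimension `d`), and let `A ⊆ X` be a locally closed subset such that for some `e ∈ ℕ`,
for every closed point `b ∈ B` the set `f⁻¹ (b) ∩ A` is irreducible of dimension `e` and
dense in `f⁻¹ (b) ∩ closure A`. Then `f⁻¹ (B) ∩ A` is equi-dimensional of dimension `d + e`,
and the number of its irreducible components equals the number of irreducible components
of `B`. -/
theorem stmt11 {K : Type} [Field K] [IsAlgClosed K]
    (X Y : Scheme) [IsReduced X] [IsReduced Y]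
    (sX : X ⟶ Spec (CommRingCat.of K)) (sY : Y ⟶ Spec (CommRingCat.of K))
    [LocallyOfFiniteType sX] [QuasiCompact sX]
    [LocallyOfFiniteType sY] [QuasiCompact sY]
    (f : X ⟶ Y) (hf : f ≫ sY = sX) [IsProper f]
    (A : Set X) (B : Set Y) (hA : IsLocallyClosed A) (hB : IsLocallyClosed B)
    (d e : ℕ)
    (hBdim : ∀ C ∈ irreducibleComponents B, topologicalKrullDim C = (d : ℕ∞))
    (hfib : ∀ b ∈ B, IsClosed ({b} : Set Y) →
      IsIrreducible (f.base ⁻¹' {b} ∩ A) ∧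
      topologicalKrullDim (f.base ⁻¹' {b} ∩ A : Set X) = (e : ℕ∞) ∧
      f.base ⁻¹' {b} ∩ closure A ⊆ closure (f.base ⁻¹' {b} ∩ A)) :
    (∀ C ∈ irreducibleComponents (f.base ⁻¹' B ∩ A : Set X),
        topologicalKrullDim C = ((d + e : ℕ) : ℕ∞)) ∧
      (irreducibleComponents (f.base ⁻¹' B ∩ A : Set X)).ncard =
        (irreducibleComponents B).ncard := by
  have : IsLocallyNoetherian X := LocallyOfFiniteType.isLocallyNoetherian sX
  have : CompactSpace X := QuasiCompact.compactSpace_of_compactSpace sX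
  have : IsNoetherian X := {}
  have : JacobsonSpace X := LocallyOfFiniteType.jacobsonSpace sX
  have : JacobsonSpace Y := LocallyOfFiniteType.jacobsonSpace sY
  exact h11_final sX sY f hf f.isClosedMap A B hA hB d e hBdim hfib
end

section
/- Let g = 3 and let F : 𝔽^6 → 𝔽^6 be the σ-semilinear map with F(e_1) = e_6, F(e_2) = e_1, F(e_3) = e_2, F(e_4) = F(e_5) = F(e_6) = 0, and V : 𝔽^6 → 𝔽^6 the σ⁻¹-semilinear map with V(e_1) = V(e_2) = 0, V(e_3) = −e_4, V(e_4) = e_5, V(e_5) = e_6, V(e_6) = 0. Then a chain of subspaces 0 = W_0 ⊂ W_1 ⊂ W_2 ⊂ W_3 of 𝔽^6 with dim W_j = j is a symplectic flag stable under F and V if and only if W_1 = 𝔽·e_6 and one of the following holds: (X) W_2 = span(e_1, e_6) and W_3 ⊆ span(e_1, e_2, e_5, e_6); (Y) W_2 = span(e_5, e_6) and W_3 ⊆ span(e_1, e_4, e_5, e_6); (Z) W_3 = span(e_1, e_5, e_6). -/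
section helpers

variable {K : Type*} [Field K]

theorem mem_S {s : Finset (Fin 6)} {x : Fin 6 → K} :
    x ∈ Submodule.span K ((fun i : Fin 6 => (Pi.single i 1 : Fin 6 → K)) '' (s : Set (Fin 6))) ↔
      ∀ i, i ∉ s → x i = 0 := by
  have h := (Pi.basisFun K (Fin 6)).mem_span_image (m := x) (s := (s : Set (Fin 6)))
  have h2 : (⇑(Pi.basisFun K (Fin 6))) = fun i : Fin 6 => (Pi.single i 1 : Fin 6 → K) := by
    funext i; simp
  rw [h2] at h
  rw [h]
  constructor
  · intro hs i hi
    by_contra hne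
    exact hi (by simpa using hs (by simpa using hne))
  · intro hs i hi
    by_contra hne
    have : x i ≠ 0 := by simpa using hi
    exact this (hs i (by simpa using hne))

theorem finrank_S (s : Finset (Fin 6)) :
    Module.finrank K (Submodule.span K
      ((fun i : Fin 6 => (Pi.single i 1 : Fin 6 → K)) '' (s : Set (Fin 6)))) = s.card := by
  have h2 : (⇑(Pi.basisFun K (Fin 6))) = fun i : Fin 6 => (Pi.single i 1 : Fin 6 → K) := by
    funext i; simp
  have hli := (Pi.basisFun K (Fin 6)).linearIndependent
  rw [h2] at hli
  have h3 := hli.comp (fun i : s => (i : Fin 6)) Subtype.val_injective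
  have h4 := finrank_span_eq_card h3
  rw [Set.range_comp] at h4
  rw [show (Set.range fun i : s => (i : Fin 6)) = (s : Set (Fin 6)) by ext; simp] at h4
  simpa using h4

theorem card_le_of_mem {W : Submodule K (Fin 6 → K)} (s : Finset (Fin 6))
    (h : ∀ i ∈ s, (Pi.single i 1 : Fin 6 → K) ∈ W) : s.card ≤ Module.finrank K W := by
  rw [← finrank_S (K := K) s]
  apply Submodule.finrank_mono
  rw [Submodule.span_le]
  rintro _ ⟨i, hi, rfl⟩
  exact h i (by simpa using hi)

theorem eq_S {W : Submodule K (Fin 6 → K)} (s : Finset (Fin 6))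
    (hd : Module.finrank K W = s.card)
    (h : ∀ x ∈ W, ∀ i, i ∉ s → x i = 0) :
    W = Submodule.span K ((fun i : Fin 6 => (Pi.single i 1 : Fin 6 → K)) '' (s : Set (Fin 6))) := by
  apply Submodule.eq_of_le_of_finrank_eq
  · intro x hx
    exact mem_S.2 (h x hx)
  · rw [hd, finrank_S]

theorem vec_eq {K : Type*} (x : Fin 6 → K) : x = ![x 0, x 1, x 2, x 3, x 4, x 5] := by
  funext i; fin_cases i <;> rfl

theorem single_mem {W : Submodule K (Fin 6 → K)} {c : K} (hc : c ≠ 0) {i : Fin 6}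
    (h : c • (Pi.single i 1 : Fin 6 → K) ∈ W) : (Pi.single i 1 : Fin 6 → K) ∈ W :=
  (Submodule.smul_mem_iff W hc).1 h

end helpers

/-- case `g = 3`, `w = s₃`. `𝔽^6` carries the standard basis
`e 0, …, e 5` (`e_i = e (i-1)` in the paper's `1`-based numbering) and the standard
alternating form. `F` is the `σ`-semilinear map with `F e₁ = e₆`, `F e₂ = e₁`,
`F e₃ = e₂`, `F e₄ = F e₅ = F e₆ = 0`, and `V` the `σ⁻¹`-semilinear map with
`V e₁ = V e₂ = 0`, `V e₃ = -e₄`, `V e₄ = e₅`, `V e₅ = e₆`, `V e₆ = 0`. A chain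
`0 = W₀ ⊂ W₁ ⊂ W₂ ⊂ W₃` with `dim W_j = j` is a symplectic flag stable under `F` and
`V` iff `W₁ = 𝔽·e₆` and one of (X), (Y), (Z) below holds. -/
theorem stmt16 {p : ℕ} (hp : p.Prime) {𝔽 : Type*} [Field 𝔽] [IsAlgClosed 𝔽] [CharP 𝔽 p]
    (e : Fin 6 → Fin 6 → 𝔽) (he : ∀ i, e i = Pi.single i 1)
    (B : (Fin 6 → 𝔽) → (Fin 6 → 𝔽) → 𝔽)
    (hB : ∀ x y, B x y = x 0 * y 3 - x 3 * y 0 + (x 1 * y 4 - x 4 * y 1)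
      + (x 2 * y 5 - x 5 * y 2))
    (F V : (Fin 6 → 𝔽) → (Fin 6 → 𝔽))
    (hFadd : ∀ x y, F (x + y) = F x + F y)
    (hVadd : ∀ x y, V (x + y) = V x + V y)
    (hFsmul : ∀ (c : 𝔽) x, F (c • x) = c ^ p • F x)
    (hVsmul : ∀ (c : 𝔽) x, V (c ^ p • x) = c • V x)
    (hF0 : F (e 0) = e 5) (hF1 : F (e 1) = e 0) (hF2 : F (e 2) = e 1)
    (hF3 : F (e 3) = 0) (hF4 : F (e 4) = 0) (hF5 : F (e 5) = 0)
    (hV0 : V (e 0) = 0) (hV1 : V (e 1) = 0) (hV2 : V (e 2) = -e 3)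
    (hV3 : V (e 3) = e 4) (hV4 : V (e 4) = e 5) (hV5 : V (e 5) = 0)
    (W1 W2 W3 : Submodule 𝔽 (Fin 6 → 𝔽)) (hW12 : W1 ≤ W2) (hW23 : W2 ≤ W3)
    (hd1 : Module.finrank 𝔽 W1 = 1) (hd2 : Module.finrank 𝔽 W2 = 2)
    (hd3 : Module.finrank 𝔽 W3 = 3) :
    ((∀ x ∈ W3, ∀ y ∈ W3, B x y = 0) ∧
      (∀ x ∈ W1, F x ∈ W1 ∧ V x ∈ W1) ∧ (∀ x ∈ W2, F x ∈ W2 ∧ V x ∈ W2) ∧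
      (∀ x ∈ W3, F x ∈ W3 ∧ V x ∈ W3)) ↔
    (W1 = Submodule.span 𝔽 {e 5} ∧
      ((W2 = Submodule.span 𝔽 {e 0, e 5} ∧
          W3 ≤ Submodule.span 𝔽 {e 0, e 1, e 4, e 5}) ∨
        (W2 = Submodule.span 𝔽 {e 4, e 5} ∧
          W3 ≤ Submodule.span 𝔽 {e 0, e 3, e 4, e 5}) ∨
        W3 = Submodule.span 𝔽 {e 0, e 4, e 5})) := by
  obtain rfl : e = fun i => Pi.single i 1 := funext he
  have hp0 : p ≠ 0 := hp.ne_zero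
  have hp1 : 0 < p := hp.pos
  have hex : ∀ c : 𝔽, ∃ z, z ^ p = c := fun c => IsAlgClosed.exists_pow_nat_eq c hp1
  choose r hr using hex
  have r0 : ∀ c, r c = 0 ↔ c = 0 := by
    intro c
    constructor
    · intro h; rw [← hr c, h, zero_pow hp0]
    · intro h; exact pow_eq_zero_iff hp0 |>.1 (by rw [hr c, h])
  have dec : ∀ x : Fin 6 → 𝔽, x = x 0 • (Pi.single 0 1 : Fin 6 → 𝔽) + x 1 • Pi.single 1 1
      + x 2 • Pi.single 2 1 + x 3 • Pi.single 3 1 + x 4 • Pi.single 4 1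
      + x 5 • Pi.single 5 1 := by
    intro x; funext i; fin_cases i <;> simp
  have hVs : ∀ (c : 𝔽) x, V (c • x) = r c • V x := by
    intro c x; conv_lhs => rw [← hr c]
    exact hVsmul _ _
  simp only at hF0 hF1 hF2 hF3 hF4 hF5 hV0 hV1 hV2 hV3 hV4 hV5
  have hFx : ∀ x, F x = x 1 ^ p • (Pi.single 0 1 : Fin 6 → 𝔽) + x 2 ^ p • Pi.single 1 1
      + x 0 ^ p • Pi.single 5 1 := by
    intro x
    conv_lhs => rw [dec x]
    simp only [hFadd, hFsmul, hF0, hF1, hF2, hF3, hF4, hF5, smul_zero, add_zero]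
    abel
  have hVx : ∀ x, V x = (- r (x 2)) • (Pi.single 3 1 : Fin 6 → 𝔽) + r (x 3) • Pi.single 4 1
      + r (x 4) • Pi.single 5 1 := by
    intro x
    conv_lhs => rw [dec x]
    simp only [hVadd, hVs, hV0, hV1, hV2, hV3, hV4, hV5, smul_zero, add_zero, zero_add, smul_neg,
      neg_smul]
  have s5 : Submodule.span 𝔽 {(Pi.single 5 1 : Fin 6 → 𝔽)} = Submodule.span 𝔽
      ((fun i : Fin 6 => (Pi.single i 1 : Fin 6 → 𝔽)) '' (({5} : Finset (Fin 6)) : Set (Fin 6))) := by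
    simp
  have s05 : Submodule.span 𝔽 {(Pi.single 0 1 : Fin 6 → 𝔽), Pi.single 5 1} = Submodule.span 𝔽
      ((fun i : Fin 6 => (Pi.single i 1 : Fin 6 → 𝔽)) ''
        (({0, 5} : Finset (Fin 6)) : Set (Fin 6))) := by
    simp [Set.image_insert_eq]
  have s45 : Submodule.span 𝔽 {(Pi.single 4 1 : Fin 6 → 𝔽), Pi.single 5 1} = Submodule.span 𝔽
      ((fun i : Fin 6 => (Pi.single i 1 : Fin 6 → 𝔽)) ''
        (({4, 5} : Finset (Fin 6)) : Set (Fin 6))) := by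
    simp [Set.image_insert_eq]
  have s045 : Submodule.span 𝔽 {(Pi.single 0 1 : Fin 6 → 𝔽), Pi.single 4 1, Pi.single 5 1} =
      Submodule.span 𝔽 ((fun i : Fin 6 => (Pi.single i 1 : Fin 6 → 𝔽)) ''
        (({0, 4, 5} : Finset (Fin 6)) : Set (Fin 6))) := by
    simp [Set.image_insert_eq]
  have s0145 : Submodule.span 𝔽 {(Pi.single 0 1 : Fin 6 → 𝔽), Pi.single 1 1, Pi.single 4 1,
      Pi.single 5 1} =
      Submodule.span 𝔽 ((fun i : Fin 6 => (Pi.single i 1 : Fin 6 → 𝔽)) ''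
        (({0, 1, 4, 5} : Finset (Fin 6)) : Set (Fin 6))) := by
    simp [Set.image_insert_eq]
  have s0345 : Submodule.span 𝔽 {(Pi.single 0 1 : Fin 6 → 𝔽), Pi.single 3 1, Pi.single 4 1,
      Pi.single 5 1} =
      Submodule.span 𝔽 ((fun i : Fin 6 => (Pi.single i 1 : Fin 6 → 𝔽)) ''
        (({0, 3, 4, 5} : Finset (Fin 6)) : Set (Fin 6))) := by
    simp [Set.image_insert_eq]
  constructor
  · rintro ⟨hiso, h1, h2, h3⟩
    have hW1 : W1 = Submodule.span 𝔽 {(Pi.single 5 1 : Fin 6 → 𝔽)} := by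
      rw [s5]
      obtain ⟨⟨v, hv⟩, hv0, hgen⟩ := finrank_eq_one_iff'.1 hd1
      have hvne : v ≠ 0 := fun h => hv0 (by simp [h])
      obtain ⟨c, hc⟩ := hgen ⟨F v, (h1 v hv).1⟩
      obtain ⟨d, hd⟩ := hgen ⟨V v, (h1 v hv).2⟩
      have hc' : c • v = F v := congrArg Subtype.val hc
      have hd' : d • v = V v := congrArg Subtype.val hd
      rw [hFx] at hc'
      rw [hVx] at hd'
      have c0 := congrFun hc' 0
      have c1 := congrFun hc' 1
      have c2 := congrFun hc' 2
      have c3 := congrFun hc' 3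
      have c4 := congrFun hc' 4
      have c5 := congrFun hc' 5
      have d3 := congrFun hd' 3
      have d4 := congrFun hd' 4
      have d5 := congrFun hd' 5
      have hnz : ¬ (v 0 = 0 ∧ v 1 = 0 ∧ v 2 = 0 ∧ v 3 = 0 ∧ v 4 = 0 ∧ v 5 = 0) := by
        rintro ⟨a0, a1, a2, a3, a4, a5⟩
        apply hvne
        rw [vec_eq v, a0, a1, a2, a3, a4, a5]
        funext i; fin_cases i <;> rfl
      simp at c0 c1 c2 c3 c4 c5 d3 d4 d5
      have hcz : c = 0 := by
        by_contra hne
        simp [hne] at c2 c3 c4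
        simp [c2, hp0, hne] at c1
        simp [c1, hp0, hne] at c0
        simp [c0, hp0, hne] at c5
        exact hnz ⟨c0, c1, c2, c3, c4, c5⟩
      simp [hcz] at c0 c1 c5
      have v0 : v 0 = 0 := by simpa [hp0] using c5.symm
      have v1 : v 1 = 0 := by simpa [hp0] using c0.symm
      have v2 : v 2 = 0 := by simpa [hp0] using c1.symm
      have hdz : d = 0 := by
        by_contra hne
        rw [(r0 _).2 v2] at d3
        simp [hne] at d3
        rw [(r0 _).2 d3] at d4
        simp [hne] at d4
        rw [(r0 _).2 d4] at d5
        simp [hne] at d5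
        exact hnz ⟨v0, v1, v2, d3, d4, d5⟩
      simp [hdz] at d4 d5
      have v3 : v 3 = 0 := (r0 _).1 d4.symm
      have v4 : v 4 = 0 := (r0 _).1 d5.symm
      refine eq_S {5} (by simpa using hd1) ?_
      intro x hx
      obtain ⟨a, ha⟩ := hgen ⟨x, hx⟩
      have ha' : a • v = x := congrArg Subtype.val ha
      rw [← ha']
      intro i hi
      have hi' : v i = 0 := by
        fin_cases i <;> first | exact v0 | exact v1 | exact v2 | exact v3 | exact v4 |
          exact absurd (by decide) hi
      simp [hi']
    have m1 : (Pi.single 5 1 : Fin 6 → 𝔽) ∈ W1 := by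
      rw [hW1]; exact Submodule.mem_span_singleton_self _
    have m2 := hW12 m1
    have m3 := hW23 m2
    have z2 : ∀ x ∈ W3, x 2 = 0 := by
      intro x hx
      have := hiso x hx _ m3
      rw [hB] at this
      simpa using this
    -- `x 1 ≠ 0` puts `e 0` in the space
    have k0 : ∀ W : Submodule 𝔽 (Fin 6 → 𝔽), Pi.single 5 1 ∈ W → W ≤ W3 →
        (∀ x ∈ W, F x ∈ W ∧ V x ∈ W) → ∀ x ∈ W, x 1 ≠ 0 → (Pi.single 0 1 : Fin 6 → 𝔽) ∈ W := by
      intro W h5 hle hst x hx hne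
      have hf := (hst x hx).1
      rw [hFx, z2 x (hle hx), zero_pow hp0, zero_smul, add_zero] at hf
      rw [Submodule.add_mem_iff_left _ (Submodule.smul_mem _ _ h5)] at hf
      exact single_mem (pow_ne_zero p hne) hf
    have k4 : ∀ W : Submodule 𝔽 (Fin 6 → 𝔽), Pi.single 5 1 ∈ W → W ≤ W3 →
        (∀ x ∈ W, F x ∈ W ∧ V x ∈ W) → ∀ x ∈ W, x 3 ≠ 0 → (Pi.single 4 1 : Fin 6 → 𝔽) ∈ W := by
      intro W h5 hle hst x hx hne
      have hf := (hst x hx).2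
      rw [hVx, z2 x (hle hx), (r0 0).2 rfl, neg_zero, zero_smul, zero_add] at hf
      rw [Submodule.add_mem_iff_left _ (Submodule.smul_mem _ _ h5)] at hf
      exact single_mem (fun h => hne ((r0 _).1 h)) hf
    -- a two dimensional space containing two basis vectors is their span
    have two : ∀ j : Fin 6, j ≠ 5 → (Pi.single j 1 : Fin 6 → 𝔽) ∈ W2 →
        ∀ x ∈ W2, ∀ i, i ≠ j → i ≠ 5 → x i = 0 := by
      intro j hj hm x hx i hij hi5
      have hle : Submodule.span 𝔽 ((fun i : Fin 6 => (Pi.single i 1 : Fin 6 → 𝔽)) ''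
        (({j, 5} : Finset (Fin 6)) : Set (Fin 6))) ≤ W2 := by
        rw [Submodule.span_le]
        rintro _ ⟨k, hk, rfl⟩
        simp only [Finset.coe_insert, Finset.coe_singleton, Set.mem_insert_iff,
          Set.mem_singleton_iff] at hk
        rcases hk with rfl | rfl
        · exact hm
        · exact m2
      have heq := Submodule.eq_of_le_of_finrank_eq hle (by
        rw [finrank_S, hd2, Finset.card_pair hj])
      rw [← heq] at hx
      exact mem_S.1 hx i (by simp [hij, hi5])
    have y1 : ∀ x ∈ W2, x 1 = 0 := by
      intro x hx
      by_contra hne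
      exact hne (two 0 (by decide) (k0 W2 m2 hW23 h2 x hx hne) x hx 1 (by decide) (by decide))
    have y3 : ∀ x ∈ W2, x 3 = 0 := by
      intro x hx
      by_contra hne
      exact hne (two 4 (by decide) (k4 W2 m2 hW23 h2 x hx hne) x hx 3 (by decide) (by decide))
    have q3 : (Pi.single 0 1 : Fin 6 → 𝔽) ∈ W3 → ∀ x ∈ W3, x 3 = 0 := by
      intro hm x hx
      have := hiso x hx _ hm
      rw [hB] at this
      simpa using this
    have q1 : (Pi.single 4 1 : Fin 6 → 𝔽) ∈ W3 → ∀ x ∈ W3, x 1 = 0 := by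
      intro hm x hx
      have := hiso x hx _ hm
      rw [hB] at this
      simpa using this
    refine ⟨hW1, ?_⟩
    by_cases ha : ∃ z ∈ W3, z 1 ≠ 0
    · left
      obtain ⟨z, hz, hz1⟩ := ha
      have e0 := k0 W3 m3 le_rfl h3 z hz hz1
      have hz3 := q3 e0
      constructor
      · rw [s05]
        refine eq_S {0, 5} (by simpa using hd2) ?_
        intro y hy i hi
        have a1 := y1 y hy
        have a2 := z2 y (hW23 hy)
        have a3 := y3 y hy
        have a4 : y 4 = 0 := by
          have := hiso z hz y (hW23 hy)
          rw [hB, a1, a2, a3, z2 z hz, hz3 z hz] at this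
          simpa [hz1] using this
        fin_cases i <;> first | exact a1 | exact a2 | exact a3 | exact a4 | exact a0 | exact absurd (by decide) hi
      · rw [s0145]
        intro x hx
        rw [mem_S]
        intro i hi
        have a2 := z2 x hx
        have a3 := hz3 x hx
        fin_cases i <;> first | exact a1 | exact a2 | exact a3 | exact a4 | exact a0 | exact absurd (by decide) hi
    · by_cases hb : ∃ z ∈ W3, z 3 ≠ 0
      · right; left
        obtain ⟨z, hz, hzne⟩ := hb
        have e4 := k4 W3 m3 le_rfl h3 z hz hzne
        have hz1 := q1 e4
        constructor
        · rw [s45]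
          refine eq_S {4, 5} (by simpa using hd2) ?_
          intro y hy i hi
          have a1 := y1 y hy
          have a2 := z2 y (hW23 hy)
          have a3 := y3 y hy
          have a0 : y 0 = 0 := by
            have := hiso z hz y (hW23 hy)
            rw [hB, a1, a2, a3, z2 z hz, hz1 z hz] at this
            simpa [hzne] using this
          fin_cases i <;> first | exact a1 | exact a2 | exact a3 | exact a4 | exact a0 | exact absurd (by decide) hi
        · rw [s0345]
          intro x hx
          rw [mem_S]
          intro i hi
          have a2 := z2 x hx
          have a1 := hz1 x hx
          fin_cases i <;> first | exact a1 | exact a2 | exact a3 | exact a4 | exact a0 | exact absurd (by decide) hi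
      · right; right
        push Not at ha hb
        rw [s045]
        refine eq_S {0, 4, 5} (by simpa using hd3) ?_
        intro x hx i hi
        have a1 := ha x hx
        have a2 := z2 x hx
        have a3 := hb x hx
        fin_cases i <;> first | exact a1 | exact a2 | exact a3 | exact a4 | exact a0 | exact absurd (by decide) hi
  · rintro ⟨hW1, hcases⟩
    have m1 : (Pi.single 5 1 : Fin 6 → 𝔽) ∈ W1 := by
      rw [hW1]; exact Submodule.mem_span_singleton_self _
    have m2 := hW12 m1
    have m3 := hW23 m2
    have st1 : ∀ x ∈ W1, F x ∈ W1 ∧ V x ∈ W1 := by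
      intro x hx
      have hx' := hx
      rw [hW1, s5, mem_S] at hx'
      rw [hFx, hVx, hx' 0 (by decide), hx' 1 (by decide), hx' 2 (by decide), hx' 3 (by decide),
        hx' 4 (by decide), (r0 0).2 rfl]
      simp [hp0]
    -- stability from vanishing coordinates
    have st : ∀ W : Submodule 𝔽 (Fin 6 → 𝔽), Pi.single 5 1 ∈ W → (∀ x ∈ W, x 2 = 0) →
        ((Pi.single 0 1 : Fin 6 → 𝔽) ∈ W ∨ ∀ x ∈ W, x 1 = 0) →
        ((Pi.single 4 1 : Fin 6 → 𝔽) ∈ W ∨ ∀ x ∈ W, x 3 = 0) →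
        ∀ x ∈ W, F x ∈ W ∧ V x ∈ W := by
      intro W h5 hz ha hb x hx
      rw [hFx, hVx, hz x hx, (r0 0).2 rfl, zero_pow hp0, neg_zero, zero_smul, zero_smul, add_zero,
        zero_add]
      constructor
      · refine W.add_mem ?_ (W.smul_mem _ h5)
        rcases ha with ha | ha
        · exact W.smul_mem _ ha
        · rw [ha x hx, zero_pow hp0, zero_smul]; exact W.zero_mem
      · refine W.add_mem ?_ (W.smul_mem _ h5)
        rcases hb with hb | hb
        · exact W.smul_mem _ hb
        · rw [hb x hx, (r0 0).2 rfl, zero_smul]; exact W.zero_mem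
    rcases hcases with ⟨hW2, hW3⟩ | ⟨hW2, hW3⟩ | hW3
    · rw [s0145] at hW3
      have c2 : ∀ x ∈ W3, x 2 = 0 := fun x hx => mem_S.1 (hW3 hx) 2 (by decide)
      have c3 : ∀ x ∈ W3, x 3 = 0 := fun x hx => mem_S.1 (hW3 hx) 3 (by decide)
      have e0 : (Pi.single 0 1 : Fin 6 → 𝔽) ∈ W2 := by
        rw [hW2]; exact Submodule.subset_span (by simp)
      have c1 : ∀ x ∈ W2, x 1 = 0 := by
        intro x hx; rw [hW2, s05] at hx; exact mem_S.1 hx 1 (by decide)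
      refine ⟨?_, st1, st W2 m2 (fun x hx => c2 x (hW23 hx)) (Or.inl e0)
        (Or.inr fun x hx => c3 x (hW23 hx)), st W3 m3 c2 (Or.inl (hW23 e0)) (Or.inr c3)⟩
      intro x hx y hy
      rw [hB, c2 x hx, c2 y hy, c3 x hx, c3 y hy]
      by_contra hne
      have hD : x 1 * y 4 - x 4 * y 1 ≠ 0 := by
        intro h; apply hne; rw [h]; ring
      have f1 : (Pi.single 1 1 : Fin 6 → 𝔽) ∈ W3 := by
        apply single_mem hD
        have : (x 1 * y 4 - x 4 * y 1) • (Pi.single 1 1 : Fin 6 → 𝔽) = y 4 • x - x 4 • y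
            - (y 4 * x 0 - x 4 * y 0) • Pi.single 0 1 - (y 4 * x 5 - x 4 * y 5) • Pi.single 5 1 := by
          funext i; fin_cases i <;> simp [c2 x hx, c2 y hy, c3 x hx, c3 y hy] <;> ring
        rw [this]
        exact W3.sub_mem (W3.sub_mem (W3.sub_mem (W3.smul_mem _ hx) (W3.smul_mem _ hy))
          (W3.smul_mem _ (hW23 e0))) (W3.smul_mem _ m3)
      have f4 : (Pi.single 4 1 : Fin 6 → 𝔽) ∈ W3 := by
        apply single_mem hD
        have : (x 1 * y 4 - x 4 * y 1) • (Pi.single 4 1 : Fin 6 → 𝔽) = x 1 • y - y 1 • x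
            - (x 1 * y 0 - y 1 * x 0) • Pi.single 0 1 - (x 1 * y 5 - y 1 * x 5) • Pi.single 5 1 := by
          funext i; fin_cases i <;> simp [c2 x hx, c2 y hy, c3 x hx, c3 y hy] <;> ring
        rw [this]
        exact W3.sub_mem (W3.sub_mem (W3.sub_mem (W3.smul_mem _ hy) (W3.smul_mem _ hx))
          (W3.smul_mem _ (hW23 e0))) (W3.smul_mem _ m3)
      have := card_le_of_mem (W := W3) {0, 1, 4, 5} (by
        intro i hi
        simp only [Finset.mem_insert, Finset.mem_singleton] at hi
        rcases hi with rfl | rfl | rfl | rfl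
        exacts [hW23 e0, f1, f4, m3])
      rw [hd3] at this
      exact absurd this (by decide)
    · rw [s0345] at hW3
      have c2 : ∀ x ∈ W3, x 2 = 0 := fun x hx => mem_S.1 (hW3 hx) 2 (by decide)
      have c1 : ∀ x ∈ W3, x 1 = 0 := fun x hx => mem_S.1 (hW3 hx) 1 (by decide)
      have e4 : (Pi.single 4 1 : Fin 6 → 𝔽) ∈ W2 := by
        rw [hW2]; exact Submodule.subset_span (by simp)
      refine ⟨?_, st1, st W2 m2 (fun x hx => c2 x (hW23 hx)) (Or.inr fun x hx => c1 x (hW23 hx))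
        (Or.inl e4), st W3 m3 c2 (Or.inr c1) (Or.inl (hW23 e4))⟩
      intro x hx y hy
      rw [hB, c2 x hx, c2 y hy, c1 x hx, c1 y hy]
      by_contra hne
      have hD : x 0 * y 3 - x 3 * y 0 ≠ 0 := by
        intro h; apply hne; rw [h]; ring
      have f0 : (Pi.single 0 1 : Fin 6 → 𝔽) ∈ W3 := by
        apply single_mem hD
        have : (x 0 * y 3 - x 3 * y 0) • (Pi.single 0 1 : Fin 6 → 𝔽) = y 3 • x - x 3 • y
            - (y 3 * x 4 - x 3 * y 4) • Pi.single 4 1 - (y 3 * x 5 - x 3 * y 5) • Pi.single 5 1 := by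
          funext i; fin_cases i <;> simp [c2 x hx, c2 y hy, c1 x hx, c1 y hy] <;> ring
        rw [this]
        exact W3.sub_mem (W3.sub_mem (W3.sub_mem (W3.smul_mem _ hx) (W3.smul_mem _ hy))
          (W3.smul_mem _ (hW23 e4))) (W3.smul_mem _ m3)
      have f3 : (Pi.single 3 1 : Fin 6 → 𝔽) ∈ W3 := by
        apply single_mem hD
        have : (x 0 * y 3 - x 3 * y 0) • (Pi.single 3 1 : Fin 6 → 𝔽) = x 0 • y - y 0 • x
            - (x 0 * y 4 - y 0 * x 4) • Pi.single 4 1 - (x 0 * y 5 - y 0 * x 5) • Pi.single 5 1 := by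
          funext i; fin_cases i <;> simp [c2 x hx, c2 y hy, c1 x hx, c1 y hy] <;> ring
        rw [this]
        exact W3.sub_mem (W3.sub_mem (W3.sub_mem (W3.smul_mem _ hy) (W3.smul_mem _ hx))
          (W3.smul_mem _ (hW23 e4))) (W3.smul_mem _ m3)
      have := card_le_of_mem (W := W3) {0, 3, 4, 5} (by
        intro i hi
        simp only [Finset.mem_insert, Finset.mem_singleton] at hi
        rcases hi with rfl | rfl | rfl | rfl
        exacts [f0, f3, hW23 e4, m3])
      rw [hd3] at this
      exact absurd this (by decide)
    · have hW3' := hW3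
      rw [s045] at hW3'
      have cc : ∀ x ∈ W3, x 1 = 0 ∧ x 2 = 0 ∧ x 3 = 0 := by
        intro x hx
        rw [hW3', mem_S] at hx
        exact ⟨hx 1 (by decide), hx 2 (by decide), hx 3 (by decide)⟩
      refine ⟨?_, st1, st W2 m2 (fun x hx => (cc x (hW23 hx)).2.1)
        (Or.inr fun x hx => (cc x (hW23 hx)).1) (Or.inr fun x hx => (cc x (hW23 hx)).2.2),
        st W3 m3 (fun x hx => (cc x hx).2.1)
        (Or.inr fun x hx => (cc x hx).1) (Or.inr fun x hx => (cc x hx).2.2)⟩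
      intro x hx y hy
      obtain ⟨a1, a2, a3⟩ := cc x hx
      obtain ⟨b1, b2, b3⟩ := cc y hy
      rw [hB, a1, a2, a3, b1, b2, b3]
      ring
end
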